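/- There exists a homeomorphism H of the Sierpiński carpet S onto itself and a Borel probability measure μ on S such that μ is H-invariant, has full support, and the system (S, H, μ) is Bernoulli. -/

import Mathlib

open MeasureTheory

/-- The Sierpiński carpet: points of `[0,1]²` admitting ternary expansions with no index at
which both digits equal `1`. -/
def sierpinskiCarpet : Set (ℝ × ℝ) :=
  {p | ∃ a b : ℕ → Fin 3, (∀ i, ¬(a i = 1 ∧ b i = 1)) ∧
    p.1 = ∑' i : ℕ, (a i : ℝ) / 3 ^ (i + 1) ∧ p.2 = ∑' i : ℕ, (b i : ℝ) / 3 ^ (i + 1)}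


/-- `(X, T, μ)` is a Bernoulli system: there are a finite alphabet `A` with a probability
measure `p` and a measure-theoretic isomorphism `φ` from the two-sided product space
`(A^ℤ, p^⊗ℤ)` (the product measure `ν` is characterized by its values on cylinder sets)
to `(X, μ)` intertwining the left shift with `T` almost everywhere. -/
def IsBernoulliSystem {X : Type*} [MeasurableSpace X] (T : X → X) (μ : Measure X) : Prop :=
  ∃ (A : Type) (_ : Fintype A),
    letI : MeasurableSpace A := ⊤
    ∃ (p : Measure A) (ν : Measure (ℤ → A)),
      IsProbabilityMeasure p ∧ IsProbabilityMeasure ν ∧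
      (∀ (F : Finset ℤ) (B : ℤ → Set A),
        ν {ω : ℤ → A | ∀ i ∈ F, ω i ∈ B i} = ∏ i ∈ F, p (B i)) ∧
      ∃ φ : (ℤ → A) → X,
        Measurable φ ∧ MeasurePreserving φ ν μ ∧
        (∃ ψ : X → (ℤ → A), Measurable ψ ∧ MeasurePreserving ψ μ ν ∧
          (∀ᵐ ω ∂ν, ψ (φ ω) = ω) ∧ (∀ᵐ x ∂μ, φ (ψ x) = x)) ∧
        (∀ᵐ ω ∂ν, φ (fun i => ω (i + 1)) = T (φ ω))

open Set Filter Topology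

/-- The unit vector in the direction of `v` (and `0` if `v = 0`). -/
noncomputable def dir (v : ℝ × ℝ) : ℝ × ℝ := ‖v‖⁻¹ • v

theorem norm_dir {v : ℝ × ℝ} (hv : v ≠ 0) : ‖dir v‖ = 1 := by
  rw [dir, norm_smul, norm_inv, norm_norm, inv_mul_cancel₀ (norm_ne_zero_iff.2 hv)]

theorem dir_smul {r : ℝ} (hr : 0 < r) (v : ℝ × ℝ) : dir (r • v) = dir v := by
  rw [dir, dir, norm_smul, Real.norm_of_nonneg hr.le, smul_smul, mul_inv, mul_right_comm,
    inv_mul_cancel₀ hr.ne', one_mul]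

theorem dir_of_norm_eq_one {v : ℝ × ℝ} (hv : ‖v‖ = 1) : dir v = v := by
  rw [dir, hv, inv_one, one_smul]

theorem norm_smul_dir (v : ℝ × ℝ) : ‖v‖ • dir v = v := by
  rcases eq_or_ne v 0 with rfl | hv
  · simp [dir]
  · rw [dir, smul_smul, mul_inv_cancel₀ (norm_ne_zero_iff.2 hv), one_smul]

theorem dir_map_dir (A : (ℝ × ℝ) →L[ℝ] (ℝ × ℝ)) {v : ℝ × ℝ} (hv : v ≠ 0) :
    dir (A (dir v)) = dir (A v) := by
  conv_rhs => rw [← norm_smul_dir v, map_smul, dir_smul (norm_pos_iff.2 hv)]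

theorem continuousAt_dir {v : ℝ × ℝ} (hv : v ≠ 0) : ContinuousAt dir v :=
  (continuousAt_id.norm.inv₀ (norm_ne_zero_iff.2 hv)).smul continuousAt_id

theorem norm_dir_sub_dir_le {u v : ℝ × ℝ} (hu : u ≠ 0) (hv : v ≠ 0) :
    ‖dir u - dir v‖ ≤ 2 * ‖u - v‖ / ‖v‖ := by
  have hu' := norm_pos_iff.2 hu
  have hv' := norm_pos_iff.2 hv
  have h : dir u - dir v = ‖v‖⁻¹ • ((u - v) + (‖v‖ - ‖u‖) • dir u) := by
    rw [sub_smul, norm_smul_dir, dir, dir]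
    rw [smul_add, smul_sub, smul_sub, smul_smul, inv_mul_cancel₀ hv'.ne', one_smul]
    abel
  rw [h, norm_smul, norm_inv, norm_norm, inv_mul_eq_div]
  gcongr
  refine (norm_add_le _ _).trans ?_
  rw [norm_smul, norm_dir hu, mul_one]
  have := abs_norm_sub_norm_le v u
  rw [norm_sub_rev] at this
  rw [Real.norm_eq_abs]
  linarith

/-- The filter of points approaching `p` from the direction `ω`. -/
noncomputable def dirFilter (p ω : ℝ × ℝ) : Filter (ℝ × ℝ) :=
  𝓝[≠] p ⊓ comap (fun z => dir (z - p)) (𝓝 ω)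

theorem tendsto_dirFilter {ι : Type*} {l : Filter ι} {f : ι → ℝ × ℝ} {p ω : ℝ × ℝ} :
    Tendsto f l (dirFilter p ω) ↔
      Tendsto f l (𝓝[≠] p) ∧ Tendsto (fun i => dir (f i - p)) l (𝓝 ω) := by
  rw [dirFilter, tendsto_inf, tendsto_comap_iff]
  rfl

/-- `f` acts on the directions at `p` as the linear map `A`. -/
def DirAt (f : ℝ × ℝ → ℝ × ℝ) (p : ℝ × ℝ) (A : (ℝ × ℝ) ≃L[ℝ] (ℝ × ℝ)) : Prop :=
  ∀ ω, ‖ω‖ = 1 → Tendsto f (dirFilter p ω) (dirFilter (f p) (dir (A ω)))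

theorem ne_zero_of_norm_eq_one {ω : ℝ × ℝ} (h : ‖ω‖ = 1) : ω ≠ 0 :=
  norm_ne_zero_iff.1 (by rw [h]; exact one_ne_zero)

theorem ContinuousLinearEquiv.apply_ne_zero (A : (ℝ × ℝ) ≃L[ℝ] (ℝ × ℝ)) {ω : ℝ × ℝ}
    (h : ω ≠ 0) : A ω ≠ 0 := by simpa using h

theorem DirAt.comp {f g : ℝ × ℝ → ℝ × ℝ} {p : ℝ × ℝ} {A B : (ℝ × ℝ) ≃L[ℝ] (ℝ × ℝ)}
    (hg : DirAt g (f p) B) (hf : DirAt f p A) : DirAt (g ∘ f) p (A.trans B) := by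
  intro ω hω
  have hA := A.apply_ne_zero (ne_zero_of_norm_eq_one hω)
  have := (hg _ (norm_dir hA)).comp (hf ω hω)
  rwa [← ContinuousLinearEquiv.coe_coe B, dir_map_dir _ hA] at this

theorem HasFDerivAt.dirAt {f : ℝ × ℝ → ℝ × ℝ} {p : ℝ × ℝ} {A : (ℝ × ℝ) ≃L[ℝ] (ℝ × ℝ)}
    (hf : HasFDerivAt f (A : (ℝ × ℝ) →L[ℝ] (ℝ × ℝ)) p) : DirAt f p A := by
  intro ω hω
  have hA := A.apply_ne_zero (ne_zero_of_norm_eq_one hω)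
  have hle : dirFilter p ω ≤ 𝓝[≠] p := inf_le_left
  have hne : ∀ᶠ z in dirFilter p ω, z ≠ p := hle self_mem_nhdsWithin
  have hdir : Tendsto (fun z => dir (z - p)) (dirFilter p ω) (𝓝 ω) :=
    (tendsto_dirFilter.1 tendsto_id).2
  have hlim : Tendsto (fun z => ‖z - p‖⁻¹ • (f z - f p)) (dirFilter p ω) (𝓝 (A ω)) := by
    have h1 : Tendsto (fun z => ‖z - p‖⁻¹ • (f z - f p - A (z - p))) (dirFilter p ω) (𝓝 0) := by
      have := (hasFDerivAt_iff_tendsto.1 hf).mono_left (hle.trans nhdsWithin_le_nhds)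
      rw [tendsto_zero_iff_norm_tendsto_zero]
      simpa [norm_smul] using this
    have h2 : Tendsto (fun z => A (dir (z - p))) (dirFilter p ω) (𝓝 (A ω)) :=
      (A.continuous.tendsto ω).comp hdir
    have h3 := h1.add h2
    rw [zero_add] at h3
    refine h3.congr fun z => ?_
    rw [dir, map_smul, ← smul_add, sub_add_cancel]
  have hev : ∀ᶠ z in dirFilter p ω, f z - f p ≠ 0 := by
    filter_upwards [hlim.eventually_ne hA] with z hz h0
    rw [h0, smul_zero] at hz
    exact hz rfl
  rw [tendsto_dirFilter]
  refine ⟨tendsto_nhdsWithin_iff.2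
    ⟨(hf.continuousAt.tendsto).mono_left (hle.trans nhdsWithin_le_nhds), ?_⟩, ?_⟩
  · filter_upwards [hev] with z hz using sub_ne_zero.1 hz
  · refine ((continuousAt_dir hA).tendsto.comp hlim).congr' ?_
    filter_upwards [hne] with z hz
    exact dir_smul (inv_pos.2 (norm_pos_iff.2 (sub_ne_zero.2 hz))) _

theorem DirAt.congr {f g : ℝ × ℝ → ℝ × ℝ} {p : ℝ × ℝ} {A : (ℝ × ℝ) ≃L[ℝ] (ℝ × ℝ)}
    (hf : DirAt f p A) (h : f =ᶠ[𝓝 p] g) : DirAt g p A := by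
  intro ω hω
  rw [← h.eq_of_nhds]
  exact (hf ω hω).congr' (h.filter_mono (inf_le_left.trans nhdsWithin_le_nhds))

/-- The local inverse of a map acting linearly on directions acts by the inverse linear map. -/
theorem DirAt.symm {f g : ℝ × ℝ → ℝ × ℝ} {p : ℝ × ℝ} {A : (ℝ × ℝ) ≃L[ℝ] (ℝ × ℝ)}
    (hf : DirAt f p A) (hg : ContinuousAt g (f p)) (hgf : g (f p) = p)
    (hfg : ∀ᶠ w in 𝓝 (f p), f (g w) = w) : DirAt g (f p) A.symm := by
  intro ω hω
  rw [hgf, tendsto_iff_ultrafilter]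
  intro U hU
  have hUle : (U : Filter (ℝ × ℝ)) ≤ 𝓝[≠] (f p) := hU.trans inf_le_left
  have hUn := hUle.trans nhdsWithin_le_nhds
  have hne : ∀ᶠ w in (U : Filter (ℝ × ℝ)), g w ≠ p := by
    filter_upwards [hUn hfg, hUle self_mem_nhdsWithin] with w hw hw' h
    apply hw'
    change w = f p
    rw [← hw, h]
  have hgp : Tendsto g U (𝓝[≠] p) := by
    refine tendsto_nhdsWithin_iff.2 ⟨?_, hne⟩
    have := hg.tendsto.mono_left hUn
    rwa [hgf] at this
  have hsph : IsCompact (Metric.sphere (0 : ℝ × ℝ) 1) := isCompact_sphere _ _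
  obtain ⟨ω', hω', hlim⟩ := hsph.ultrafilter_le_nhds (U.map fun w => dir (g w - p)) (by
    rw [Ultrafilter.coe_map, le_principal_iff, mem_map]
    filter_upwards [hne] with w hw
    simpa using norm_dir (sub_ne_zero.2 hw))
  have hω1 : ‖ω'‖ = 1 := by simpa using hω'
  have hgd : Tendsto g U (dirFilter p ω') := tendsto_dirFilter.2 ⟨hgp, hlim⟩
  have h1 := (tendsto_dirFilter.1 ((hf ω' hω1).comp hgd)).2
  have h2 : Tendsto (fun w => dir (w - f p)) U (𝓝 ω) :=
    (tendsto_dirFilter.1 (tendsto_id.mono_left hU)).2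
  have h3 : dir (A ω') = ω := by
    refine tendsto_nhds_unique (h1.congr' ?_) h2
    filter_upwards [hUn hfg] with w hw
    simp only [Function.comp_apply, hw]
  have h4 : dir (A.symm ω) = ω' := by
    rw [← h3, ← ContinuousLinearEquiv.coe_coe A.symm,
      dir_map_dir _ (A.apply_ne_zero (ne_zero_of_norm_eq_one hω1)),
      ContinuousLinearEquiv.coe_coe, A.symm_apply_apply, dir_of_norm_eq_one hω1]
  rw [h4]
  exact hgd

/-- An endomorphism of the plane with trivial kernel is an isomorphism. -/
theorem exists_continuousLinearEquiv_coe_eq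
    {L : (ℝ × ℝ) →L[ℝ] (ℝ × ℝ)} (hL : ∀ h, L h = 0 → h = 0) :
    ∃ A : (ℝ × ℝ) ≃L[ℝ] (ℝ × ℝ), (A : (ℝ × ℝ) →L[ℝ] (ℝ × ℝ)) = L := by
  have hinj : Function.Injective (L : (ℝ × ℝ) →ₗ[ℝ] (ℝ × ℝ)) := by
    rw [← LinearMap.ker_eq_bot, LinearMap.ker_eq_bot']
    exact hL
  refine ⟨(LinearEquiv.ofInjectiveEndo (L : (ℝ × ℝ) →ₗ[ℝ] (ℝ × ℝ)) hinj).toContinuousLinearEquiv, ?_⟩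
  exact ContinuousLinearMap.ext fun x => rfl

/-- A radial map `z ↦ φ z • z` with nondegenerate radial derivative has invertible derivative. -/
theorem exists_equiv_hasStrictFDerivAt_smul_self {φ : ℝ × ℝ → ℝ} {z : ℝ × ℝ}
    {L : (ℝ × ℝ) →L[ℝ] ℝ} (hφ : HasStrictFDerivAt φ L z) (h0 : φ z ≠ 0) (h1 : φ z + L z ≠ 0) :
    ∃ A : (ℝ × ℝ) ≃L[ℝ] (ℝ × ℝ),
      HasStrictFDerivAt (fun z => φ z • z) (A : (ℝ × ℝ) →L[ℝ] (ℝ × ℝ)) z := by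
  have h := hφ.smul (hasStrictFDerivAt_id z)
  obtain ⟨A, hA⟩ := exists_continuousLinearEquiv_coe_eq
    (L := φ z • ContinuousLinearMap.id ℝ (ℝ × ℝ) + L.smulRight z) (by
      intro v hv
      have hv' : φ z • v + L v • z = 0 := by simpa using hv
      have h2 : φ z * L v + L v * L z = 0 := by
        have := congrArg L hv'
        simpa using this
      have h3 : L v = 0 := by
        have : L v * (φ z + L z) = 0 := by linarith
        exact (mul_eq_zero.1 this).resolve_right h1
      rw [h3, zero_smul, add_zero] at hv'
      exact (smul_eq_zero.1 hv').resolve_left h0)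
  exact ⟨A, by rw [hA]; exact h⟩

/-- A homeomorphism of the plane, uniformly continuous in both directions, with invertible
derivative everywhere. -/
structure IsUniformDiffeo (θ : (ℝ × ℝ) ≃ₜ (ℝ × ℝ)) : Prop where
  uniformContinuous : UniformContinuous θ
  uniformContinuous_symm : UniformContinuous θ.symm
  exists_hasFDerivAt : ∀ x, ∃ A : (ℝ × ℝ) ≃L[ℝ] (ℝ × ℝ),
    HasFDerivAt θ (A : (ℝ × ℝ) →L[ℝ] (ℝ × ℝ)) x

theorem IsUniformDiffeo.trans {θ g : (ℝ × ℝ) ≃ₜ (ℝ × ℝ)} (hθ : IsUniformDiffeo θ)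
    (hg : IsUniformDiffeo g) : IsUniformDiffeo (θ.trans g) where
  uniformContinuous := hg.uniformContinuous.comp hθ.uniformContinuous
  uniformContinuous_symm := hθ.uniformContinuous_symm.comp hg.uniformContinuous_symm
  exists_hasFDerivAt x := by
    obtain ⟨A, hA⟩ := hθ.exists_hasFDerivAt x
    obtain ⟨B, hB⟩ := hg.exists_hasFDerivAt (θ x)
    exact ⟨A.trans B, hB.comp x hA⟩

theorem exists_isUniformDiffeo_add {β : ℝ × ℝ → ℝ} {K : NNReal} {w : ℝ × ℝ}
    (hβ : LipschitzWith K β) (hd : Differentiable ℝ β) (hw : K * ‖w‖ ≤ 1 / 2) :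
    ∃ g : (ℝ × ℝ) ≃ₜ (ℝ × ℝ), IsUniformDiffeo g ∧ ∀ z, g z = z + β z • w := by
  have hap : ApproximatesLinearOn (fun z => z + β z • w)
      ((ContinuousLinearEquiv.refl ℝ (ℝ × ℝ) : (ℝ × ℝ) ≃L[ℝ] (ℝ × ℝ)) :
        (ℝ × ℝ) →L[ℝ] (ℝ × ℝ)) univ (1 / 2) := by
    intro x _ y _
    have h1 : x + β x • w - (y + β y • w) - (x - y) = (β x - β y) • w := by
      rw [sub_smul]; abel
    have h2 := hβ.dist_le_mul x y
    rw [Real.dist_eq, dist_eq_norm] at h2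
    change ‖x + β x • w - (y + β y • w) - (x - y)‖ ≤ _
    rw [h1, norm_smul, Real.norm_eq_abs]
    calc |β x - β y| * ‖w‖ ≤ (K * ‖x - y‖) * ‖w‖ := by gcongr
      _ = (K * ‖w‖) * ‖x - y‖ := by ring
      _ ≤ _ := by
        push_cast
        gcongr
  have hN : ‖((ContinuousLinearEquiv.refl ℝ (ℝ × ℝ)).symm : (ℝ × ℝ) →L[ℝ] (ℝ × ℝ))‖₊ = 1 := by
    have : ‖((ContinuousLinearEquiv.refl ℝ (ℝ × ℝ)).symm : (ℝ × ℝ) →L[ℝ] (ℝ × ℝ))‖ = 1 :=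
      ContinuousLinearMap.norm_id
    exact NNReal.eq this
  have hc : Subsingleton (ℝ × ℝ) ∨ (1 / 2 : NNReal) <
      ‖((ContinuousLinearEquiv.refl ℝ (ℝ × ℝ)).symm : (ℝ × ℝ) →L[ℝ] (ℝ × ℝ))‖₊⁻¹ := by
    right
    rw [hN, inv_one]
    exact NNReal.half_lt_self one_ne_zero
  let g := hap.toHomeomorph _ hc
  have hg : ∀ z, g z = z + β z • w := fun z => rfl
  refine ⟨g, ⟨?_, ?_, ?_⟩, hg⟩
  · have : (g : ℝ × ℝ → ℝ × ℝ) = fun z => z + β z • w := funext hg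
    rw [this]
    have hl : LipschitzWith ‖w‖₊ fun r : ℝ => r • w :=
      LipschitzWith.of_dist_le_mul fun r r' => by
        rw [dist_eq_norm, dist_eq_norm, ← sub_smul, norm_smul, mul_comm, coe_nnnorm]
    exact uniformContinuous_id.add (hl.uniformContinuous.comp hβ.uniformContinuous)
  · have hanti : AntilipschitzWith 2 g := by
      refine AntilipschitzWith.of_le_mul_dist fun x y => ?_
      have h1 := hap x (mem_univ _) y (mem_univ _)
      change ‖g x - g y - (x - y)‖ ≤ _ at h1
      have h2 := norm_sub_norm_le (x - y) (g x - g y)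
      rw [norm_sub_rev (x - y) (g x - g y)] at h2
      rw [dist_eq_norm, dist_eq_norm]
      push_cast at h1 ⊢
      linarith
    exact (hanti.to_rightInverse g.apply_symm_apply).uniformContinuous
  · intro x
    have hβx := (hd x).hasFDerivAt
    have hK : ‖fderiv ℝ β x‖ ≤ K := norm_fderiv_le_of_lipschitz ℝ hβ
    have h := (hasFDerivAt_id x).add (hβx.smul_const w)
    obtain ⟨A, hA⟩ := exists_continuousLinearEquiv_coe_eq
      (L := ContinuousLinearMap.id ℝ (ℝ × ℝ) + (fderiv ℝ β x).smulRight w) (by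
        intro v hv
        have hv' : v = - (fderiv ℝ β x v • w) := by
          rw [← sub_eq_zero, sub_neg_eq_add]
          simpa using hv
        have h1 : ‖v‖ ≤ 1 / 2 * ‖v‖ := by
          calc ‖v‖ = ‖fderiv ℝ β x v‖ * ‖w‖ := by
                conv_lhs => rw [hv', norm_neg, norm_smul]
            _ ≤ (‖fderiv ℝ β x‖ * ‖v‖) * ‖w‖ := by
                gcongr
                exact (fderiv ℝ β x).le_opNorm v
            _ ≤ (K * ‖v‖) * ‖w‖ := by gcongr
            _ = (K * ‖w‖) * ‖v‖ := by ring
            _ ≤ _ := by gcongr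
        exact norm_le_zero_iff.1 (by linarith))
    exact ⟨A, by rw [hA]; exact h⟩

/-- Near a point off a finite set, points can be pushed to each other by small diffeomorphisms
which fix a neighbourhood of the finite set and hardly change directions seen from it. -/
theorem exists_push (a : ℝ × ℝ) (F : Finset (ℝ × ℝ)) (ha : a ∉ F) {ε : ℝ} (hε : 0 < ε) :
    ∃ δ > 0, ∀ x ∈ Metric.ball a δ, ∀ y ∈ Metric.ball a δ, ∃ g : (ℝ × ℝ) ≃ₜ (ℝ × ℝ),
      IsUniformDiffeo g ∧ g x = y ∧ (∀ z, ‖g z - z‖ ≤ ε) ∧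
      ∀ f ∈ F, g =ᶠ[𝓝 f] id ∧ ∀ z, z ≠ f → ‖dir (g z - f) - dir (z - f)‖ ≤ ε := by
  obtain ⟨r, hr, hrF⟩ : ∃ r > 0, ∀ f ∈ F, 2 * r ≤ dist a f := by
    have hopen : IsOpen ((F : Set (ℝ × ℝ))ᶜ) := F.finite_toSet.isClosed.isOpen_compl
    obtain ⟨r, hr, h⟩ := Metric.isOpen_iff.1 hopen a (by simpa using ha)
    refine ⟨r / 2, half_pos hr, fun f hf => ?_⟩
    by_contra hlt
    push Not at hlt
    have hmem : f ∈ Metric.ball a r := by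
      rw [Metric.mem_ball, dist_comm]
      linarith
    exact h hmem hf
  let b : ContDiffBump a := ⟨r / 2, r, half_pos hr, half_lt_self hr⟩
  obtain ⟨K, hK⟩ := ContDiff.lipschitzWith_of_hasCompactSupport (𝕂 := ℝ) b.hasCompactSupport
    (b.contDiff (n := 1)) (by simp)
  have hdiff : Differentiable ℝ b := (b.contDiff (n := 1)).differentiable (by simp)
  obtain ⟨η, hη, hη1, hη2, hη3⟩ : ∃ η : ℝ, 0 < η ∧ K * η ≤ 1 / 2 ∧ η ≤ ε ∧ 2 * η / r ≤ ε := by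
    refine ⟨min (1 / (2 * ((K : ℝ) + 1))) (min ε (r * ε / 2)), by positivity, ?_, ?_, ?_⟩
    · calc (K : ℝ) * min (1 / (2 * ((K : ℝ) + 1))) (min ε (r * ε / 2))
          ≤ K * (1 / (2 * (K + 1))) := by gcongr; exact min_le_left _ _
        _ ≤ 1 / 2 := by
          rw [mul_one_div, div_le_div_iff₀ (by positivity) (by positivity)]
          nlinarith [K.2]
    · exact (min_le_right _ _).trans (min_le_left _ _)
    · rw [div_le_iff₀ hr]
      have : min (1 / (2 * ((K : ℝ) + 1))) (min ε (r * ε / 2)) ≤ r * ε / 2 :=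
        (min_le_right _ _).trans (min_le_right _ _)
      linarith
  refine ⟨min (η / 2) (r / 2), by positivity, fun x hx y hy => ?_⟩
  have hyx : ‖y - x‖ ≤ η := by
    have h1 := (Metric.mem_ball.1 hx).trans_le (min_le_left _ _)
    have h2 := (Metric.mem_ball.1 hy).trans_le (min_le_left _ _)
    have h3 := dist_triangle_right y x a
    rw [dist_eq_norm y x] at h3
    linarith
  obtain ⟨g, hg, hgz⟩ := exists_isUniformDiffeo_add (w := y - x) hK hdiff
    ((mul_le_mul_of_nonneg_left hyx K.2).trans hη1)
  have hgle : ∀ z, ‖g z - z‖ ≤ η := by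
    intro z
    rw [hgz, add_sub_cancel_left, norm_smul, Real.norm_of_nonneg b.nonneg]
    calc b z * ‖y - x‖ ≤ 1 * ‖y - x‖ := by gcongr; exact b.le_one
      _ ≤ η := by rwa [one_mul]
  have hout : ∀ z, r ≤ dist z a → g z = z := by
    intro z hz
    rw [hgz, b.zero_of_le_dist hz, zero_smul, add_zero]
  refine ⟨g, hg, ?_, fun z => (hgle z).trans hη2, fun f hf => ⟨?_, fun z hz => ?_⟩⟩
  · rw [hgz, b.one_of_mem_closedBall, one_smul, add_sub_cancel]
    exact Metric.ball_subset_closedBall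
      (Metric.ball_subset_ball (min_le_right _ _) hx)
  · filter_upwards [Metric.ball_mem_nhds f hr] with z hz
    refine hout z ?_
    have h1 := hrF f hf
    have h2 := dist_triangle a z f
    have h3 := Metric.mem_ball.1 hz
    rw [dist_comm z a]
    linarith
  · rcases le_or_gt r (dist z a) with h | h
    · rw [hout z h, sub_self, norm_zero]
      exact hε.le
    · have hgf : g f = f := by
        refine hout f ?_
        have := hrF f hf
        rw [dist_comm] at this
        linarith
      have h1 : g z - f ≠ 0 := by
        rw [sub_ne_zero]
        intro h'
        exact hz (g.injective (h'.trans hgf.symm))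
      have h2 : r ≤ ‖z - f‖ := by
        rw [← dist_eq_norm]
        have h1 := hrF f hf
        have h2 := dist_triangle a z f
        rw [dist_comm a z] at h2
        linarith
      refine (norm_dir_sub_dir_le h1 (sub_ne_zero.2 hz)).trans (le_trans ?_ hη3)
      rw [sub_sub_sub_cancel_right]
      gcongr
      exact hgle z

/-- A stage of the back-and-forth construction. -/
structure MatchStage (P E : Set (ℝ × ℝ)) where
  toHomeo : (ℝ × ℝ) ≃ₜ (ℝ × ℝ)
  isUniformDiffeo : IsUniformDiffeo toHomeo
  matched : Finset (ℝ × ℝ)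
  matched_subset : ↑matched ⊆ P
  map_matched : ∀ f ∈ matched, toHomeo f ∈ E

/-- The stage `t` refines the stage `s` up to an error `ε`. -/
structure MatchStage.Refines {P E : Set (ℝ × ℝ)} (ε : ℝ) (s t : MatchStage P E) : Prop where
  subset : s.matched ⊆ t.matched
  dist_le : ∀ z, dist (s.toHomeo z) (t.toHomeo z) ≤ ε
  dist_symm_le : ∀ z, dist (s.toHomeo.symm z) (t.toHomeo.symm z) ≤ ε
  eventuallyEq : ∀ f ∈ s.matched, t.toHomeo =ᶠ[𝓝 f] s.toHomeo
  dir_le : ∀ f ∈ s.matched, ∀ z, z ≠ f →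
    dist (dir (s.toHomeo z - s.toHomeo f)) (dir (t.toHomeo z - s.toHomeo f)) ≤ ε

theorem MatchStage.Refines.refl {P E : Set (ℝ × ℝ)} {ε : ℝ} (hε : 0 ≤ ε) (s : MatchStage P E) :
    s.Refines ε s where
  subset := Finset.Subset.refl _
  dist_le z := by simpa using hε
  dist_symm_le z := by simpa using hε
  eventuallyEq f _ := EventuallyEq.rfl
  dir_le f _ z _ := by simpa using hε

/-- One can refine a stage so as to match a point near `p` with a point near its image. -/
theorem MatchStage.exists_refines {P E : Set (ℝ × ℝ)} (s : MatchStage P E) {ε : ℝ} (hε : 0 < ε)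
    {p : ℝ × ℝ} (hp : p ∉ s.matched) :
    ∃ δ > 0, ∀ x ∈ P, ∀ y ∈ E, s.toHomeo x ∈ Metric.ball (s.toHomeo p) δ →
      y ∈ Metric.ball (s.toHomeo p) δ →
      ∃ t : MatchStage P E, s.Refines ε t ∧ x ∈ t.matched ∧ t.toHomeo x = y := by
  classical
  obtain ⟨η, hη, hηs⟩ := Metric.uniformContinuous_iff.1 s.isUniformDiffeo.uniformContinuous_symm ε hε
  obtain ⟨δ, hδ, H⟩ := exists_push (s.toHomeo p) (s.matched.image s.toHomeo) (by
    rw [Finset.mem_image]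
    rintro ⟨f, hf, hfp⟩
    exact hp (s.toHomeo.injective hfp ▸ hf)) (lt_min hε (half_pos hη))
  refine ⟨δ, hδ, fun x hx y hy hxb hyb => ?_⟩
  obtain ⟨g, hg, hgx, hgz, hgF⟩ := H _ hxb _ hyb
  have hfix : ∀ f ∈ s.matched, g (s.toHomeo f) = s.toHomeo f := fun f hf =>
    (hgF _ (Finset.mem_image_of_mem _ hf)).1.eq_of_nhds
  refine ⟨⟨s.toHomeo.trans g, s.isUniformDiffeo.trans hg, insert x s.matched, ?_, ?_⟩,
    ⟨?_, ?_, ?_, ?_, ?_⟩, ?_, ?_⟩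
  · rw [Finset.coe_insert]
    exact insert_subset hx s.matched_subset
  · intro f hf
    rcases Finset.mem_insert.1 hf with rfl | hf
    · simpa [hgx] using hy
    · simpa [hfix f hf] using s.map_matched f hf
  · exact Finset.subset_insert _ _
  · intro z
    rw [dist_comm, dist_eq_norm]
    exact (hgz _).trans (min_le_left _ _)
  · intro z
    refine (hηs ?_).le
    have := hgz (g.symm z)
    rw [g.apply_symm_apply] at this
    rw [dist_eq_norm]
    exact (this.trans (min_le_right _ _)).trans_lt (half_lt_self hη)
  · intro f hf
    exact (s.toHomeo.continuous.tendsto f).eventually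
      (hgF _ (Finset.mem_image_of_mem _ hf)).1
  · intro f hf z hz
    rw [dist_comm, dist_eq_norm]
    exact ((hgF _ (Finset.mem_image_of_mem _ hf)).2 _ (s.toHomeo.injective.ne hz)).trans
      (min_le_left _ _)
  · exact Finset.mem_insert_self _ _
  · exact hgx

theorem MatchStage.exists_refines_mem {P E : Set (ℝ × ℝ)} (hE : Dense E) (s : MatchStage P E)
    {ε : ℝ} (hε : 0 < ε) {p : ℝ × ℝ} (hp : p ∈ P) :
    ∃ t : MatchStage P E, s.Refines ε t ∧ p ∈ t.matched := by
  by_cases hps : p ∈ s.matched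
  · exact ⟨s, .refl hε.le s, hps⟩
  obtain ⟨δ, hδ, H⟩ := s.exists_refines hε hps
  obtain ⟨y, hyE, hy⟩ := hE.exists_mem_open Metric.isOpen_ball ⟨_, Metric.mem_ball_self hδ⟩
  obtain ⟨t, h1, h2, -⟩ := H p hp y hyE (Metric.mem_ball_self hδ) hy
  exact ⟨t, h1, h2⟩

theorem MatchStage.exists_refines_image {P E : Set (ℝ × ℝ)} (hP : Dense P) (s : MatchStage P E)
    {ε : ℝ} (hε : 0 < ε) {e : ℝ × ℝ} (he : e ∈ E) :
    ∃ t : MatchStage P E, s.Refines ε t ∧ ∃ p ∈ t.matched, t.toHomeo p = e := by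
  by_cases hps : s.toHomeo.symm e ∈ s.matched
  · exact ⟨s, .refl hε.le s, _, hps, s.toHomeo.apply_symm_apply e⟩
  obtain ⟨δ, hδ, H⟩ := s.exists_refines hε hps
  rw [s.toHomeo.apply_symm_apply] at H
  obtain ⟨x, hxP, hx⟩ := hP.exists_mem_open (Metric.isOpen_ball.preimage s.toHomeo.continuous)
    ⟨s.toHomeo.symm e, by
      rw [mem_preimage, s.toHomeo.apply_symm_apply]
      exact Metric.mem_ball_self hδ⟩
  obtain ⟨t, h1, h2, h3⟩ := H x hxP e he hx (Metric.mem_ball_self hδ)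
  exact ⟨t, h1, x, h2, h3⟩

/-- Countable dense subsets of the plane are equivalent under a homeomorphism acting linearly on
directions at the points of the first set. -/
theorem exists_homeomorph_image_eq_dirAt {P E : Set (ℝ × ℝ)} (hPc : P.Countable) (hEc : E.Countable)
    (hP : Dense P) (hE : Dense E) :
    ∃ θ : (ℝ × ℝ) ≃ₜ (ℝ × ℝ), θ '' P = E ∧ ∀ p ∈ P, ∃ A, DirAt θ p A := by
  have := hPc.to_subtype
  have := hEc.to_subtype
  have : Nonempty (P ⊕ E) := ⟨Sum.inl ⟨_, hP.nonempty.some_mem⟩⟩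
  obtain ⟨task, htask⟩ := exists_surjective_nat (P ⊕ E)
  let Done : MatchStage P E → P ⊕ E → Prop := fun s t =>
    Sum.elim (fun p : P => (p : ℝ × ℝ) ∈ s.matched)
      (fun e : E => ∃ p ∈ s.matched, s.toHomeo p = e) t
  have hstep : ∀ (s : MatchStage P E) (n : ℕ), ∃ t, s.Refines (1 * (1 / 2) ^ n) t ∧
      Done t (task n) := by
    intro s n
    rcases task n with p | e
    · exact s.exists_refines_mem hE (by positivity) p.2
    · exact s.exists_refines_image hP (by positivity) e.2
  choose next hnext hdone using hstep
  let s0 : MatchStage P E :=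
    ⟨Homeomorph.refl _, ⟨uniformContinuous_id, uniformContinuous_id, fun x =>
      ⟨ContinuousLinearEquiv.refl ℝ _, hasFDerivAt_id x⟩⟩, ∅, by simp, by simp⟩
  let s : ℕ → MatchStage P E := fun n => Nat.rec s0 (fun n t => next t n) n
  have href : ∀ n, (s n).Refines (1 * (1 / 2) ^ n) (s (n + 1)) := fun n => hnext (s n) n
  have hdn : ∀ n, Done (s (n + 1)) (task n) := fun n => hdone (s n) n
  have h12 : (1 / 2 : ℝ) < 1 := by norm_num
  have hlim : ∀ z, ∃ w, Tendsto (fun n => (s n).toHomeo z) atTop (𝓝 w) := fun z =>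
    cauchySeq_tendsto_of_complete
      (cauchySeq_of_le_geometric (1 / 2) 1 h12 fun n => (href n).dist_le z)
  have hlim' : ∀ z, ∃ w, Tendsto (fun n => (s n).toHomeo.symm z) atTop (𝓝 w) := fun z =>
    cauchySeq_tendsto_of_complete
      (cauchySeq_of_le_geometric (1 / 2) 1 h12 fun n => (href n).dist_symm_le z)
  choose θ hθ using hlim
  choose η hη using hlim'
  have hgeom : Tendsto (fun n : ℕ => 1 * (1 / 2 : ℝ) ^ n / (1 - 1 / 2)) atTop (𝓝 0) := by
    have := ((tendsto_pow_atTop_nhds_zero_of_lt_one (by norm_num) h12).const_mul (1 : ℝ)).div_const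
      (1 - 1 / 2)
    simpa using this
  have hunif : TendstoUniformly (fun n => ((s n).toHomeo : ℝ × ℝ → ℝ × ℝ)) θ atTop := by
    rw [Metric.tendstoUniformly_iff]
    intro ε hε
    filter_upwards [hgeom.eventually_lt_const hε] with n hn z
    rw [dist_comm]
    exact (dist_le_of_le_geometric_of_tendsto (1 / 2) 1 h12 (fun n => (href n).dist_le z)
      (hθ z) n).trans_lt hn
  have hunif' : TendstoUniformly (fun n => ((s n).toHomeo.symm : ℝ × ℝ → ℝ × ℝ)) η atTop := by
    rw [Metric.tendstoUniformly_iff]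
    intro ε hε
    filter_upwards [hgeom.eventually_lt_const hε] with n hn z
    rw [dist_comm]
    exact (dist_le_of_le_geometric_of_tendsto (1 / 2) 1 h12 (fun n => (href n).dist_symm_le z)
      (hη z) n).trans_lt hn
  have hθc : Continuous θ := hunif.continuous (.of_forall fun n => (s n).toHomeo.continuous)
  have hηc : Continuous η := hunif'.continuous (.of_forall fun n => (s n).toHomeo.symm.continuous)
  have hθη : ∀ z, θ (η z) = z := fun z => by
    refine tendsto_nhds_unique (hunif.tendsto_comp hθc.continuousAt (hη z)) ?_
    simp only [Homeomorph.apply_symm_apply]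
    exact tendsto_const_nhds
  have hηθ : ∀ z, η (θ z) = z := fun z => by
    refine tendsto_nhds_unique (hunif'.tendsto_comp hηc.continuousAt (hθ z)) ?_
    simp only [Homeomorph.symm_apply_apply]
    exact tendsto_const_nhds
  let Θ : (ℝ × ℝ) ≃ₜ (ℝ × ℝ) := ⟨⟨θ, η, hηθ, hθη⟩, hθc, hηc⟩
  have hmono : ∀ k n, (s k).matched ⊆ (s (k + n)).matched := by
    intro k n
    induction n with
    | zero => exact Finset.Subset.refl _
    | succ n ih => exact ih.trans (href (k + n)).subset
  have heq : ∀ k n, ∀ f ∈ (s k).matched, (s (k + n)).toHomeo =ᶠ[𝓝 f] (s k).toHomeo := by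
    intro k n f hf
    induction n with
    | zero => exact EventuallyEq.rfl
    | succ n ih => exact ((href (k + n)).eventuallyEq f (hmono k n hf)).trans ih
  have hval : ∀ k, ∀ f ∈ (s k).matched, θ f = (s k).toHomeo f := by
    intro k f hf
    refine tendsto_nhds_unique (hθ f) (tendsto_atTop_of_eventually_const (i₀ := k) fun n hn => ?_)
    obtain ⟨m, rfl⟩ := Nat.exists_eq_add_of_le hn
    exact (heq k m f hf).eq_of_nhds
  have hmatch : ∀ p ∈ P, ∃ k, p ∈ (s k).matched := by
    intro p hp
    obtain ⟨n, hn⟩ := htask (Sum.inl ⟨p, hp⟩)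
    have h := hdn n
    rw [hn] at h
    exact ⟨n + 1, h⟩
  refine ⟨Θ, Subset.antisymm ?_ ?_, fun p hp => ?_⟩
  · rintro _ ⟨p, hp, rfl⟩
    obtain ⟨k, hk⟩ := hmatch p hp
    change θ p ∈ E
    rw [hval k p hk]
    exact (s k).map_matched p hk
  · intro e he
    obtain ⟨n, hn⟩ := htask (Sum.inr ⟨e, he⟩)
    have h := hdn n
    rw [hn] at h
    obtain ⟨p, hp, hpe⟩ := h
    exact ⟨p, (s (n + 1)).matched_subset hp, (hval (n + 1) p hp).trans hpe⟩
  · obtain ⟨k, hk⟩ := hmatch p hp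
    obtain ⟨A, hA⟩ := (s k).isUniformDiffeo.exists_hasFDerivAt p
    refine ⟨A, fun ω hω => ?_⟩
    have hle : dirFilter p ω ≤ 𝓝[≠] p := inf_le_left
    have hne : ∀ᶠ z in dirFilter p ω, z ≠ p := hle self_mem_nhdsWithin
    rw [tendsto_dirFilter]
    refine ⟨tendsto_nhdsWithin_iff.2
      ⟨(hθc.tendsto p).mono_left (hle.trans nhdsWithin_le_nhds), ?_⟩, ?_⟩
    · filter_upwards [hne] with z hz
      exact Θ.injective.ne hz
    · rw [Metric.tendsto_nhds]
      intro ε hε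
      obtain ⟨n, hn⟩ := (hgeom.eventually_lt_const (half_pos hε)).exists_forall_of_atTop
      have hDk : DirAt (s (k + n)).toHomeo p A := hA.dirAt.congr (heq k n p hk).symm
      have h1 := (tendsto_dirFilter.1 (hDk ω hω)).2
      rw [Metric.tendsto_nhds] at h1
      filter_upwards [h1 (ε / 2) (half_pos hε), hne] with z hz hzp
      have hconst : ∀ m, (s (k + m)).toHomeo p = θ p := fun m =>
        (hval _ p (hmono k m hk)).symm
      have h2 : dist (dir ((s (k + n)).toHomeo z - θ p)) (dir (θ z - θ p)) ≤
          1 * (1 / 2 : ℝ) ^ (k + n) / (1 - 1 / 2) := by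
        have hl : Tendsto (fun m => dir ((s (k + m)).toHomeo z - θ p)) atTop
            (𝓝 (dir (θ z - θ p))) := by
          refine (continuousAt_dir (sub_ne_zero.2 (Θ.injective.ne hzp))).tendsto.comp
            (Tendsto.sub_const ?_ _)
          have := (hθ z).comp (tendsto_add_atTop_nat k)
          refine this.congr fun m => ?_
          simp [add_comm]
        have := dist_le_of_le_geometric_of_tendsto (1 / 2) (1 * (1 / 2) ^ k) h12 (fun m => ?_) hl n
        · rw [one_mul] at this ⊢
          rwa [pow_add]
        · rw [mul_assoc, ← pow_add]
          have h3 := (href (k + m)).dir_le p (hmono k m hk) z hzp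
          rwa [hconst] at h3
      rw [hconst] at hz
      have h4 := hn (k + n) (Nat.le_add_left _ _)
      rw [dist_comm] at h2
      calc dist (dir (θ z - θ p)) (dir (A ω)) ≤ _ := dist_triangle _ _ _
        _ < ε / 2 + ε / 2 := add_lt_add_of_le_of_lt (h2.trans h4.le) hz
        _ = ε := add_halves ε

/-- The finite part of a point of the sphere, with junk value `0` at infinity. -/
noncomputable def toPlane (z : OnePoint (ℝ × ℝ)) : ℝ × ℝ := z.elim 0 id

@[simp] theorem toPlane_coe (v : ℝ × ℝ) : toPlane (v : OnePoint (ℝ × ℝ)) = v := rfl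

theorem continuousAt_toPlane (v : ℝ × ℝ) : ContinuousAt toPlane (v : OnePoint (ℝ × ℝ)) := by
  rw [ContinuousAt, OnePoint.nhds_coe_eq, tendsto_map'_iff]
  exact tendsto_id

theorem eventually_coe_toPlane (v : ℝ × ℝ) :
    ∀ᶠ z in 𝓝 (v : OnePoint (ℝ × ℝ)), ((toPlane z : ℝ × ℝ) : OnePoint (ℝ × ℝ)) = z := by
  rw [OnePoint.nhds_coe_eq, eventually_map]
  exact .of_forall fun _ => rfl

theorem dirFilter_neBot {p ω : ℝ × ℝ} (hω : ‖ω‖ = 1) : (dirFilter p ω).NeBot := by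
  have hω0 := ne_zero_of_norm_eq_one hω
  have h : Tendsto (fun t : ℝ => p + t • ω) (𝓝[>] 0) (dirFilter p ω) := by
    rw [tendsto_dirFilter]
    constructor
    · refine tendsto_nhdsWithin_iff.2 ⟨?_, ?_⟩
      · have : Tendsto (fun t : ℝ => p + t • ω) (𝓝 0) (𝓝 (p + (0 : ℝ) • ω)) :=
          Continuous.tendsto (by fun_prop) 0
        rw [zero_smul, add_zero] at this
        exact this.mono_left nhdsWithin_le_nhds
      · filter_upwards [self_mem_nhdsWithin] with t ht h
        have h' : t • ω = 0 := by simpa using h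
        exact (smul_ne_zero (ne_of_gt ht) hω0) h'
    · refine Tendsto.congr' ?_ tendsto_const_nhds
      filter_upwards [self_mem_nhdsWithin] with t ht
      rw [add_sub_cancel_left, dir_smul ht, dir_of_norm_eq_one hω]
  exact h.neBot

/-- `Ψ` presents `S` as the sphere with the points of `E` replaced by circles of directions;
`a e x` is the direction at `e` which corresponds to the point `x` of the fibre over `e`. -/
structure IsPlaneBlowUp {S : Type*} [TopologicalSpace S] (Ψ : S → OnePoint (ℝ × ℝ))
    (E : Set (ℝ × ℝ)) (a : ℝ × ℝ → S → ℝ × ℝ) : Prop where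
  continuous : Continuous Ψ
  surjective : Function.Surjective Ψ
  fiber : ∀ x y, Ψ x = Ψ y → x = y ∨ ∃ e ∈ E, Ψ x = (e : OnePoint (ℝ × ℝ))
  norm_eq_one : ∀ e ∈ E, ∀ x, Ψ x = (e : OnePoint (ℝ × ℝ)) → ‖a e x‖ = 1
  injOn : ∀ e ∈ E, InjOn (a e) (Ψ ⁻¹' {(e : OnePoint (ℝ × ℝ))})
  continuousOn : ∀ e ∈ E, ContinuousOn (a e) (Ψ ⁻¹' {(e : OnePoint (ℝ × ℝ))})
  tendsto : ∀ e ∈ E, ∀ x, Ψ x = (e : OnePoint (ℝ × ℝ)) →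
    Tendsto (fun x' => dir (toPlane (Ψ x') - e))
      (𝓝[{x' | Ψ x' ≠ (e : OnePoint (ℝ × ℝ))}] x) (𝓝 (a e x))

namespace IsPlaneBlowUp

variable {S : Type*} [TopologicalSpace S] {Ψ : S → OnePoint (ℝ × ℝ)}
    {E : Set (ℝ × ℝ)} {a : ℝ × ℝ → S → ℝ × ℝ}

theorem exists_dir_eq [CompactSpace S] (h : IsPlaneBlowUp Ψ E a) {e ω : ℝ × ℝ} (he : e ∈ E)
    (hω : ‖ω‖ = 1) : ∃ x, Ψ x = (e : OnePoint (ℝ × ℝ)) ∧ a e x = ω ∧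
      x ∈ closure {x' | Ψ x' ≠ (e : OnePoint (ℝ × ℝ))} := by
  have := dirFilter_neBot (p := e) hω
  obtain ⟨U, hU⟩ := Ultrafilter.exists_le (dirFilter e ω)
  let σ : ℝ × ℝ → S := fun v => (h.surjective (v : OnePoint (ℝ × ℝ))).choose
  have hσ : ∀ v : ℝ × ℝ, Ψ (σ v) = (v : OnePoint (ℝ × ℝ)) := fun v =>
    (h.surjective (v : OnePoint (ℝ × ℝ))).choose_spec
  obtain ⟨x, -, hx⟩ := isCompact_univ.ultrafilter_le_nhds (U.map σ) (by simp)
  have hx' : Tendsto σ U (𝓝 x) := hx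
  have hUt := tendsto_dirFilter.1 (tendsto_id.mono_left hU)
  have hUe : Tendsto (fun v : ℝ × ℝ => (v : OnePoint (ℝ × ℝ))) U (𝓝 (e : OnePoint (ℝ × ℝ))) :=
    (OnePoint.continuous_coe.tendsto e).comp (hUt.1.mono_right nhdsWithin_le_nhds)
  have hxe : Ψ x = (e : OnePoint (ℝ × ℝ)) := by
    refine tendsto_nhds_unique (((h.continuous.tendsto x).comp hx').congr fun v => ?_) hUe
    exact hσ v
  have hw : Tendsto σ U (𝓝[{x' | Ψ x' ≠ (e : OnePoint (ℝ × ℝ))}] x) := by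
    refine tendsto_nhdsWithin_iff.2 ⟨hx', ?_⟩
    filter_upwards [hUt.1 self_mem_nhdsWithin] with v hv h'
    rw [hσ] at h'
    exact hv (OnePoint.coe_injective h')
  refine ⟨x, hxe, ?_, mem_closure_iff_nhdsWithin_neBot.2 hw.neBot⟩
  refine tendsto_nhds_unique ((h.tendsto e he x hxe).comp hw) (hUt.2.congr fun v => ?_)
  simp [hσ]

theorem exists_lift [CompactSpace S] (h : IsPlaneBlowUp Ψ E a)
    {G : OnePoint (ℝ × ℝ) → OnePoint (ℝ × ℝ)} {g : ℝ × ℝ → ℝ × ℝ}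
    {A : ℝ × ℝ → (ℝ × ℝ) ≃L[ℝ] (ℝ × ℝ)}
    (hG : Continuous G) (hinj : Function.Injective G)
    (hg : ∀ v, g v = toPlane (G (v : OnePoint (ℝ × ℝ))))
    (hE : ∀ e ∈ E, g e ∈ E ∧ G (e : OnePoint (ℝ × ℝ)) = (g e : OnePoint (ℝ × ℝ)))
    (hE' : ∀ z, ∀ e ∈ E, G z = (e : OnePoint (ℝ × ℝ)) →
      ∃ e' ∈ E, z = (e' : OnePoint (ℝ × ℝ)))
    (hA : ∀ e ∈ E, DirAt g e (A e)) :
    ∃ k : S → S, Continuous k ∧ (∀ x, Ψ (k x) = G (Ψ x)) ∧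
      ∀ e ∈ E, ∀ x, Ψ x = (e : OnePoint (ℝ × ℝ)) → a (g e) (k x) = dir (A e (a e x)) := by
  have hex : ∀ x, ∃ y, Ψ y = G (Ψ x) ∧
      ∀ e ∈ E, Ψ x = (e : OnePoint (ℝ × ℝ)) → a (g e) y = dir (A e (a e x)) := by
    intro x
    by_cases hx : ∃ e ∈ E, Ψ x = (e : OnePoint (ℝ × ℝ))
    · obtain ⟨e, he, hxe⟩ := hx
      have hn := norm_dir ((A e).apply_ne_zero (ne_zero_of_norm_eq_one (h.norm_eq_one e he x hxe)))
      obtain ⟨y, hy, hay, -⟩ := h.exists_dir_eq (hE e he).1 hn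
      refine ⟨y, by rw [hy, hxe, (hE e he).2], fun e' he' hxe' => ?_⟩
      obtain rfl : e = e' := OnePoint.coe_injective (hxe.symm.trans hxe')
      exact hay
    · obtain ⟨y, hy⟩ := h.surjective (G (Ψ x))
      exact ⟨y, hy, fun e he hxe => absurd ⟨e, he, hxe⟩ hx⟩
  choose k hk hka using hex
  refine ⟨k, continuous_iff_continuousAt.2 fun x => ?_, hk, fun e he x hx => hka x e he hx⟩
  rw [ContinuousAt, tendsto_iff_ultrafilter]
  intro U hU
  obtain ⟨y, -, hy⟩ := isCompact_univ.ultrafilter_le_nhds (U.map k) (by simp)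
  have hky : Tendsto k U (𝓝 y) := hy
  have hΨU : Tendsto Ψ U (𝓝 (Ψ x)) := (h.continuous.tendsto x).mono_left hU
  have hΨy : Ψ y = G (Ψ x) := by
    refine tendsto_nhds_unique (((h.continuous.tendsto y).comp hky).congr fun v => ?_)
      ((hG.tendsto _).comp hΨU)
    exact hk v
  suffices y = k x by rw [← this]; exact hky
  rcases h.fiber y (k x) (hΨy.trans (hk x).symm) with hyk | ⟨e', he', hye'⟩
  · exact hyk
  obtain ⟨e, he, hxe⟩ := hE' (Ψ x) e' he' (hΨy.symm.trans hye')
  have hge : e' = g e := by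
    have : (e' : OnePoint (ℝ × ℝ)) = (g e : OnePoint (ℝ × ℝ)) := by
      rw [← hye', hΨy, hxe, (hE e he).2]
    exact OnePoint.coe_injective this
  subst hge
  have hkx : Ψ (k x) = (g e : OnePoint (ℝ × ℝ)) := by rw [hk, hxe, (hE e he).2]
  refine h.injOn _ he' hye' hkx ?_
  rw [hka x e he hxe]
  have hn0 := ne_zero_of_norm_eq_one (h.norm_eq_one e he x hxe)
  rcases U.em fun x' => Ψ x' = (e : OnePoint (ℝ × ℝ)) with hUe | hUe
  · have h1 : Tendsto (fun x' => a (g e) (k x')) U (𝓝 (a (g e) y)) := by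
      refine (h.continuousOn _ he' y hye').tendsto.comp (tendsto_nhdsWithin_iff.2 ⟨hky, ?_⟩)
      filter_upwards [hUe] with x' hx'
      change Ψ (k x') = _
      rw [hk, hx', (hE e he).2]
    have h2 : Tendsto (a e) U (𝓝 (a e x)) :=
      (h.continuousOn e he x hxe).tendsto.comp
        (tendsto_nhdsWithin_iff.2 ⟨tendsto_id.mono_left hU, hUe⟩)
    have h3 : Tendsto (fun x' => dir (A e (a e x'))) U (𝓝 (dir (A e (a e x)))) :=
      (continuousAt_dir ((A e).apply_ne_zero hn0)).tendsto.comp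
        (((A e).continuous.tendsto _).comp h2)
    refine tendsto_nhds_unique h1 (h3.congr' ?_)
    filter_upwards [hUe] with x' hx'
    exact (hka x' e he hx').symm
  · have hΨU' : Tendsto (fun x' => toPlane (Ψ x')) U (𝓝 e) := by
      rw [hxe] at hΨU
      have := (continuousAt_toPlane e).tendsto.comp hΨU
      rwa [toPlane_coe] at this
    have hcoe : ∀ᶠ x' in (U : Filter S), ((toPlane (Ψ x') : ℝ × ℝ) : OnePoint (ℝ × ℝ)) = Ψ x' := by
      rw [hxe] at hΨU
      exact hΨU.eventually (eventually_coe_toPlane e)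
    have h1 : Tendsto (fun x' => toPlane (Ψ x')) U (dirFilter e (a e x)) := by
      refine tendsto_dirFilter.2 ⟨tendsto_nhdsWithin_iff.2 ⟨hΨU', ?_⟩,
        (h.tendsto e he x hxe).comp (tendsto_nhdsWithin_iff.2 ⟨tendsto_id.mono_left hU, hUe⟩)⟩
      filter_upwards [hUe, hcoe] with x' hx' hc h'
      apply hx'
      rw [← hc, show toPlane (Ψ x') = e from h']
    have h2 := (tendsto_dirFilter.1 ((hA e he _ (h.norm_eq_one e he x hxe)).comp h1)).2
    have h3 : Tendsto (fun x' => dir (toPlane (Ψ (k x')) - g e)) U (𝓝 (a (g e) y)) := by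
      refine (h.tendsto _ he' y hye').comp (tendsto_nhdsWithin_iff.2 ⟨hky, ?_⟩)
      filter_upwards [hUe] with x' hx' h'
      apply hx'
      rw [hk, ← (hE e he).2] at h'
      exact hinj h'
    refine tendsto_nhds_unique h3 (h2.congr' ?_)
    filter_upwards [hcoe] with x' hx'
    rw [Function.comp_apply, hg, hx', hk]

/-- A homeomorphism of the sphere permuting `E` and acting linearly on directions there lifts to
the blow-up. -/
theorem exists_homeomorph [CompactSpace S] (h : IsPlaneBlowUp Ψ E a)
    (G : OnePoint (ℝ × ℝ) ≃ₜ OnePoint (ℝ × ℝ))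
    (hE : ∀ e ∈ E, ∃ e' ∈ E, G (e : OnePoint (ℝ × ℝ)) = (e' : OnePoint (ℝ × ℝ)))
    (hE' : ∀ e ∈ E, ∃ e' ∈ E, G (e' : OnePoint (ℝ × ℝ)) = (e : OnePoint (ℝ × ℝ)))
    (hA : ∀ e ∈ E, ∃ A, DirAt (fun v => toPlane (G (v : OnePoint (ℝ × ℝ)))) e A) :
    ∃ H : S ≃ₜ S, ∀ x, Ψ (H x) = G (Ψ x) := by
  classical
  let g : ℝ × ℝ → ℝ × ℝ := fun v => toPlane (G (v : OnePoint (ℝ × ℝ)))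
  let g' : ℝ × ℝ → ℝ × ℝ := fun v => toPlane (G.symm (v : OnePoint (ℝ × ℝ)))
  have hgE : ∀ e ∈ E, g e ∈ E ∧ G (e : OnePoint (ℝ × ℝ)) = (g e : OnePoint (ℝ × ℝ)) := by
    intro e he
    obtain ⟨e', he', h'⟩ := hE e he
    have : g e = e' := by simp only [g, h', toPlane_coe]
    rw [this]
    exact ⟨he', h'⟩
  have hgE' : ∀ e ∈ E, g' e ∈ E ∧ G.symm (e : OnePoint (ℝ × ℝ)) = (g' e : OnePoint (ℝ × ℝ)) := by
    intro e he
    obtain ⟨e', he', h'⟩ := hE' e he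
    have h2 : G.symm (e : OnePoint (ℝ × ℝ)) = (e' : OnePoint (ℝ × ℝ)) := by
      rw [← h', G.symm_apply_apply]
    have : g' e = e' := by simp only [g', h2, toPlane_coe]
    rw [this]
    exact ⟨he', h2⟩
  have hgg' : ∀ e ∈ E, g (g' e) = e := by
    intro e he
    simp only [g]
    rw [← (hgE' e he).2, G.apply_symm_apply, toPlane_coe]
  have hg'g : ∀ e ∈ E, g' (g e) = e := by
    intro e he
    simp only [g']
    rw [← (hgE e he).2, G.symm_apply_apply, toPlane_coe]
  let A : ℝ × ℝ → (ℝ × ℝ) ≃L[ℝ] (ℝ × ℝ) := fun e =>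
    if he : e ∈ E then (hA e he).choose else ContinuousLinearEquiv.refl ℝ _
  have hA1 : ∀ e ∈ E, DirAt g e (A e) := by
    intro e he
    simp only [A, dif_pos he]
    exact (hA e he).choose_spec
  have hA2 : ∀ e ∈ E, DirAt g' e (A (g' e)).symm := by
    intro e he
    have h1 := hA1 (g' e) (hgE' e he).1
    have hc : ContinuousAt g' e := by
      have h2 : ContinuousAt toPlane (G.symm (e : OnePoint (ℝ × ℝ))) := by
        rw [(hgE' e he).2]
        exact continuousAt_toPlane _
      exact ContinuousAt.comp (g := toPlane) (f := fun v : ℝ × ℝ => G.symm (v : OnePoint (ℝ × ℝ))) h2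
        (G.symm.continuous.comp OnePoint.continuous_coe).continuousAt
    have h3 := h1.symm (g := g')
    rw [hgg' e he] at h3
    refine h3 hc rfl ?_
    have h4 : Tendsto (fun v : ℝ × ℝ => G.symm (v : OnePoint (ℝ × ℝ))) (𝓝 e)
        (𝓝 ((g' e : ℝ × ℝ) : OnePoint (ℝ × ℝ))) := by
      rw [← (hgE' e he).2]
      exact (G.symm.continuous.comp OnePoint.continuous_coe).continuousAt
    filter_upwards [h4.eventually (eventually_coe_toPlane _)] with w hw
    simp only [g, g']
    rw [hw, G.apply_symm_apply, toPlane_coe]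
  obtain ⟨k, hkc, hk, hka⟩ := h.exists_lift (g := g) G.continuous G.injective (fun _ => rfl) hgE (by
    intro z e he hz
    refine ⟨g' e, (hgE' e he).1, ?_⟩
    rw [← (hgE' e he).2, ← hz, G.symm_apply_apply]) hA1
  obtain ⟨k', hkc', hk', hka'⟩ := h.exists_lift (g := g') (A := fun e => (A (g' e)).symm)
    G.symm.continuous G.symm.injective (fun _ => rfl) hgE' (by
    intro z e he hz
    refine ⟨g e, (hgE e he).1, ?_⟩
    rw [← (hgE e he).2, ← hz, G.apply_symm_apply]) hA2
  refine ⟨⟨⟨k, k', fun x => ?_, fun x => ?_⟩, hkc, hkc'⟩, hk⟩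
  · have h1 : Ψ (k' (k x)) = Ψ x := by rw [hk', hk, G.symm_apply_apply]
    rcases h.fiber _ _ h1 with h2 | ⟨e, he, h2⟩
    · exact h2
    have hx : Ψ x = (e : OnePoint (ℝ × ℝ)) := by rw [← h1, h2]
    refine h.injOn e he h2 hx ?_
    have hn := h.norm_eq_one e he x hx
    have h3 := hka' (g e) (hgE e he).1 (k x) (by rw [hk, hx, (hgE e he).2])
    rw [hg'g e he, hka e he x hx] at h3
    rw [h3, ← ContinuousLinearEquiv.coe_coe (A e).symm,
      dir_map_dir _ ((A e).apply_ne_zero (ne_zero_of_norm_eq_one hn)),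
      ContinuousLinearEquiv.coe_coe, (A e).symm_apply_apply, dir_of_norm_eq_one hn]
  · have h1 : Ψ (k (k' x)) = Ψ x := by rw [hk, hk', G.apply_symm_apply]
    rcases h.fiber _ _ h1 with h2 | ⟨e, he, h2⟩
    · exact h2
    have hx : Ψ x = (e : OnePoint (ℝ × ℝ)) := by rw [← h1, h2]
    refine h.injOn e he h2 hx ?_
    have hn := h.norm_eq_one e he x hx
    have h3 := hka (g' e) (hgE' e he).1 (k' x) (by rw [hk', hx, (hgE' e he).2])
    rw [hgg' e he, hka' e he x hx] at h3
    rw [h3, ← ContinuousLinearEquiv.coe_coe (A (g' e)),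
      dir_map_dir _ ((A (g' e)).symm.apply_ne_zero (ne_zero_of_norm_eq_one hn)),
      ContinuousLinearEquiv.coe_coe, (A (g' e)).apply_symm_apply, dir_of_norm_eq_one hn]

end IsPlaneBlowUp

/-- The position of `t` relative to the centre of its unit cell. -/
noncomputable def cellOffset (t : ℝ) : ℝ := Int.fract t - 1 / 2

/-- A cut-off function on the unit cell: `1` on the middle third, `0` on the boundary. -/
noncomputable def cellBump (t : ℝ) : ℝ :=
  min 1 (2 * (1 - 2 * |cellOffset t|) / (1 + 2 * |cellOffset t|))

/-- The collapse of the middle ninth of every unit cell to its centre. -/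
noncomputable def cellCollapse (z : ℝ × ℝ) : ℝ × ℝ :=
  (z.1 - cellOffset z.1 * (cellBump z.1 * cellBump z.2),
    z.2 - cellOffset z.2 * (cellBump z.1 * cellBump z.2))

theorem abs_cellOffset_le (t : ℝ) : |cellOffset t| ≤ 1 / 2 := by
  have h1 := Int.fract_nonneg t
  have h2 := Int.fract_lt_one t
  rw [cellOffset, abs_le]
  constructor <;> linarith

theorem cellBump_nonneg (t : ℝ) : 0 ≤ cellBump t := by
  have h1 := abs_cellOffset_le t
  have h2 := abs_nonneg (cellOffset t)
  exact le_min zero_le_one (div_nonneg (by linarith) (by linarith))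

theorem cellBump_le_one (t : ℝ) : cellBump t ≤ 1 := min_le_left _ _

theorem cellBump_eq_one_iff (t : ℝ) : cellBump t = 1 ↔ |cellOffset t| ≤ 1 / 6 := by
  have h2 := abs_nonneg (cellOffset t)
  rw [cellBump, min_eq_left_iff, le_div_iff₀ (by linarith)]
  constructor <;> intro h <;> linarith

theorem cellBump_of_le {t : ℝ} (h : 1 / 6 ≤ |cellOffset t|) :
    cellBump t = 2 * (1 - 2 * |cellOffset t|) / (1 + 2 * |cellOffset t|) := by
  have h2 := abs_nonneg (cellOffset t)
  rw [cellBump, min_eq_right_iff, div_le_iff₀ (by linarith)]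
  linarith

theorem cellBump_anti {t t' : ℝ} (h : |cellOffset t| ≤ |cellOffset t'|) :
    cellBump t' ≤ cellBump t := by
  have h2 := abs_nonneg (cellOffset t)
  refine min_le_min le_rfl ?_
  rw [div_le_div_iff₀ (by linarith) (by linarith)]
  nlinarith

theorem abs_cellOffset_le_of_int (t : ℝ) (k : ℤ) : 1 / 2 - |cellOffset t| ≤ |t - k| := by
  have h0 := Int.floor_add_fract t
  rcases le_or_gt k ⌊t⌋ with h | h
  · have h1 : (k : ℝ) ≤ ⌊t⌋ := by exact_mod_cast h
    have h2 := Int.fract_nonneg t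
    rw [abs_of_nonneg (by linarith : 0 ≤ t - k)]
    have h3 := neg_abs_le (cellOffset t)
    have h4 : cellOffset t = Int.fract t - 1 / 2 := rfl
    linarith
  · have h1 : (⌊t⌋ : ℝ) + 1 ≤ k := by exact_mod_cast h
    have h2 := (Int.fract_lt_one t).le
    rw [abs_of_nonpos (by linarith : t - k ≤ 0)]
    have h3 := le_abs_self (cellOffset t)
    have h4 : cellOffset t = Int.fract t - 1 / 2 := rfl
    linarith

theorem abs_cellOffset_mul_cellBump_le (t : ℝ) :
    |cellOffset t * cellBump t| ≤ 1 / 2 - |cellOffset t| ∨ |cellOffset t| ≤ 1 / 6 := by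
  rcases le_or_gt |cellOffset t| (1 / 6) with h | h
  · exact Or.inr h
  left
  have h1 := abs_cellOffset_le t
  rw [abs_mul, abs_of_nonneg (cellBump_nonneg t), cellBump_of_le h.le, ← mul_div_assoc,
    div_le_iff₀ (by linarith)]
  nlinarith

theorem abs_cellOffset_mul_cellBump_le_abs_sub (t : ℝ) (k : ℤ) :
    |cellOffset t * cellBump t| ≤ |t - k| := by
  refine le_trans ?_ (abs_cellOffset_le_of_int t k)
  rcases abs_cellOffset_mul_cellBump_le t with h | h
  · exact h
  · rw [(cellBump_eq_one_iff t).2 h, mul_one]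
    linarith

theorem abs_cellOffset_mul_cellBump_le_fifth (t : ℝ) :
    |cellOffset t * cellBump t| ≤ 1 / 5 := by
  rw [abs_mul, abs_of_nonneg (cellBump_nonneg t)]
  rcases le_or_gt |cellOffset t| (1 / 6) with h | h
  · have := cellBump_le_one t
    have := cellBump_nonneg t
    have := abs_nonneg (cellOffset t)
    nlinarith
  · rw [cellBump_of_le h.le, ← mul_div_assoc, div_le_iff₀ (by linarith)]
    nlinarith [sq_nonneg (5 * |cellOffset t| - 1)]

/-- The profile of `s ↦ s * cellBump s` on one half of the cell is `1`-Lipschitz. -/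
theorem abs_profile_sub_le {s s' n n' : ℝ} (hs : 0 ≤ s) (hss : s ≤ s') (hs' : s' ≤ 1 / 2)
    (hn : n = min 1 (2 * (1 - 2 * s) / (1 + 2 * s)))
    (hn' : n' = min 1 (2 * (1 - 2 * s') / (1 + 2 * s'))) :
    |s' * n' - s * n| ≤ s' - s := by
  have key : ∀ r : ℝ, 0 ≤ r → 1 / 6 ≤ r → min 1 (2 * (1 - 2 * r) / (1 + 2 * r)) =
      2 * (1 - 2 * r) / (1 + 2 * r) := by
    intro r h0 h
    rw [min_eq_right_iff, div_le_iff₀ (by linarith)]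
    linarith
  have key' : ∀ r : ℝ, 0 ≤ r → r ≤ 1 / 6 → min 1 (2 * (1 - 2 * r) / (1 + 2 * r)) = 1 := by
    intro r h0 h
    rw [min_eq_left_iff, le_div_iff₀ (by linarith)]
    linarith
  have main : ∀ r r' : ℝ, 1 / 6 ≤ r → r ≤ r' → r' ≤ 1 / 2 →
      |r' * (2 * (1 - 2 * r') / (1 + 2 * r')) - r * (2 * (1 - 2 * r) / (1 + 2 * r))| ≤ r' - r := by
    intro r r' h1 h2 h3
    have p1 : 0 < 1 + 2 * r := by linarith
    have p2 : 0 < 1 + 2 * r' := by linarith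
    have q1 := p1.ne'
    have q2 := p2.ne'
    have e : r' * (2 * (1 - 2 * r') / (1 + 2 * r')) - r * (2 * (1 - 2 * r) / (1 + 2 * r)) =
        (r' - r) * (2 * (2 / ((1 + 2 * r) * (1 + 2 * r')) - 1)) := by
      have i : ∀ r : ℝ, 1 + 2 * r ≠ 0 →
          r * (2 * (1 - 2 * r) / (1 + 2 * r)) = 2 - 2 * r - 2 / (1 + 2 * r) := by
        intro r hr
        rw [eq_sub_iff_add_eq, mul_div_assoc', ← add_div, div_eq_iff hr]
        ring
      have j : 2 / (1 + 2 * r) - 2 / (1 + 2 * r') =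
          (r' - r) * (2 * (2 / ((1 + 2 * r) * (1 + 2 * r')))) := by
        rw [div_sub_div _ _ q1 q2]
        ring
      rw [i r q1, i r' q2]
      linear_combination j
    rw [e, abs_mul, abs_of_nonneg (by linarith : 0 ≤ r' - r)]
    refine mul_le_of_le_one_right (by linarith) ?_
    rw [abs_le]
    have hpos : 0 < (1 + 2 * r) * (1 + 2 * r') := by positivity
    constructor
    · have : 1 / 2 ≤ 2 / ((1 + 2 * r) * (1 + 2 * r')) := by
        rw [div_le_div_iff₀ (by norm_num) hpos]
        nlinarith
      linarith
    · have : 2 / ((1 + 2 * r) * (1 + 2 * r')) ≤ 3 / 2 := by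
        rw [div_le_div_iff₀ hpos (by norm_num)]
        nlinarith
      linarith
  subst hn hn'
  rcases le_or_gt s' (1 / 6) with h | h
  · rw [key' s' (by linarith) h, key' s hs (by linarith), mul_one, mul_one, abs_of_nonneg]
    linarith
  rw [key s' (by linarith) h.le]
  rcases le_or_gt s (1 / 6) with h2 | h2
  · rw [key' s hs h2, mul_one]
    have h3 := main (1 / 6) s' le_rfl h.le hs'
    norm_num at h3
    rw [abs_le] at h3 ⊢
    constructor <;> linarith [h3.1, h3.2]
  · rw [key s hs h2.le]
    exact main s s' h2.le hss hs'

theorem abs_cellOffset_mul_cellBump_sub_le_aux {t t' : ℝ} (h : t ≤ t') :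
    |cellOffset t' * cellBump t' - cellOffset t * cellBump t| ≤ t' - t := by
  have h0 := Int.floor_add_fract t
  have h0' := Int.floor_add_fract t'
  rcases (Int.floor_le_floor h).lt_or_eq with hlt | heq
  · have h1 : (⌊t⌋ : ℝ) + 1 ≤ ⌊t'⌋ := by exact_mod_cast hlt
    have h2 := Int.fract_nonneg t'
    have h3 := (Int.fract_lt_one t).le
    have h4 := abs_cellOffset_mul_cellBump_le_abs_sub t ⌊t'⌋
    have h5 := abs_cellOffset_mul_cellBump_le_abs_sub t' ⌊t'⌋
    rw [abs_of_nonpos (by linarith : t - ⌊t'⌋ ≤ 0)] at h4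
    rw [abs_of_nonneg (by linarith : 0 ≤ t' - ⌊t'⌋)] at h5
    have := abs_sub (cellOffset t' * cellBump t') (cellOffset t * cellBump t)
    linarith
  · have h1 : (⌊t⌋ : ℝ) = ⌊t'⌋ := by exact_mod_cast heq
    have hst : cellOffset t' - cellOffset t = t' - t := by
      rw [cellOffset, cellOffset]
      linarith
    have hb := abs_cellOffset_le t
    have hb' := abs_cellOffset_le t'
    have hab : ∀ r, |cellOffset r * cellBump r| ≤ |cellOffset r| := fun r => by
      rw [abs_mul, abs_of_nonneg (cellBump_nonneg r)]
      exact mul_le_of_le_one_right (abs_nonneg _) (cellBump_le_one r)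
    rcases le_total 0 (cellOffset t) with hs | hs
    · have := abs_profile_sub_le hs (by linarith : cellOffset t ≤ cellOffset t')
        ((le_abs_self _).trans hb') (n := cellBump t) (n' := cellBump t')
        (by rw [cellBump, abs_of_nonneg hs]) (by rw [cellBump, abs_of_nonneg (by linarith)])
      linarith
    · rcases le_total 0 (cellOffset t') with hs' | hs'
      · have h4 := hab t
        have h5 := hab t'
        rw [abs_of_nonpos hs] at h4
        rw [abs_of_nonneg hs'] at h5
        have := abs_sub (cellOffset t' * cellBump t') (cellOffset t * cellBump t)
        linarith
      · have := abs_profile_sub_le (neg_nonneg.2 hs') (by linarith : -cellOffset t' ≤ -cellOffset t)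
          ((neg_le_abs _).trans hb) (n := cellBump t') (n' := cellBump t)
          (by rw [cellBump, abs_of_nonpos hs']) (by rw [cellBump, abs_of_nonpos hs])
        rw [show -cellOffset t * cellBump t - -cellOffset t' * cellBump t' =
          cellOffset t' * cellBump t' - cellOffset t * cellBump t by ring] at this
        linarith

theorem abs_cellOffset_mul_cellBump_sub_le (t t' : ℝ) :
    |cellOffset t' * cellBump t' - cellOffset t * cellBump t| ≤ |t' - t| := by
  rcases le_total t t' with h | h
  · rw [abs_of_nonneg (sub_nonneg.2 h)]
    exact abs_cellOffset_mul_cellBump_sub_le_aux h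
  · rw [abs_sub_comm, abs_sub_comm t', abs_of_nonneg (sub_nonneg.2 h)]
    exact abs_cellOffset_mul_cellBump_sub_le_aux h

theorem abs_cellOffset_sub_le (t t' : ℝ) : |cellOffset t'| - |cellOffset t| ≤ |t' - t| := by
  obtain ⟨k, hk⟩ : ∃ k : ℤ, |t' - k| = 1 / 2 - |cellOffset t'| := by
    have h0 := Int.floor_add_fract t'
    rcases le_total 0 (cellOffset t') with h | h
    · refine ⟨⌊t'⌋ + 1, ?_⟩
      have := Int.fract_lt_one t'
      push_cast
      rw [abs_of_nonneg h, abs_of_nonpos (by linarith), cellOffset]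
      linarith
    · refine ⟨⌊t'⌋, ?_⟩
      have := Int.fract_nonneg t'
      rw [abs_of_nonpos h, abs_of_nonneg (by linarith), cellOffset]
      linarith
  have h1 := abs_cellOffset_le_of_int t k
  have h2 := abs_sub_le t t' k
  rw [abs_sub_comm t t'] at h2
  linarith

theorem cellBump_sub_le_aux {t t' : ℝ} (h : |cellOffset t| ≤ |cellOffset t'|) :
    cellBump t - cellBump t' ≤ 9 / 2 * (|cellOffset t'| - |cellOffset t|) := by
  have h0 := abs_nonneg (cellOffset t)
  rcases le_or_gt |cellOffset t'| (1 / 6) with h1 | h1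
  · rw [(cellBump_eq_one_iff t').2 h1, (cellBump_eq_one_iff t).2 (h.trans h1)]
    linarith
  rw [cellBump_of_le h1.le]
  set σ := |cellOffset t|
  set σ' := |cellOffset t'|
  rcases le_or_gt σ (1 / 6) with h2 | h2
  · rw [(cellBump_eq_one_iff t).2 h2]
    have : 1 - 2 * (1 - 2 * σ') / (1 + 2 * σ') = (6 * σ' - 1) / (1 + 2 * σ') := by
      field_simp
      ring
    rw [this, div_le_iff₀ (by linarith)]
    nlinarith
  · rw [cellBump_of_le h2.le]
    have : 2 * (1 - 2 * σ) / (1 + 2 * σ) - 2 * (1 - 2 * σ') / (1 + 2 * σ') =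
        (σ' - σ) * (8 / ((1 + 2 * σ) * (1 + 2 * σ'))) := by
      field_simp
      ring
    rw [this, mul_comm]
    refine mul_le_mul_of_nonneg_right ?_ (by linarith)
    rw [div_le_div_iff₀ (by positivity) (by norm_num)]
    nlinarith

theorem abs_cellBump_sub_le (t t' : ℝ) : |cellBump t' - cellBump t| ≤ 9 / 2 * |t' - t| := by
  rcases le_total |cellOffset t| |cellOffset t'| with h | h
  · have h1 := cellBump_sub_le_aux h
    have h2 := abs_cellOffset_sub_le t t'
    rw [abs_of_nonpos (sub_nonpos.2 (cellBump_anti h))]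
    linarith
  · have h1 := cellBump_sub_le_aux h
    have h2 := abs_cellOffset_sub_le t' t
    rw [abs_sub_comm t] at h2
    rw [abs_of_nonneg (sub_nonneg.2 (cellBump_anti h))]
    linarith

theorem dist_cellCollapse_le (z z' : ℝ × ℝ) :
    dist (cellCollapse z) (cellCollapse z') ≤ 29 / 10 * dist z z' := by
  have main : ∀ x x' y y' : ℝ,
      |(x - cellOffset x * cellBump x * cellBump y) -
        (x' - cellOffset x' * cellBump x' * cellBump y')| ≤ 2 * |x - x'| + 9 / 10 * |y - y'| := by
    intro x x' y y'
    have e : (x - cellOffset x * cellBump x * cellBump y) -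
        (x' - cellOffset x' * cellBump x' * cellBump y') =
        (x - x') - (cellOffset x * cellBump x - cellOffset x' * cellBump x') * cellBump y -
          cellOffset x' * cellBump x' * (cellBump y - cellBump y') := by ring
    rw [e]
    refine (abs_sub _ _).trans ((add_le_add_left (abs_sub _ _) _).trans ?_)
    rw [abs_mul, abs_mul (cellOffset x' * cellBump x'), abs_of_nonneg (cellBump_nonneg y)]
    have h1 := abs_cellOffset_mul_cellBump_sub_le x' x
    have h2 := abs_cellBump_sub_le y' y
    have h3 := abs_cellOffset_mul_cellBump_le_fifth x'
    have h4 := mul_le_mul h1 (cellBump_le_one y) (cellBump_nonneg y) (abs_nonneg _)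
    have h5 := mul_le_mul h3 h2 (abs_nonneg _) (by norm_num)
    linarith
  have h1 : |z.1 - z'.1| ≤ dist z z' := by
    rw [Prod.dist_eq, ← Real.dist_eq]; exact le_max_left _ _
  have h2 : |z.2 - z'.2| ≤ dist z z' := by
    rw [Prod.dist_eq, ← Real.dist_eq]; exact le_max_right _ _
  rw [Prod.dist_eq, Real.dist_eq, Real.dist_eq]
  refine max_le ?_ ?_
  · have := main z.1 z'.1 z.2 z'.2
    simp only [cellCollapse, ← mul_assoc]
    linarith
  · have := main z.2 z'.2 z.1 z'.1
    simp only [cellCollapse, mul_comm (cellBump z.1), mul_comm (cellBump z'.1), ← mul_assoc]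
    linarith

theorem sub_cellOffset_eq (t : ℝ) : t - cellOffset t = ⌊t⌋ + 1 / 2 := by
  rw [cellOffset]
  linarith [Int.floor_add_fract t]

theorem cellOffset_int_add {s : ℝ} (k : ℤ) (h1 : -(1 / 2) ≤ s) (h2 : s < 1 / 2) :
    cellOffset (k + 1 / 2 + s) = s := by
  have : Int.fract (k + 1 / 2 + s : ℝ) = s + 1 / 2 := by
    rw [Int.fract_eq_iff]
    exact ⟨by linarith, by linarith, k, by ring⟩
  rw [cellOffset, this]
  ring

theorem cellOffset_nonneg_lt (t : ℝ) : -(1 / 2) ≤ cellOffset t ∧ cellOffset t < 1 / 2 := by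
  rw [cellOffset]
  constructor <;> linarith [Int.fract_nonneg t, Int.fract_lt_one t]

theorem cellBump_eq_zero_of_fract {t : ℝ} (h : Int.fract t = 0) : cellBump t = 0 := by
  rw [cellBump, cellOffset, h]
  norm_num

theorem floor_sub_cellOffset_mul {t c : ℝ} (h0 : 0 ≤ c) (h1 : c ≤ 1) :
    ⌊t - cellOffset t * c⌋ = ⌊t⌋ := by
  have h2 := Int.fract_nonneg t
  have h3 := Int.fract_lt_one t
  have h4 := Int.floor_add_fract t
  have e : t - cellOffset t * c = ⌊t⌋ + (Int.fract t * (1 - c) + c / 2) := by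
    rw [cellOffset]
    linear_combination (-1 : ℝ) * h4
  rw [e, Int.floor_eq_iff]
  constructor
  · nlinarith
  · rcases h0.eq_or_lt with rfl | h0
    · linarith
    · nlinarith

theorem int_le_sub_cellOffset_mul_iff {t c : ℝ} (h0 : 0 ≤ c) (h1 : c ≤ 1) (k : ℤ) :
    (k : ℝ) ≤ t - cellOffset t * c ↔ (k : ℝ) ≤ t := by
  rw [← Int.le_floor, floor_sub_cellOffset_mul h0 h1, Int.le_floor]

theorem sub_cellOffset_mul_le_int_iff {t c : ℝ} (h0 : 0 ≤ c) (h1 : c ≤ cellBump t) (k : ℤ) :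
    t - cellOffset t * c ≤ (k : ℝ) ↔ t ≤ (k : ℝ) := by
  have h2 := Int.fract_nonneg t
  have h3 := Int.fract_lt_one t
  have h4 := Int.floor_add_fract t
  have hc := h1.trans (cellBump_le_one t)
  have e : t - cellOffset t * c = ⌊t⌋ + (Int.fract t * (1 - c) + c / 2) := by
    rw [cellOffset]
    linear_combination (-1 : ℝ) * h4
  constructor
  · intro h
    by_contra! hk
    have h5 : k ≤ ⌊t⌋ := Int.le_floor.2 hk.le
    have h6 : (k : ℝ) ≤ ⌊t⌋ := by exact_mod_cast h5
    rw [e] at h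
    have h7 : 0 ≤ Int.fract t * (1 - c) := mul_nonneg h2 (by linarith)
    have h8 : c = 0 := by linarith
    rw [h8] at h
    linarith
  · intro h
    rcases h.lt_or_eq with h | h
    · have h5 : ⌊t⌋ < k := Int.floor_lt.2 h
      rw [← floor_sub_cellOffset_mul h0 hc, Int.floor_lt] at h5
      exact h5.le
    · have h5 : cellBump t = 0 := cellBump_eq_zero_of_fract (by rw [h, Int.fract_intCast])
      have h6 : c = 0 := le_antisymm (h5 ▸ h1) h0
      rw [h6, mul_zero, sub_zero]
      exact h.le

theorem cellBump_mul_nonneg (s t : ℝ) : 0 ≤ cellBump s * cellBump t :=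
  mul_nonneg (cellBump_nonneg s) (cellBump_nonneg t)

theorem cellBump_mul_le_left (s t : ℝ) : cellBump s * cellBump t ≤ cellBump s :=
  mul_le_of_le_one_right (cellBump_nonneg s) (cellBump_le_one t)

theorem cellBump_mul_le_right (s t : ℝ) : cellBump s * cellBump t ≤ cellBump t :=
  mul_le_of_le_one_left (cellBump_nonneg t) (cellBump_le_one s)

theorem cellBump_mul_le_one (s t : ℝ) : cellBump s * cellBump t ≤ 1 :=
  (cellBump_mul_le_left s t).trans (cellBump_le_one s)

theorem cellBump_mul_eq_one_iff (s t : ℝ) :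
    cellBump s * cellBump t = 1 ↔ |cellOffset s| ≤ 1 / 6 ∧ |cellOffset t| ≤ 1 / 6 := by
  rw [← cellBump_eq_one_iff, ← cellBump_eq_one_iff]
  constructor
  · intro h
    have h1 := cellBump_mul_le_left s t
    have h2 := cellBump_mul_le_right s t
    exact ⟨le_antisymm (cellBump_le_one s) (h ▸ h1), le_antisymm (cellBump_le_one t) (h ▸ h2)⟩
  · rintro ⟨h1, h2⟩
    rw [h1, h2, one_mul]

/-- The closed middle ninth of the unit cell with lower left corner `k`. -/
def cellHole (k : ℤ × ℤ) : Set (ℝ × ℝ) :=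
  {z | |z.1 - (k.1 + 1 / 2)| ≤ 1 / 6 ∧ |z.2 - (k.2 + 1 / 2)| ≤ 1 / 6}

theorem cellOffset_of_abs_le {t : ℝ} {k : ℤ} (h : |t - (k + 1 / 2)| ≤ 1 / 6) :
    cellOffset t = t - (k + 1 / 2) := by
  have h' := abs_le.1 h
  have := cellOffset_int_add (s := t - (k + 1 / 2)) k (by linarith) (by linarith)
  rwa [add_sub_cancel] at this

theorem mem_cellHole_floor_iff (z : ℝ × ℝ) :
    z ∈ cellHole (⌊z.1⌋, ⌊z.2⌋) ↔ cellBump z.1 * cellBump z.2 = 1 := by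
  rw [cellBump_mul_eq_one_iff]
  have h : ∀ t : ℝ, t - (⌊t⌋ + 1 / 2) = cellOffset t := fun t => by
    rw [← sub_cellOffset_eq]; ring
  simp only [cellHole, mem_ofPred_eq, h]

theorem cellCollapse_of_mem_cellHole {k : ℤ × ℤ} {z : ℝ × ℝ} (h : z ∈ cellHole k) :
    cellCollapse z = ((k.1 : ℝ) + 1 / 2, (k.2 : ℝ) + 1 / 2) := by
  have h1 := cellOffset_of_abs_le h.1
  have h2 := cellOffset_of_abs_le h.2
  have h3 : cellBump z.1 * cellBump z.2 = 1 := by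
    rw [cellBump_mul_eq_one_iff, h1, h2]
    exact h
  rw [cellCollapse, h3, h1, h2]
  ext <;> simp

theorem cellCollapse_fiber {z z' : ℝ × ℝ} (h : cellCollapse z = cellCollapse z') :
    z = z' ∨ ∃ k, z ∈ cellHole k ∧ z' ∈ cellHole k := by
  have hx := congrArg Prod.fst h
  have hy := congrArg Prod.snd h
  have hfx : ⌊z.1⌋ = ⌊z'.1⌋ := by
    have := congrArg Int.floor hx
    rwa [cellCollapse, cellCollapse,
      floor_sub_cellOffset_mul (cellBump_mul_nonneg _ _) (cellBump_mul_le_one _ _),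
      floor_sub_cellOffset_mul (cellBump_mul_nonneg _ _) (cellBump_mul_le_one _ _)] at this
  have hfy : ⌊z.2⌋ = ⌊z'.2⌋ := by
    have := congrArg Int.floor hy
    rwa [cellCollapse, cellCollapse,
      floor_sub_cellOffset_mul (cellBump_mul_nonneg _ _) (cellBump_mul_le_one _ _),
      floor_sub_cellOffset_mul (cellBump_mul_nonneg _ _) (cellBump_mul_le_one _ _)] at this
  have ex := sub_cellOffset_eq z.1
  have ey := sub_cellOffset_eq z.2
  have ex' := sub_cellOffset_eq z'.1
  have ey' := sub_cellOffset_eq z'.2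
  rw [← hfx] at ex'
  rw [← hfy] at ey'
  have hm := mem_cellHole_floor_iff z
  have hm' := mem_cellHole_floor_iff z'
  rw [← hfx, ← hfy] at hm'
  have hc := cellBump_mul_le_one z.1 z.2
  have hc' := cellBump_mul_le_one z'.1 z'.2
  simp only [cellCollapse] at hx hy
  have hone := cellBump_mul_eq_one_iff z.1 z.2
  have hone' := cellBump_mul_eq_one_iff z'.1 z'.2
  have hanti : |cellOffset z.1| ≤ |cellOffset z'.1| → |cellOffset z.2| ≤ |cellOffset z'.2| →
      cellBump z'.1 * cellBump z'.2 ≤ cellBump z.1 * cellBump z.2 := fun h1 h2 =>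
    mul_le_mul (cellBump_anti h1) (cellBump_anti h2) (cellBump_nonneg _) (cellBump_nonneg _)
  have hanti' : |cellOffset z'.1| ≤ |cellOffset z.1| → |cellOffset z'.2| ≤ |cellOffset z.2| →
      cellBump z.1 * cellBump z.2 ≤ cellBump z'.1 * cellBump z'.2 := fun h1 h2 =>
    mul_le_mul (cellBump_anti h1) (cellBump_anti h2) (cellBump_nonneg _) (cellBump_nonneg _)
  set c := 1 - cellBump z.1 * cellBump z.2 with hcdef
  set c' := 1 - cellBump z'.1 * cellBump z'.2 with hcdef'
  have qx : cellOffset z.1 * c = cellOffset z'.1 * c' := by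
    rw [hcdef, hcdef']; linear_combination hx - ex + ex'
  have qy : cellOffset z.2 * c = cellOffset z'.2 * c' := by
    rw [hcdef, hcdef']; linear_combination hy - ey + ey'
  have c0 : 0 ≤ c := by linarith
  have c0' : 0 ≤ c' := by linarith
  have absx : |cellOffset z.1| * c = |cellOffset z'.1| * c' := by
    have := congrArg abs qx
    rwa [abs_mul, abs_mul, abs_of_nonneg c0, abs_of_nonneg c0'] at this
  have absy : |cellOffset z.2| * c = |cellOffset z'.2| * c' := by
    have := congrArg abs qy
    rwa [abs_mul, abs_mul, abs_of_nonneg c0, abs_of_nonneg c0'] at this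
  have hzero : ∀ {u v d : ℝ}, |u| * d = 0 → |v| * d = 0 → 0 < d → |u| ≤ 1 / 6 ∧ |v| ≤ 1 / 6 := by
    intro u v d h1 h2 hd
    rw [(mul_eq_zero.1 h1).resolve_right hd.ne', (mul_eq_zero.1 h2).resolve_right hd.ne']
    norm_num
  rcases c0.eq_or_lt with c1 | c1
  · right
    refine ⟨_, hm.2 (by linarith), hm'.2 ?_⟩
    by_contra hne
    have c1' : 0 < c' := lt_of_le_of_ne c0' fun h => hne (by linarith)
    rw [← c1, mul_zero] at absx absy
    exact hne (hone'.2 (hzero absx.symm absy.symm c1'))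
  rcases c0'.eq_or_lt with c1' | c1'
  · right
    refine ⟨_, hm.2 ?_, hm'.2 (by linarith)⟩
    by_contra hne
    rw [← c1', mul_zero] at absx absy
    exact hne (hone.2 (hzero absx absy c1))
  left
  have hcc : c = c' := by
    rcases lt_trichotomy c c' with hlt | heq | hlt
    · have h1 : |cellOffset z'.1| ≤ |cellOffset z.1| := by
        by_contra! hh
        nlinarith [abs_nonneg (cellOffset z.1)]
      have h2 : |cellOffset z'.2| ≤ |cellOffset z.2| := by
        by_contra! hh
        nlinarith [abs_nonneg (cellOffset z.2)]
      have := hanti' h1 h2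
      linarith
    · exact heq
    · have h1 : |cellOffset z.1| ≤ |cellOffset z'.1| := by
        by_contra! hh
        nlinarith [abs_nonneg (cellOffset z'.1)]
      have h2 : |cellOffset z.2| ≤ |cellOffset z'.2| := by
        by_contra! hh
        nlinarith [abs_nonneg (cellOffset z'.2)]
      have := hanti h1 h2
      linarith
  rw [hcc] at qx qy
  have px := mul_right_cancel₀ c1'.ne' qx
  have py := mul_right_cancel₀ c1'.ne' qy
  exact Prod.ext (by linarith) (by linarith)

theorem cellCollapse_surjective : Function.Surjective cellCollapse := by
  intro w
  let n : ℝ → ℝ := fun σ => min 1 (2 * (1 - 2 * σ) / (1 + 2 * σ))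
  set p := |cellOffset w.1| with hp
  set q := |cellOffset w.2| with hq
  have hp0 : 0 ≤ p := abs_nonneg _
  have hq0 : 0 ≤ q := abs_nonneg _
  have hp1 : p ≤ 1 / 2 := abs_cellOffset_le _
  have hq1 : q ≤ 1 / 2 := abs_cellOffset_le _
  rcases (le_max_of_le_left hp0 : 0 ≤ max p q).eq_or_lt with hm | hm
  · have hp' : p = 0 := le_antisymm (hm ▸ le_max_left p q) hp0
    have hq' : q = 0 := le_antisymm (hm ▸ le_max_right p q) hq0
    refine ⟨w, ?_⟩
    rw [cellCollapse, abs_eq_zero.1 hp', abs_eq_zero.1 hq']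
    simp
  obtain ⟨R, hR⟩ : ∃ R, R * max p q = 1 / 2 := ⟨1 / 2 / max p q, div_mul_cancel₀ _ hm.ne'⟩
  have hR1 : 1 ≤ R := by
    by_contra! h
    have : max p q ≤ 1 / 2 := max_le hp1 hq1
    nlinarith
  have hn0 : ∀ r, 0 ≤ r → r ≤ 1 / 2 → 0 ≤ n r := fun r h h' =>
    le_min zero_le_one (div_nonneg (by linarith) (by linarith))
  let g : ℝ → ℝ := fun r => r * (1 - n (r * p) * n (r * q))
  have hnc : ∀ v, 0 ≤ v → ContinuousOn (fun r => n (r * v)) (Icc 1 R) := by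
    intro v hv
    refine ContinuousOn.inf continuousOn_const (ContinuousOn.div (by fun_prop) (by fun_prop) ?_)
    intro r hr
    have := mul_nonneg (zero_le_one.trans hr.1) hv
    linarith
  have hgc : ContinuousOn g (Icc 1 R) :=
    continuousOn_id.mul (continuousOn_const.sub ((hnc p hp0).mul (hnc q hq0)))
  have hle : ∀ r ∈ Icc 1 R, r * p ≤ 1 / 2 ∧ r * q ≤ 1 / 2 := by
    intro r hr
    have h1 : p ≤ max p q := le_max_left _ _
    have h2 : q ≤ max p q := le_max_right _ _
    have h3 := hr.1
    have h4 := hr.2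
    constructor <;> nlinarith
  have hhalf : n (1 / 2) = 0 := by simp only [n]; norm_num
  have hgR : g R = R := by
    simp only [g]
    rcases le_total p q with h | h
    · rw [max_eq_right h] at hR
      rw [hR, hhalf]; ring
    · rw [max_eq_left h] at hR
      rw [hR, hhalf]; ring
  have hg1 : g 1 ≤ 1 := by
    have h1 := hn0 p hp0 hp1
    have h2 := hn0 q hq0 hq1
    have h3 := mul_nonneg h1 h2
    simp only [g, one_mul]
    linarith
  obtain ⟨r, hr, hgr⟩ := intermediate_value_Icc hR1 hgc ⟨hg1, hgR.symm ▸ hR1⟩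
  have hr0 : 0 < r := zero_lt_one.trans_le hr.1
  have hlt : ∀ t : ℝ, |cellOffset t| = p ∨ |cellOffset t| = q →
      -(1 / 2) ≤ r * cellOffset t ∧ r * cellOffset t < 1 / 2 := by
    intro t ht
    have hrt : r * |cellOffset t| ≤ 1 / 2 := by
      rcases ht with ht | ht <;> rw [ht]
      exacts [(hle r hr).1, (hle r hr).2]
    have habs : |r * cellOffset t| ≤ 1 / 2 := by rwa [abs_mul, abs_of_pos hr0]
    refine ⟨(abs_le.1 habs).1, lt_of_le_of_ne (abs_le.1 habs).2 fun heq => ?_⟩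
    have h1 : r * |cellOffset t| = 1 / 2 := by
      rw [← abs_of_pos hr0, ← abs_mul, heq]
      norm_num
    have h2 : g r = r := by
      simp only [g]
      rcases ht with ht | ht <;> rw [ht] at h1 <;> rw [h1, hhalf] <;> ring
    have h3 : r = 1 := h2.symm.trans hgr
    rw [h3, one_mul] at heq
    exact (cellOffset_nonneg_lt t).2.ne heq
  have h1 := hlt w.1 (Or.inl rfl)
  have h2 := hlt w.2 (Or.inr rfl)
  refine ⟨(⌊w.1⌋ + 1 / 2 + r * cellOffset w.1, ⌊w.2⌋ + 1 / 2 + r * cellOffset w.2), ?_⟩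
  have o1 := cellOffset_int_add ⌊w.1⌋ h1.1 h1.2
  have o2 := cellOffset_int_add ⌊w.2⌋ h2.1 h2.2
  have b1 : cellBump (⌊w.1⌋ + 1 / 2 + r * cellOffset w.1) = n (r * p) := by
    simp only [cellBump, n, o1, abs_mul, abs_of_pos hr0, hp]
  have b2 : cellBump (⌊w.2⌋ + 1 / 2 + r * cellOffset w.2) = n (r * q) := by
    simp only [cellBump, n, o2, abs_mul, abs_of_pos hr0, hq]
  simp only [g] at hgr
  have e1 := sub_cellOffset_eq w.1
  have e2 := sub_cellOffset_eq w.2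
  simp only [cellCollapse, o1, o2, b1, b2]
  ext
  · linear_combination cellOffset w.1 * hgr - e1
  · linear_combination cellOffset w.2 * hgr - e2

theorem continuous_cellCollapse : Continuous cellCollapse :=
  (LipschitzWith.of_dist_le_mul (K := ⟨29 / 10, by norm_num⟩) dist_cellCollapse_le).continuous

theorem dist_cellCollapse_self_le (z : ℝ × ℝ) : dist z (cellCollapse z) ≤ 1 := by
  rw [Prod.dist_eq, Real.dist_eq, Real.dist_eq]
  have h : ∀ t c : ℝ, 0 ≤ c → c ≤ 1 → |t - (t - cellOffset t * c)| ≤ 1 := by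
    intro t c h0 h1
    rw [sub_sub_cancel, abs_mul, abs_of_nonneg h0]
    have := abs_cellOffset_le t
    have := abs_nonneg (cellOffset t)
    nlinarith
  exact max_le (h _ _ (cellBump_mul_nonneg _ _) (cellBump_mul_le_one _ _))
    (h _ _ (cellBump_mul_nonneg _ _) (cellBump_mul_le_one _ _))

theorem cellCollapse_swap (z : ℝ × ℝ) : cellCollapse z.swap = (cellCollapse z).swap := by
  simp only [cellCollapse, Prod.fst_swap, Prod.snd_swap, Prod.swap_prod_mk,
    mul_comm (cellBump z.1)]

/-- Finite stages of the collapse of all holes of the carpet. -/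
noncomputable def collapseIter : ℕ → ℝ × ℝ → ℝ × ℝ
  | 0 => id
  | n + 1 => fun z => cellCollapse ((1 / 3 : ℝ) • collapseIter n ((3 : ℝ) • z))

theorem collapseIter_succ (n : ℕ) (z : ℝ × ℝ) :
    collapseIter (n + 1) z = cellCollapse ((1 / 3 : ℝ) • collapseIter n ((3 : ℝ) • z)) := rfl

theorem collapseIter_swap (n : ℕ) (z : ℝ × ℝ) :
    collapseIter n z.swap = (collapseIter n z).swap := by
  induction n generalizing z with
  | zero => rfl
  | succ n ih =>
    have h : ∀ (r : ℝ) (w : ℝ × ℝ), r • w.swap = (r • w).swap := fun r w => rfl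
    rw [collapseIter_succ, collapseIter_succ, h, ih, h, cellCollapse_swap]

theorem dist_collapseIter_succ_le (n : ℕ) (z : ℝ × ℝ) :
    dist (collapseIter n z) (collapseIter (n + 1) z) ≤ 1 * (29 / 30 : ℝ) ^ n := by
  induction n generalizing z with
  | zero =>
    have : collapseIter 1 z = cellCollapse z := by
      rw [collapseIter_succ]
      simp only [collapseIter, id, smul_smul]
      norm_num
    rw [zero_add, this, pow_zero, one_mul]
    exact dist_cellCollapse_self_le z
  | succ n ih =>
    rw [collapseIter_succ, collapseIter_succ]
    refine (dist_cellCollapse_le _ _).trans ?_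
    rw [dist_smul₀, Real.norm_of_nonneg (by norm_num), pow_succ]
    linarith [ih ((3 : ℝ) • z)]

/-- The collapse of every hole of the carpet to a point. -/
noncomputable def collapse (z : ℝ × ℝ) : ℝ × ℝ := limUnder atTop fun n => collapseIter n z

theorem tendsto_collapseIter (z : ℝ × ℝ) :
    Tendsto (fun n => collapseIter n z) atTop (𝓝 (collapse z)) :=
  (cauchySeq_of_le_geometric _ _ (by norm_num) fun n =>
    dist_collapseIter_succ_le n z).tendsto_limUnder

theorem dist_collapseIter_collapse_le (n : ℕ) (z : ℝ × ℝ) :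
    dist (collapseIter n z) (collapse z) ≤ 30 * (29 / 30 : ℝ) ^ n := by
  have := dist_le_of_le_geometric_of_tendsto _ _ (by norm_num)
    (fun n => dist_collapseIter_succ_le n z) (tendsto_collapseIter z) n
  rw [one_mul, div_eq_mul_inv] at this
  norm_num at this ⊢
  linarith

theorem dist_collapse_le (z : ℝ × ℝ) : dist z (collapse z) ≤ 30 := by
  simpa [collapseIter] using dist_collapseIter_collapse_le 0 z

theorem continuous_collapseIter (n : ℕ) : Continuous (collapseIter n) := by
  induction n with
  | zero => exact continuous_id
  | succ n ih =>
    exact continuous_cellCollapse.comp ((ih.comp (continuous_const_smul (3 : ℝ))).const_smul (1 / 3 : ℝ))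

theorem tendsto_geom_collapse : Tendsto (fun n : ℕ => 30 * (29 / 30 : ℝ) ^ n) atTop (𝓝 0) := by
  simpa using (tendsto_pow_atTop_nhds_zero_of_lt_one (r := (29 / 30 : ℝ)) (by norm_num)
    (by norm_num)).const_mul 30

theorem continuous_collapse : Continuous collapse := by
  have : TendstoUniformly collapseIter collapse atTop := by
    rw [Metric.tendstoUniformly_iff]
    intro ε hε
    filter_upwards [tendsto_geom_collapse.eventually_lt_const hε] with n hn z
    rw [dist_comm]
    exact (dist_collapseIter_collapse_le n z).trans_lt hn
  exact this.continuous (.of_forall continuous_collapseIter)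

theorem collapse_eq_cellCollapse (z : ℝ × ℝ) :
    collapse z = cellCollapse ((1 / 3 : ℝ) • collapse ((3 : ℝ) • z)) := by
  refine tendsto_nhds_unique ((tendsto_collapseIter z).comp (tendsto_add_atTop_nat 1)) ?_
  exact (continuous_cellCollapse.tendsto _).comp ((tendsto_collapseIter _).const_smul _)

theorem collapse_swap (z : ℝ × ℝ) : collapse z.swap = (collapse z).swap := by
  refine tendsto_nhds_unique (tendsto_collapseIter z.swap) ?_
  simp only [collapseIter_swap]
  exact (continuous_swap.tendsto _).comp (tendsto_collapseIter z)

theorem int_le_cellCollapse_fst_iff (k : ℤ) (z : ℝ × ℝ) : (k : ℝ) ≤ (cellCollapse z).1 ↔ k ≤ z.1 :=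
  int_le_sub_cellOffset_mul_iff (cellBump_mul_nonneg _ _) (cellBump_mul_le_one _ _) k

theorem cellCollapse_fst_le_int_iff (k : ℤ) (z : ℝ × ℝ) : (cellCollapse z).1 ≤ k ↔ z.1 ≤ k :=
  sub_cellOffset_mul_le_int_iff (cellBump_mul_nonneg _ _) (cellBump_mul_le_left _ _) k

theorem int_le_collapseIter_fst_iff (n : ℕ) (k : ℤ) (z : ℝ × ℝ) :
    (k : ℝ) ≤ (collapseIter n z).1 ↔ k ≤ z.1 := by
  induction n generalizing k z with
  | zero => rfl
  | succ n ih =>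
    have := ih (3 * k) ((3 : ℝ) • z)
    rw [collapseIter_succ, int_le_cellCollapse_fst_iff]
    simp only [Prod.smul_fst, smul_eq_mul, Int.cast_mul, Int.cast_ofNat] at this ⊢
    constructor
    · intro h
      linarith [this.1 (by linarith)]
    · intro h
      linarith [this.2 (by linarith)]

theorem collapseIter_fst_le_int_iff (n : ℕ) (k : ℤ) (z : ℝ × ℝ) :
    (collapseIter n z).1 ≤ k ↔ z.1 ≤ k := by
  induction n generalizing k z with
  | zero => rfl
  | succ n ih =>
    have := ih (3 * k) ((3 : ℝ) • z)
    rw [collapseIter_succ, cellCollapse_fst_le_int_iff]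
    simp only [Prod.smul_fst, smul_eq_mul, Int.cast_mul, Int.cast_ofNat] at this ⊢
    constructor
    · intro h
      linarith [this.1 (by linarith)]
    · intro h
      linarith [this.2 (by linarith)]

theorem le_of_forall_pow_mul_le {a b C : ℝ} (h : ∀ n : ℕ, 3 ^ n * a ≤ 3 ^ n * b + C) : a ≤ b := by
  by_contra! hab
  obtain ⟨n, hn⟩ := pow_unbounded_of_one_lt (C / (a - b)) (by norm_num : (1 : ℝ) < 3)
  rw [div_lt_iff₀ (by linarith)] at hn
  linarith [h n]

theorem int_le_collapse_fst_iff (k : ℤ) (z : ℝ × ℝ) : (k : ℝ) ≤ (collapse z).1 ↔ k ≤ z.1 := by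
  constructor
  · intro h
    have key : ∀ n : ℕ, (3 ^ n : ℝ) * k ≤ (collapse ((3 ^ n : ℝ) • z)).1 := by
      intro n
      induction n with
      | zero => simpa using h
      | succ n ih =>
        rw [collapse_eq_cellCollapse] at ih
        have h1 := (int_le_cellCollapse_fst_iff (3 ^ n * k) _).1 (by push_cast; exact ih)
        rw [smul_smul, ← pow_succ', Prod.smul_fst, smul_eq_mul] at h1
        push_cast at h1
        rw [pow_succ'] at h1 ⊢
        linarith
    refine le_of_forall_pow_mul_le (C := 30) fun n => (key n).trans ?_
    have h1 := (le_max_left _ _).trans (dist_collapse_le ((3 ^ n : ℝ) • z))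
    rw [dist_comm, Real.dist_eq] at h1
    have h2 := (abs_le.1 h1).2
    rw [Prod.smul_fst, smul_eq_mul] at h2
    linarith
  · intro h
    exact ge_of_tendsto' ((continuous_fst.tendsto _).comp (tendsto_collapseIter z))
      fun n => (int_le_collapseIter_fst_iff n k z).2 h

theorem collapse_fst_le_int_iff (k : ℤ) (z : ℝ × ℝ) : (collapse z).1 ≤ k ↔ z.1 ≤ k := by
  constructor
  · intro h
    have key : ∀ n : ℕ, (collapse ((3 ^ n : ℝ) • z)).1 ≤ (3 ^ n : ℝ) * k := by
      intro n
      induction n with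
      | zero => simpa using h
      | succ n ih =>
        rw [collapse_eq_cellCollapse] at ih
        have h1 := (cellCollapse_fst_le_int_iff (3 ^ n * k) _).1 (by push_cast; exact ih)
        rw [smul_smul, ← pow_succ', Prod.smul_fst, smul_eq_mul] at h1
        push_cast at h1
        rw [pow_succ'] at h1 ⊢
        linarith
    refine le_of_forall_pow_mul_le (C := 30) fun n => ?_
    have h1 := (le_max_left _ _).trans (dist_collapse_le ((3 ^ n : ℝ) • z))
    rw [dist_comm, Real.dist_eq] at h1
    have h2 := (abs_le.1 h1).1
    rw [Prod.smul_fst, smul_eq_mul] at h2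
    linarith [key n]
  · intro h
    exact le_of_tendsto' ((continuous_fst.tendsto _).comp (tendsto_collapseIter z))
      fun n => (collapseIter_fst_le_int_iff n k z).2 h

theorem int_le_collapse_snd_iff (k : ℤ) (z : ℝ × ℝ) : (k : ℝ) ≤ (collapse z).2 ↔ k ≤ z.2 := by
  have := int_le_collapse_fst_iff k z.swap
  rwa [collapse_swap] at this

theorem collapse_snd_le_int_iff (k : ℤ) (z : ℝ × ℝ) : (collapse z).2 ≤ k ↔ z.2 ≤ k := by
  have := collapse_fst_le_int_iff k z.swap
  rwa [collapse_swap] at this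

theorem collapse_mem_Icc_iff (z : ℝ × ℝ) : collapse z ∈ Icc (0 : ℝ × ℝ) 1 ↔ z ∈ Icc (0 : ℝ × ℝ) 1 := by
  have h1 := int_le_collapse_fst_iff 0 z
  have h2 := int_le_collapse_snd_iff 0 z
  have h3 := collapse_fst_le_int_iff 1 z
  have h4 := collapse_snd_le_int_iff 1 z
  simp only [Int.cast_zero, Int.cast_one] at h1 h2 h3 h4
  simp only [mem_Icc, Prod.le_def, Prod.fst_zero, Prod.snd_zero, Prod.fst_one, Prod.snd_one, h1,
    h2, h3, h4]

theorem abs_le_sixth_iff (t : ℝ) (k : ℤ) :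
    |t - (k + 1 / 2)| ≤ 1 / 6 ↔ ((3 * k + 1 : ℤ) : ℝ) ≤ 3 * t ∧ 3 * t ≤ ((3 * k + 2 : ℤ) : ℝ) := by
  push_cast
  rw [abs_le]
  constructor <;> rintro ⟨h1, h2⟩ <;> constructor <;> linarith

theorem smul_collapse_mem_cellHole_iff (k : ℤ × ℤ) (z : ℝ × ℝ) :
    (1 / 3 : ℝ) • collapse ((3 : ℝ) • z) ∈ cellHole k ↔ z ∈ cellHole k := by
  have e : ∀ w : ℝ, 3 * (1 / 3 * w) = w := fun w => by ring
  simp only [cellHole, mem_ofPred_eq, abs_le_sixth_iff, Prod.smul_fst, Prod.smul_snd, smul_eq_mul,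
    e, int_le_collapse_fst_iff, int_le_collapse_snd_iff, collapse_fst_le_int_iff,
    collapse_snd_le_int_iff]

theorem collapse_of_mem_cellHole {k : ℤ × ℤ} {z : ℝ × ℝ} (h : z ∈ cellHole k) :
    collapse z = ((k.1 : ℝ) + 1 / 2, (k.2 : ℝ) + 1 / 2) := by
  rw [collapse_eq_cellCollapse]
  exact cellCollapse_of_mem_cellHole ((smul_collapse_mem_cellHole_iff k z).2 h)

theorem collapse_step {z z' : ℝ × ℝ} (h : collapse z = collapse z') :
    collapse ((3 : ℝ) • z) = collapse ((3 : ℝ) • z') ∨ ∃ k, z ∈ cellHole k ∧ z' ∈ cellHole k := by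
  rw [collapse_eq_cellCollapse, collapse_eq_cellCollapse z'] at h
  rcases cellCollapse_fiber h with h | ⟨k, h1, h2⟩
  · exact Or.inl (smul_right_injective _ (by norm_num : (1 / 3 : ℝ) ≠ 0) h)
  · exact Or.inr ⟨k, (smul_collapse_mem_cellHole_iff _ _).1 h1,
      (smul_collapse_mem_cellHole_iff _ _).1 h2⟩

theorem collapse_fiber {z z' : ℝ × ℝ} (h : collapse z = collapse z') :
    z = z' ∨ ∃ (n : ℕ) (k : ℤ × ℤ), (3 ^ n : ℝ) • z ∈ cellHole k ∧ (3 ^ n : ℝ) • z' ∈ cellHole k := by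
  rw [or_iff_not_imp_right]
  intro hn
  push Not at hn
  have key : ∀ n : ℕ, collapse ((3 ^ n : ℝ) • z) = collapse ((3 ^ n : ℝ) • z') := by
    intro n
    induction n with
    | zero => simpa using h
    | succ n ih =>
      rcases collapse_step ih with h1 | ⟨k, h1, h2⟩
      · rwa [smul_smul, smul_smul, ← pow_succ'] at h1
      · exact absurd h2 (hn n k h1)
  rw [← dist_le_zero]
  refine le_of_forall_pow_mul_le (C := 60) fun n => ?_
  have h1 := dist_triangle_right ((3 ^ n : ℝ) • z) ((3 ^ n : ℝ) • z') (collapse ((3 ^ n : ℝ) • z))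
  have h2 := dist_collapse_le ((3 ^ n : ℝ) • z)
  have h3 := dist_collapse_le ((3 ^ n : ℝ) • z')
  rw [← key n] at h3
  rw [dist_smul₀, Real.norm_of_nonneg (by positivity)] at h1
  linarith

theorem collapseIter_surjective (n : ℕ) : Function.Surjective (collapseIter n) := by
  induction n with
  | zero => exact Function.surjective_id
  | succ n ih =>
    intro w
    obtain ⟨u, rfl⟩ := cellCollapse_surjective w
    obtain ⟨z, hz⟩ := ih ((3 : ℝ) • u)
    refine ⟨(1 / 3 : ℝ) • z, ?_⟩
    rw [collapseIter_succ, smul_smul]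
    norm_num [hz, smul_smul]

theorem collapse_surjective : Function.Surjective collapse := by
  intro w
  have hK : IsClosed (collapse '' Metric.closedBall w 60) :=
    ((isCompact_closedBall w 60).image continuous_collapse).isClosed
  suffices h : w ∈ closure (collapse '' Metric.closedBall w 60) by
    rw [hK.closure_eq] at h
    exact ⟨h.choose, h.choose_spec.2⟩
  choose z hz using fun n => collapseIter_surjective n w
  refine mem_closure_of_tendsto (f := fun n => collapse (z n)) (b := atTop) ?_ ?_
  · rw [tendsto_iff_dist_tendsto_zero]
    refine squeeze_zero (fun _ => dist_nonneg) (fun n => ?_) tendsto_geom_collapse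
    have := dist_collapseIter_collapse_le n (z n)
    rwa [hz, dist_comm] at this
  · refine .of_forall fun n => mem_image_of_mem _ ?_
    have h1 := dist_collapseIter_collapse_le n (z n)
    have h2 := dist_collapse_le (z n)
    have h3 := dist_triangle_right (z n) w (collapse (z n))
    rw [hz] at h1
    have h4 : (29 / 30 : ℝ) ^ n ≤ 1 := pow_le_one₀ (by norm_num) (by norm_num)
    rw [Metric.mem_closedBall]
    linarith

theorem cellCollapse_of_fract_fst {w : ℝ × ℝ} (h : Int.fract w.1 = 0) : cellCollapse w = w := by
  rw [cellCollapse, cellBump_eq_zero_of_fract h]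
  simp

theorem collapse_fst_int {k : ℤ} {z : ℝ × ℝ} (h : z.1 = k) : (collapse z).1 = k :=
  le_antisymm ((collapse_fst_le_int_iff k z).2 h.le) ((int_le_collapse_fst_iff k z).2 h.ge)

theorem collapse_of_fst_int {k : ℤ} {z : ℝ × ℝ} (h : z.1 = k) : collapse z = z := by
  have key : ∀ n : ℕ, (3 ^ n : ℝ) • collapse z = collapse ((3 ^ n : ℝ) • z) := by
    intro n
    induction n with
    | zero => simp
    | succ n ih =>
      have h1 : (((3 ^ n : ℝ) • z)).1 = ((3 ^ n * k : ℤ) : ℝ) := by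
        rw [Prod.smul_fst, h]; simp
      have h2 : (((3 : ℝ) • (3 ^ n : ℝ) • z)).1 = ((3 * (3 ^ n * k) : ℤ) : ℝ) := by
        rw [Prod.smul_fst, h1]; simp
      have h3 := collapse_fst_int h2
      rw [collapse_eq_cellCollapse (_ • z), cellCollapse_of_fract_fst] at ih
      · rw [pow_succ', ← smul_smul, ih, smul_smul, smul_smul]
        norm_num
      · rw [Prod.smul_fst, h3, smul_eq_mul, Int.cast_mul, ← mul_assoc]
        norm_num
        exact_mod_cast Int.fract_intCast (3 ^ n * k)
  rw [← dist_le_zero]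
  refine le_of_forall_pow_mul_le (C := 30) fun n => ?_
  have h1 := dist_collapse_le ((3 ^ n : ℝ) • z)
  rw [← key n, dist_smul₀, Real.norm_of_nonneg (by positivity), dist_comm] at h1
  linarith

theorem collapse_of_snd_int {k : ℤ} {z : ℝ × ℝ} (h : z.2 = k) : collapse z = z := by
  have := collapse_of_fst_int (z := z.swap) h
  rw [collapse_swap] at this
  exact Prod.swap_injective this

/-- The open middle ninth of the unit cell with lower left corner `k`. -/
def openCellHole (k : ℤ × ℤ) : Set (ℝ × ℝ) :=
  {z | |z.1 - (k.1 + 1 / 2)| < 1 / 6 ∧ |z.2 - (k.2 + 1 / 2)| < 1 / 6}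

theorem abs_lt_sixth_iff (t : ℝ) (k : ℤ) :
    |t - (k + 1 / 2)| < 1 / 6 ↔ ((3 * k + 1 : ℤ) : ℝ) < 3 * t ∧ 3 * t < ((3 * k + 2 : ℤ) : ℝ) := by
  push_cast
  rw [abs_lt]
  constructor <;> rintro ⟨h1, h2⟩ <;> constructor <;> linarith

theorem openCellHole_subset (k : ℤ × ℤ) : openCellHole k ⊆ cellHole k :=
  fun _ h => ⟨h.1.le, h.2.le⟩

/-- The points of the plane that lie in no removed hole of any level. -/
def holeFree : Set (ℝ × ℝ) := {z | ∀ (n : ℕ) (k : ℤ × ℤ), (3 ^ n : ℝ) • z ∉ openCellHole k}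

theorem add_mem_openCellHole_iff (m k : ℤ × ℤ) (z : ℝ × ℝ) :
    ((m.1 : ℝ), (m.2 : ℝ)) + z ∈ openCellHole (m + k) ↔ z ∈ openCellHole k := by
  simp only [openCellHole, mem_ofPred_eq, Prod.fst_add, Prod.snd_add, Int.cast_add]
  ring_nf

theorem int_add_mem_holeFree {z : ℝ × ℝ} (h : z ∈ holeFree) (m : ℤ × ℤ) :
    ((m.1 : ℝ), (m.2 : ℝ)) + z ∈ holeFree := by
  intro n k hk
  refine h n (k - (3 ^ n * m.1, 3 ^ n * m.2)) ?_
  rw [← add_mem_openCellHole_iff (3 ^ n * m.1, 3 ^ n * m.2), add_sub_cancel]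
  rw [smul_add] at hk
  convert hk using 2
  ext <;> simp

theorem smul_three_mem_holeFree {z : ℝ × ℝ} (h : z ∈ holeFree) : (3 : ℝ) • z ∈ holeFree := by
  intro n k hk
  rw [smul_smul, ← pow_succ] at hk
  exact h _ _ hk

/-- The value of a ternary expansion. -/
noncomputable def ternaryValue (a : ℕ → Fin 3) : ℝ := ∑' i : ℕ, (a i : ℝ) / 3 ^ (i + 1)

theorem fin_three_cast_le (i : Fin 3) : ((i : ℕ) : ℝ) ≤ 2 := by
  exact_mod_cast Nat.lt_succ_iff.1 i.isLt

theorem hasSum_two_div_three_pow : HasSum (fun i : ℕ => (2 : ℝ) / 3 ^ (i + 1)) 1 := by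
  have := (hasSum_geometric_of_lt_one (r := (1 / 3 : ℝ)) (by norm_num) (by norm_num)).mul_left (2 / 3)
  have e : (fun i : ℕ => (2 : ℝ) / 3 ^ (i + 1)) = fun i : ℕ => 2 / 3 * (1 / 3 : ℝ) ^ i := by
    funext i
    rw [pow_succ, one_div, inv_pow]
    field_simp
  rw [e]
  norm_num at this ⊢
  exact this

theorem summable_ternary (a : ℕ → Fin 3) : Summable fun i : ℕ => (a i : ℝ) / 3 ^ (i + 1) :=
  Summable.of_nonneg_of_le (fun i => by positivity)
    (fun i => div_le_div_of_nonneg_right (fin_three_cast_le _) (by positivity))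
    hasSum_two_div_three_pow.summable

theorem ternaryValue_nonneg (a : ℕ → Fin 3) : 0 ≤ ternaryValue a :=
  tsum_nonneg fun i => by positivity

theorem ternaryValue_le_one (a : ℕ → Fin 3) : ternaryValue a ≤ 1 := by
  rw [← hasSum_two_div_three_pow.tsum_eq]
  exact (summable_ternary a).tsum_le_tsum
    (fun i => div_le_div_of_nonneg_right (fin_three_cast_le _) (by positivity))
    hasSum_two_div_three_pow.summable

theorem three_mul_ternaryValue (a : ℕ → Fin 3) :
    3 * ternaryValue a = (a 0 : ℕ) + ternaryValue fun i => a (i + 1) := by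
  rw [ternaryValue, (summable_ternary a).tsum_eq_zero_add, mul_add, ternaryValue, ← tsum_mul_left]
  congr 1
  · ring
  · refine tsum_congr fun i => ?_
    rw [pow_succ _ (i + 1)]
    field_simp

theorem mem_sierpinskiCarpet_iff_ternaryValue (z : ℝ × ℝ) : z ∈ sierpinskiCarpet ↔
    ∃ a b : ℕ → Fin 3, (∀ i, ¬(a i = 1 ∧ b i = 1)) ∧ z = (ternaryValue a, ternaryValue b) := by
  simp only [sierpinskiCarpet, mem_ofPred_eq, Prod.ext_iff, ternaryValue]

theorem eq_one_of_lt_ternaryValue {a : ℕ → Fin 3} {k : ℤ}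
    (h1 : ((3 * k + 1 : ℤ) : ℝ) < 3 * ternaryValue a)
    (h2 : 3 * ternaryValue a < ((3 * k + 2 : ℤ) : ℝ)) : a 0 = 1 := by
  have h3 := ternaryValue_nonneg a
  have h4 := ternaryValue_le_one a
  have h5 : (3 * k + 1 : ℤ) < 3 := by
    have : ((3 * k + 1 : ℤ) : ℝ) < ((3 : ℤ) : ℝ) := by push_cast at h1 ⊢; linarith
    exact_mod_cast this
  have h6 : 0 < (3 * k + 2 : ℤ) := by
    have : ((0 : ℤ) : ℝ) < ((3 * k + 2 : ℤ) : ℝ) := by push_cast at h2 ⊢; linarith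
    exact_mod_cast this
  have hk : k = 0 := by omega
  subst hk
  rw [three_mul_ternaryValue] at h1 h2
  have h7 := ternaryValue_nonneg fun i => a (i + 1)
  have h8 := ternaryValue_le_one fun i => a (i + 1)
  have h9 : (0 : ℝ) < ((a 0 : ℕ) : ℝ) := by push_cast at h1; linarith
  have h10 : ((a 0 : ℕ) : ℝ) < ((2 : ℕ) : ℝ) := by push_cast at h2 ⊢; linarith
  have h11 : 0 < (a 0 : ℕ) := by exact_mod_cast h9
  have h12 : (a 0 : ℕ) < 2 := by exact_mod_cast h10
  ext
  change (a 0 : ℕ) = 1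
  omega

theorem sierpinskiCarpet_subset_holeFree : sierpinskiCarpet ⊆ holeFree := by
  have step : ∀ (n : ℕ) (a b : ℕ → Fin 3), (∀ i, ¬(a i = 1 ∧ b i = 1)) → ∀ k,
      (3 ^ n : ℝ) • (ternaryValue a, ternaryValue b) ∉ openCellHole k := by
    intro n
    induction n with
    | zero =>
      intro a b hab k hk
      rw [pow_zero, one_smul] at hk
      have h1 := (abs_lt_sixth_iff _ _).1 hk.1
      have h2 := (abs_lt_sixth_iff _ _).1 hk.2
      exact hab 0 ⟨eq_one_of_lt_ternaryValue h1.1 h1.2, eq_one_of_lt_ternaryValue h2.1 h2.2⟩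
    | succ n ih =>
      intro a b hab k hk
      refine ih (fun i => a (i + 1)) (fun i => b (i + 1)) (fun i => hab (i + 1))
        (k - (3 ^ n * ((a 0 : ℕ) : ℤ), 3 ^ n * ((b 0 : ℕ) : ℤ))) ?_
      rw [← add_mem_openCellHole_iff (3 ^ n * ((a 0 : ℕ) : ℤ), 3 ^ n * ((b 0 : ℕ) : ℤ)), add_sub_cancel]
      convert hk using 1
      have h1 := three_mul_ternaryValue a
      have h2 := three_mul_ternaryValue b
      ext
      · simp only [Prod.fst_add, Prod.smul_fst, smul_eq_mul]
        push_cast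
        rw [pow_succ, mul_assoc, h1]; ring
      · simp only [Prod.snd_add, Prod.smul_snd, smul_eq_mul]
        push_cast
        rw [pow_succ, mul_assoc, h2]; ring
  intro z hz n k
  obtain ⟨a, b, hab, rfl⟩ := (mem_sierpinskiCarpet_iff_ternaryValue z).1 hz
  exact step n a b hab k

theorem sierpinskiCarpet_subset_Icc : sierpinskiCarpet ⊆ Icc (0 : ℝ × ℝ) 1 := by
  intro z hz
  obtain ⟨a, b, -, rfl⟩ := (mem_sierpinskiCarpet_iff_ternaryValue z).1 hz
  exact ⟨⟨ternaryValue_nonneg a, ternaryValue_nonneg b⟩, ternaryValue_le_one a, ternaryValue_le_one b⟩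

theorem exists_digit_step {z : ℝ × ℝ} (hz : z ∈ Icc (0 : ℝ × ℝ) 1 ∩ holeFree) :
    ∃ (i j : Fin 3) (w : ℝ × ℝ), ¬(i = 1 ∧ j = 1) ∧ w ∈ Icc (0 : ℝ × ℝ) 1 ∩ holeFree ∧
      (3 : ℝ) • z = (((i : ℕ) : ℝ), ((j : ℕ) : ℝ)) + w := by
  have key : ∀ i j : Fin 3, ¬(i = 1 ∧ j = 1) → ((i : ℕ) : ℝ) ≤ 3 * z.1 → 3 * z.1 ≤ (i : ℕ) + 1 →
      ((j : ℕ) : ℝ) ≤ 3 * z.2 → 3 * z.2 ≤ (j : ℕ) + 1 →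
      ∃ (i j : Fin 3) (w : ℝ × ℝ), ¬(i = 1 ∧ j = 1) ∧ w ∈ Icc (0 : ℝ × ℝ) 1 ∩ holeFree ∧
      (3 : ℝ) • z = (((i : ℕ) : ℝ), ((j : ℕ) : ℝ)) + w := by
    intro i j hij h1 h2 h3 h4
    refine ⟨i, j, (3 : ℝ) • z - (((i : ℕ) : ℝ), ((j : ℕ) : ℝ)), hij, ⟨?_, ?_⟩,
      (add_sub_cancel _ _).symm⟩
    · refine ⟨⟨?_, ?_⟩, ?_, ?_⟩ <;> simp <;> linarith
    · have := int_add_mem_holeFree (smul_three_mem_holeFree hz.2) (-((i : ℕ) : ℤ), -((j : ℕ) : ℤ))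
      convert this using 1
      ext <;> simp <;> ring
  have hopt : ∀ t : ℝ, 0 ≤ t → t ≤ 1 → (∃ i : Fin 3, i ≠ 1 ∧ ((i : ℕ) : ℝ) ≤ 3 * t ∧ 3 * t ≤ (i : ℕ) + 1) ∨
      (1 < 3 * t ∧ 3 * t < 2) := by
    intro t h0 h1
    rcases le_or_gt (3 * t) 1 with h | h
    · exact Or.inl ⟨0, by decide, by simp; linarith, by simpa using h⟩
    rcases le_or_gt 2 (3 * t) with h' | h'
    · exact Or.inl ⟨2, by decide, by simpa using h', by simp; linarith⟩
    · exact Or.inr ⟨h, h'⟩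
  have hall : ∀ t : ℝ, 0 ≤ t → t ≤ 1 → ∃ i : Fin 3, ((i : ℕ) : ℝ) ≤ 3 * t ∧ 3 * t ≤ (i : ℕ) + 1 := by
    intro t h0 h1
    rcases hopt t h0 h1 with ⟨i, -, h⟩ | h
    · exact ⟨i, h⟩
    · exact ⟨1, by simpa using h.1.le, by simp; linarith⟩
  obtain ⟨⟨⟨hx0, hy0⟩, hx1, hy1⟩, hfree⟩ := hz
  rcases hopt z.1 hx0 hx1 with ⟨i, hi, h1, h2⟩ | ⟨h1, h2⟩
  · obtain ⟨j, h3, h4⟩ := hall z.2 hy0 hy1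
    exact key i j (fun h => hi h.1) h1 h2 h3 h4
  rcases hopt z.2 hy0 hy1 with ⟨j, hj, h3, h4⟩ | ⟨h3, h4⟩
  · obtain ⟨i, h5, h6⟩ := hall z.1 hx0 hx1
    exact key i j (fun h => hj h.2) h5 h6 h3 h4
  · refine absurd ?_ (hfree 0 (0, 0))
    rw [pow_zero, one_smul]
    exact ⟨(abs_lt_sixth_iff _ _).2 (by simpa using ⟨h1, h2⟩),
      (abs_lt_sixth_iff _ _).2 (by simpa using ⟨h3, h4⟩)⟩

theorem eq_ternaryValue_of_step {a : ℕ → Fin 3} {t : ℕ → ℝ} (h0 : ∀ n, 0 ≤ t n)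
    (h1 : ∀ n, t n ≤ 1) (h : ∀ n, 3 * t n = (a n : ℕ) + t (n + 1)) : t 0 = ternaryValue a := by
  have key : ∀ n : ℕ, ∑ i ∈ Finset.range n, (a i : ℝ) / 3 ^ (i + 1) = t 0 - t n / 3 ^ n := by
    intro n
    induction n with
    | zero => simp
    | succ n ih =>
      rw [Finset.sum_range_succ, ih]
      have := h n
      have h3 : t n / 3 ^ n = (3 * t n) / 3 ^ (n + 1) := by
        rw [pow_succ]; field_simp
      rw [h3, this]
      ring
  symm
  refine HasSum.tsum_eq ?_
  rw [hasSum_iff_tendsto_nat_of_nonneg (fun i => by positivity)]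
  simp only [key]
  have : Tendsto (fun n => t n / 3 ^ n) atTop (𝓝 0) := by
    refine squeeze_zero (fun n => div_nonneg (h0 n) (by positivity))
      (fun n => div_le_div_of_nonneg_right (h1 n) (by positivity)) ?_
    have := tendsto_pow_atTop_nhds_zero_of_lt_one (r := (1 / 3 : ℝ)) (by norm_num) (by norm_num)
    simpa [one_div] using this
  simpa using this.const_sub (t 0)

theorem sierpinskiCarpet_eq : sierpinskiCarpet = Icc (0 : ℝ × ℝ) 1 ∩ holeFree := by
  refine subset_antisymm
    (subset_inter sierpinskiCarpet_subset_Icc sierpinskiCarpet_subset_holeFree) ?_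
  intro z hz
  choose! i j w hij hw hs using fun (z : ℝ × ℝ) (h : z ∈ Icc (0 : ℝ × ℝ) 1 ∩ holeFree) =>
    exists_digit_step h
  have horb : ∀ n, w^[n] z ∈ Icc (0 : ℝ × ℝ) 1 ∩ holeFree := by
    intro n
    induction n with
    | zero => exact hz
    | succ n ih => rw [Function.iterate_succ_apply']; exact hw _ ih
  rw [mem_sierpinskiCarpet_iff_ternaryValue]
  refine ⟨fun n => i (w^[n] z), fun n => j (w^[n] z), fun n => hij _ (horb n), ?_⟩
  have h1 := eq_ternaryValue_of_step (a := fun n => i (w^[n] z)) (t := fun n => (w^[n] z).1)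
    (fun n => (horb n).1.1.1) (fun n => (horb n).1.2.1) (fun n => by
      have := congrArg Prod.fst (hs _ (horb n))
      rw [Function.iterate_succ_apply']
      exact this)
  have h2 := eq_ternaryValue_of_step (a := fun n => j (w^[n] z)) (t := fun n => (w^[n] z).2)
    (fun n => (horb n).1.1.2) (fun n => (horb n).1.2.2) (fun n => by
      have := congrArg Prod.snd (hs _ (horb n))
      rw [Function.iterate_succ_apply']
      exact this)
  exact Prod.ext h1 h2

theorem isOpen_openCellHole (k : ℤ × ℤ) : IsOpen (openCellHole k) :=
  (isOpen_lt (f := fun z : ℝ × ℝ => |z.1 - (k.1 + 1 / 2)|) (by fun_prop) continuous_const).inter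
    (isOpen_lt (f := fun z : ℝ × ℝ => |z.2 - (k.2 + 1 / 2)|) (by fun_prop) continuous_const)

theorem isClosed_holeFree : IsClosed holeFree := by
  simp only [holeFree, ofPred_forall]
  refine isClosed_iInter fun n => isClosed_iInter fun k => ?_
  exact ((isOpen_openCellHole k).preimage (continuous_const_smul (3 ^ n : ℝ))).isClosed_compl

theorem isCompact_sierpinskiCarpet : IsCompact sierpinskiCarpet := by
  rw [sierpinskiCarpet_eq]
  exact isCompact_Icc.inter_right isClosed_holeFree

/-- A point of a hole at a boundary position has a coordinate that is a multiple of `1 / 3`. -/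
theorem exists_int_of_mem_cellHole {k : ℤ × ℤ} {z : ℝ × ℝ} (h : z ∈ cellHole k)
    (h' : z ∉ openCellHole k) : (∃ m : ℤ, 3 * z.1 = m) ∨ ∃ m : ℤ, 3 * z.2 = m := by
  have key : ∀ (t : ℝ) (k : ℤ), |t - (k + 1 / 2)| ≤ 1 / 6 → ¬ |t - (k + 1 / 2)| < 1 / 6 →
      ∃ m : ℤ, 3 * t = m := by
    intro t k h1 h2
    rcases eq_or_eq_neg_of_abs_eq (le_antisymm h1 (not_lt.1 h2)) with h | h
    · exact ⟨3 * k + 2, by push_cast; linarith⟩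
    · exact ⟨3 * k + 1, by push_cast; linarith⟩
  by_cases hx : |z.1 - (k.1 + 1 / 2)| < 1 / 6
  · exact Or.inr (key _ _ h.2 fun hy => h' ⟨hx, hy⟩)
  · exact Or.inl (key _ _ h.1 hx)

theorem norm_sub_of_mem_cellHole {k : ℤ × ℤ} {z : ℝ × ℝ} (h : z ∈ cellHole k)
    (h' : z ∉ openCellHole k) : ‖z - ((k.1 : ℝ) + 1 / 2, (k.2 : ℝ) + 1 / 2)‖ = 1 / 6 := by
  rw [Prod.norm_def, Real.norm_eq_abs, Real.norm_eq_abs]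
  refine le_antisymm (max_le h.1 h.2) ?_
  by_contra! hlt
  exact h' (max_lt_iff.1 hlt)

theorem exists_corner {z : ℝ × ℝ} (hz : z ∈ Icc (0 : ℝ × ℝ) 1) (hz' : z ∉ holeFree) :
    ∃ p ∈ sierpinskiCarpet, ∃ (n : ℕ) (k : ℤ × ℤ),
      (3 ^ n : ℝ) • p ∈ cellHole k ∧ (3 ^ n : ℝ) • z ∈ cellHole k := by
  classical
  have hex : ∃ n : ℕ, ∃ k : ℤ × ℤ, (3 ^ n : ℝ) • z ∈ openCellHole k := by
    simpa only [holeFree, mem_ofPred_eq, not_forall, not_not] using hz'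
  obtain ⟨n, ⟨k, hk⟩, hmin⟩ : ∃ n : ℕ, (∃ k : ℤ × ℤ, (3 ^ n : ℝ) • z ∈ openCellHole k) ∧
      ∀ m < n, ∀ l : ℤ × ℤ, (3 ^ m : ℝ) • z ∉ openCellHole l :=
    ⟨Nat.find hex, Nat.find_spec hex, fun m hm l hl => Nat.find_min hex hm ⟨l, hl⟩⟩
  have h3n : (0 : ℝ) < 3 ^ n := by positivity
  have hkx := (abs_lt_sixth_iff _ _).1 hk.1
  have hky := (abs_lt_sixth_iff _ _).1 hk.2
  simp only [Prod.smul_fst, Prod.smul_snd, smul_eq_mul] at hkx hky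
  have range : ∀ (t : ℝ) (k : ℤ), 0 ≤ t → t ≤ 1 → ((3 * k + 1 : ℤ) : ℝ) < 3 * (3 ^ n * t) →
      3 * (3 ^ n * t) < ((3 * k + 2 : ℤ) : ℝ) → 0 ≤ ((k : ℝ) + 1 / 3) / 3 ^ n ∧
        ((k : ℝ) + 1 / 3) / 3 ^ n ≤ 1 := by
    intro t k h0 h1 h2 h3
    have h4 : 0 ≤ 3 ^ n * t := mul_nonneg h3n.le h0
    have h5 : 3 ^ n * t ≤ 3 ^ n := mul_le_of_le_one_right h3n.le h1
    have h6 : ((0 : ℤ) : ℝ) < ((3 * k + 2 : ℤ) : ℝ) := by push_cast at h3 ⊢; linarith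
    have h7 : ((3 * k + 1 : ℤ) : ℝ) < ((3 * 3 ^ n : ℤ) : ℝ) := by push_cast at h2 ⊢; linarith
    have h8 : 0 < 3 * k + 2 := by exact_mod_cast h6
    have h9 : 3 * k + 1 < 3 * 3 ^ n := by exact_mod_cast h7
    have h10 : 0 ≤ k := by omega
    have h11 : k + 1 ≤ 3 ^ n := by omega
    have h12 : (0 : ℝ) ≤ k := by exact_mod_cast h10
    have h13 : (k : ℝ) + 1 ≤ 3 ^ n := by exact_mod_cast h11
    exact ⟨by positivity, by rw [div_le_one h3n]; linarith⟩
  have hrx := range z.1 k.1 hz.1.1 hz.2.1 hkx.1 hkx.2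
  have hry := range z.2 k.2 hz.1.2 hz.2.2 hky.1 hky.2
  have hpn : (3 ^ n : ℝ) • ((((k.1 : ℝ) + 1 / 3) / 3 ^ n, ((k.2 : ℝ) + 1 / 3) / 3 ^ n) : ℝ × ℝ) =
      ((k.1 : ℝ) + 1 / 3, (k.2 : ℝ) + 1 / 3) := by
    rw [Prod.smul_mk, smul_eq_mul, smul_eq_mul, mul_div_cancel₀ _ h3n.ne', mul_div_cancel₀ _ h3n.ne']
  have inner : ∀ (t : ℝ) (k l : ℤ) (m : ℕ), m < n → ((3 * k + 1 : ℤ) : ℝ) < 3 * (3 ^ n * t) →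
      3 * (3 ^ n * t) < ((3 * k + 2 : ℤ) : ℝ) →
      |3 ^ m * (((k : ℝ) + 1 / 3) / 3 ^ n) - (l + 1 / 2)| < 1 / 6 →
      |3 ^ m * t - (l + 1 / 2)| < 1 / 6 := by
    intro t k l m hm h1 h2 h3
    obtain ⟨d, hd⟩ : ∃ d, n = m + 1 + d := ⟨n - (m + 1), by omega⟩
    rw [hd] at h1 h2 h3
    rw [abs_lt_sixth_iff] at h3 ⊢
    have hm0 : (0 : ℝ) < 3 ^ m := by positivity
    have hd0 : (0 : ℝ) < 3 ^ d := by positivity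
    have e : 3 * (3 ^ m * (((k : ℝ) + 1 / 3) / 3 ^ (m + 1 + d))) = ((k : ℝ) + 1 / 3) / 3 ^ d := by
      rw [pow_add, pow_add]; field_simp
    rw [e, lt_div_iff₀ hd0, div_lt_iff₀ hd0] at h3
    have e2 : 3 * (3 ^ (m + 1 + d) * t) = 3 * ((3 * (3 ^ m * t)) * 3 ^ d) := by
      rw [pow_add, pow_add]; ring
    rw [e2] at h1 h2
    have h4 : (3 * l + 1) * 3 ^ d ≤ k := by
      have : (((3 * l + 1) * 3 ^ d : ℤ) : ℝ) < ((k + 1 : ℤ) : ℝ) := by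
        push_cast at h3 ⊢; linarith [h3.1]
      have : (3 * l + 1) * 3 ^ d < k + 1 := by exact_mod_cast this
      omega
    have h5 : k + 1 ≤ (3 * l + 2) * 3 ^ d := by
      have : ((k : ℤ) : ℝ) < (((3 * l + 2) * 3 ^ d : ℤ) : ℝ) := by
        push_cast at h3 ⊢; linarith [h3.2]
      have : k < (3 * l + 2) * 3 ^ d := by exact_mod_cast this
      omega
    have h6 : (((3 * l + 1) * 3 ^ d : ℤ) : ℝ) ≤ (k : ℝ) := by exact_mod_cast h4
    have h7 : (k : ℝ) + 1 ≤ (((3 * l + 2) * 3 ^ d : ℤ) : ℝ) := by exact_mod_cast h5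
    push_cast at h1 h2 h6 h7 ⊢
    constructor
    · refine lt_of_mul_lt_mul_right ?_ hd0.le
      linarith
    · refine lt_of_mul_lt_mul_right ?_ hd0.le
      linarith
  refine ⟨(((k.1 : ℝ) + 1 / 3) / 3 ^ n, ((k.2 : ℝ) + 1 / 3) / 3 ^ n), ?_, n, k, ?_,
    openCellHole_subset _ hk⟩
  · rw [sierpinskiCarpet_eq]
    refine ⟨⟨⟨hrx.1, hry.1⟩, hrx.2, hry.2⟩, ?_⟩
    intro m l hl
    rcases lt_or_ge m n with hm | hm
    · exact hmin m hm l ⟨inner z.1 k.1 l.1 m hm hkx.1 hkx.2 hl.1,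
        inner z.2 k.2 l.2 m hm hky.1 hky.2 hl.2⟩
    · obtain ⟨d, rfl⟩ : ∃ d, m = n + d := ⟨m - n, by omega⟩
      rw [pow_add, mul_comm, ← smul_smul, hpn] at hl
      have h1 := (abs_lt_sixth_iff _ _).1 hl.1
      have e : 3 * ((3 ^ d : ℝ) • ((((k.1 : ℝ) + 1 / 3), ((k.2 : ℝ) + 1 / 3)) : ℝ × ℝ)).1 =
          ((3 ^ d * (3 * k.1 + 1) : ℤ) : ℝ) := by
        push_cast
        simp only [Prod.smul_fst, smul_eq_mul]
        ring
      rw [e] at h1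
      have h2 : 3 * l.1 + 1 < 3 ^ d * (3 * k.1 + 1) := by exact_mod_cast h1.1
      have h3 : 3 ^ d * (3 * k.1 + 1) < 3 * l.1 + 2 := by exact_mod_cast h1.2
      omega
  · rw [hpn]
    constructor <;> simp only [] <;> rw [abs_le] <;> constructor <;> linarith

theorem hasStrictDerivAt_bumpProfile {s : ℝ} (hs : |s| ≠ 1 / 6) :
    ∃ n', HasStrictDerivAt (fun s : ℝ => min 1 (2 * (1 - 2 * |s|) / (1 + 2 * |s|))) n' s ∧
      n' * s ≤ 0 := by
  rcases lt_or_gt_of_ne hs with h | h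
  · refine ⟨0, ?_, by rw [zero_mul]⟩
    refine (hasStrictDerivAt_const s (1 : ℝ)).congr_of_eventuallyEq ?_
    have hopen : ∀ᶠ t in 𝓝 s, |t| < 1 / 6 := continuous_abs.continuousAt.eventually_lt_const h
    filter_upwards [hopen] with t ht
    have := abs_nonneg t
    rw [eq_comm, min_eq_left_iff, le_div_iff₀ (by linarith)]
    linarith
  · have hs0 : s ≠ 0 := by
      rintro rfl
      rw [abs_zero] at h
      norm_num at h
    have habs := hasStrictDerivAt_abs hs0
    have hp : 1 + 2 * |s| ≠ 0 := by positivity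
    have hd := ((((habs.const_mul 2).const_sub 1).const_mul 2).div ((habs.const_mul 2).const_add 1) hp)
    refine ⟨_, hd.congr_of_eventuallyEq ?_, ?_⟩
    · have hopen : ∀ᶠ t in 𝓝 s, 1 / 6 < |t| := continuous_abs.continuousAt.eventually_const_lt h
      filter_upwards [hopen] with t ht
      have : 2 * (1 - 2 * |t|) / (1 + 2 * |t|) ≤ 1 := by
        rw [div_le_one (by linarith)]
        linarith
      exact (min_eq_right this).symm
    · rw [div_mul_eq_mul_div]
      refine div_nonpos_of_nonpos_of_nonneg ?_ (sq_nonneg _)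
      have := sign_mul_self s
      have e : (2 * -(2 * ((SignType.sign s : SignType) : ℝ)) * (1 + 2 * |s|) -
        2 * (1 - 2 * |s|) * (2 * ((SignType.sign s : SignType) : ℝ))) * s =
        -8 * (((SignType.sign s : SignType) : ℝ) * s) := by ring
      rw [e, sign_mul_self]
      linarith [abs_nonneg s]

theorem eventually_floor_eq {t : ℝ} {k : ℤ} (h1 : (k : ℝ) < t) (h2 : t < k + 1) :
    ∀ᶠ u in 𝓝 t, ⌊u⌋ = k := by
  filter_upwards [isOpen_Ioo.mem_nhds (show t ∈ Ioo (k : ℝ) (k + 1) from ⟨h1, h2⟩)] with u hu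
  exact Int.floor_eq_iff.2 ⟨hu.1.le, hu.2⟩

theorem cellOffset_of_floor_eq {t : ℝ} {k : ℤ} (h : ⌊t⌋ = k) : cellOffset t = t - (k + 1 / 2) := by
  rw [← h, ← sub_cellOffset_eq]
  ring

theorem exists_equiv_hasStrictFDerivAt_cellCollapse {w : ℝ × ℝ} (h1 : ∀ m : ℤ, 3 * w.1 ≠ m)
    (h2 : ∀ m : ℤ, 3 * w.2 ≠ m) (hw : ∀ k, w ∉ cellHole k) :
    ∃ A : (ℝ × ℝ) ≃L[ℝ] (ℝ × ℝ),
      HasStrictFDerivAt cellCollapse (A : (ℝ × ℝ) →L[ℝ] (ℝ × ℝ)) w := by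
  let n : ℝ → ℝ := fun s => min 1 (2 * (1 - 2 * |s|) / (1 + 2 * |s|))
  let q : ℝ × ℝ := ((⌊w.1⌋ : ℝ) + 1 / 2, (⌊w.2⌋ : ℝ) + 1 / 2)
  have hn : ∀ t, cellBump t = n (cellOffset t) := fun t => rfl
  have side : ∀ t : ℝ, (∀ m : ℤ, 3 * t ≠ m) → (⌊t⌋ : ℝ) < t ∧ |cellOffset t| ≠ 1 / 6 := by
    intro t ht
    constructor
    · refine lt_of_le_of_ne (Int.floor_le t) fun h => ht (3 * ⌊t⌋) ?_
      push_cast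
      rw [h]
    · intro h
      have e := sub_cellOffset_eq t
      rcases eq_or_eq_neg_of_abs_eq h with h | h
      · exact ht (3 * ⌊t⌋ + 2) (by push_cast; linarith)
      · exact ht (3 * ⌊t⌋ + 1) (by push_cast; linarith)
  obtain ⟨f1, o1⟩ := side _ h1
  obtain ⟨f2, o2⟩ := side _ h2
  have e1 := cellOffset_of_floor_eq (rfl : ⌊w.1⌋ = ⌊w.1⌋)
  have e2 := cellOffset_of_floor_eq (rfl : ⌊w.2⌋ = ⌊w.2⌋)
  obtain ⟨n1, d1, l1⟩ := hasStrictDerivAt_bumpProfile o1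
  obtain ⟨n2, d2, l2⟩ := hasStrictDerivAt_bumpProfile o2
  have b1 := cellBump_nonneg w.1
  have b2 := cellBump_nonneg w.2
  have hlt : cellBump w.1 * cellBump w.2 < 1 :=
    lt_of_le_of_ne (cellBump_mul_le_one _ _) fun h => hw _ ((mem_cellHole_floor_iff w).2 h)
  have p1 : cellOffset w.1 = (w - q).1 := e1
  have p2 : cellOffset w.2 = (w - q).2 := e2
  rw [hn, hn] at hlt
  rw [hn] at b1 b2
  rw [p1] at d1 l1 b1
  rw [p2] at d2 l2 b2
  rw [p1, p2] at hlt
  have D1 := d1.comp_hasStrictFDerivAt (w - q) (hasStrictFDerivAt_fst (𝕜 := ℝ) (E := ℝ) (F := ℝ))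
  have D2 := d2.comp_hasStrictFDerivAt (w - q) (hasStrictFDerivAt_snd (𝕜 := ℝ) (E := ℝ) (F := ℝ))
  have D := (D1.mul D2).const_sub 1
  obtain ⟨A, hA⟩ := exists_equiv_hasStrictFDerivAt_smul_self D
    (by
      have : 1 - n (w - q).1 * n (w - q).2 ≠ 0 := by linarith
      exact this)
    (by
      refine ne_of_gt (add_pos_of_pos_of_nonneg ?_ ?_)
      · have : 0 < 1 - n (w - q).1 * n (w - q).2 := by linarith
        exact this
      · have : 0 ≤ -(n (w - q).1 * (n2 * (w - q).2) + n (w - q).2 * (n1 * (w - q).1)) := by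
          have i1 := mul_nonneg b1 (neg_nonneg.2 l2)
          have i2 := mul_nonneg b2 (neg_nonneg.2 l1)
          linarith
        exact this)
  have hsub : HasStrictFDerivAt (fun z : ℝ × ℝ => z - q) (ContinuousLinearMap.id ℝ (ℝ × ℝ)) w :=
    (hasStrictFDerivAt_id w).sub_const q
  have hfin := (hA.comp w hsub).const_add q
  rw [ContinuousLinearMap.comp_id] at hfin
  refine ⟨A, hfin.congr_of_eventuallyEq ?_⟩
  have E1 := (continuous_fst.tendsto w).eventually (eventually_floor_eq f1 (Int.lt_floor_add_one _))
  have E2 := (continuous_snd.tendsto w).eventually (eventually_floor_eq f2 (Int.lt_floor_add_one _))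
  filter_upwards [E1, E2] with z hz1 hz2
  have g1 : cellOffset z.1 = (z - q).1 := cellOffset_of_floor_eq hz1
  have g2 : cellOffset z.2 = (z - q).2 := cellOffset_of_floor_eq hz2
  rw [cellCollapse, hn, hn, g1, g2]
  ext
  · change q.1 + (1 - n (z - q).1 * n (z - q).2) * (z.1 - q.1) = z.1 - (z.1 - q.1) * _
    ring
  · change q.2 + (1 - n (z - q).1 * n (z - q).2) * (z.2 - q.2) = z.2 - (z.2 - q.2) * _
    ring

/-- The part of `collapse` that acts after a magnification by `3 ^ n`. -/
noncomputable def collapseTail : ℕ → ℝ × ℝ → ℝ × ℝ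
  | 0 => id
  | n + 1 => fun z => cellCollapse ((1 / 3 : ℝ) • collapseTail n z)

theorem collapseTail_collapse (n : ℕ) (z : ℝ × ℝ) :
    collapseTail n (collapse ((3 ^ n : ℝ) • z)) = collapse z := by
  induction n generalizing z with
  | zero => simp [collapseTail]
  | succ n ih =>
    have := ih ((3 : ℝ) • z)
    rw [smul_smul, ← pow_succ] at this
    rw [collapse_eq_cellCollapse z, ← this]
    rfl

theorem ne_int_of_mem_cellHole {k : ℤ × ℤ} {z : ℝ × ℝ} (h : z ∈ cellHole k) (m : ℤ) :
    z.1 ≠ m ∧ z.2 ≠ m := by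
  have key : ∀ (t : ℝ) (k : ℤ), |t - (k + 1 / 2)| ≤ 1 / 6 → t ≠ m := by
    rintro t k h rfl
    rw [abs_le_sixth_iff] at h
    have h1 : 3 * k + 1 ≤ 3 * m := by exact_mod_cast h.1
    have h2 : 3 * m ≤ 3 * k + 2 := by exact_mod_cast h.2
    omega
  exact ⟨key _ _ h.1, key _ _ h.2⟩

theorem ne_int_of_pow_smul_mem_cellHole {k : ℤ × ℤ} {z : ℝ × ℝ} {n : ℕ}
    (h : (3 ^ (n + 1) : ℝ) • z ∈ cellHole k) (m : ℤ) : 3 * z.1 ≠ m ∧ 3 * z.2 ≠ m := by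
  have := ne_int_of_mem_cellHole h (3 ^ n * m)
  push_cast at this
  rw [pow_succ, Prod.smul_fst, Prod.smul_snd, smul_eq_mul, smul_eq_mul, mul_assoc, mul_assoc] at this
  exact ⟨fun h => this.1 (by rw [h]), fun h => this.2 (by rw [h])⟩

theorem not_mem_cellHole_of_pow_smul_mem {k : ℤ × ℤ} {z : ℝ × ℝ} {n : ℕ} (hz : z ∈ holeFree)
    (h : (3 ^ (n + 1) : ℝ) • z ∈ cellHole k) (l : ℤ × ℤ) : z ∉ cellHole l := by
  intro hl
  have h0 : z ∉ openCellHole l := by simpa using hz 0 l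
  rcases exists_int_of_mem_cellHole hl h0 with ⟨m, hm⟩ | ⟨m, hm⟩
  · exact (ne_int_of_pow_smul_mem_cellHole h m).1 hm
  · exact (ne_int_of_pow_smul_mem_cellHole h m).2 hm

theorem collapse_fst_eq_int_iff (k : ℤ) (z : ℝ × ℝ) : (collapse z).1 = k ↔ z.1 = k := by
  rw [le_antisymm_iff, le_antisymm_iff, collapse_fst_le_int_iff, int_le_collapse_fst_iff]

theorem collapse_snd_eq_int_iff (k : ℤ) (z : ℝ × ℝ) : (collapse z).2 = k ↔ z.2 = k := by
  rw [le_antisymm_iff, le_antisymm_iff, collapse_snd_le_int_iff, int_le_collapse_snd_iff]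

theorem exists_equiv_hasStrictFDerivAt_collapseTail {n : ℕ} {k : ℤ × ℤ} {z : ℝ × ℝ}
    (hz : z ∈ holeFree) (hk : (3 ^ n : ℝ) • z ∈ cellHole k) :
    ∃ A : (ℝ × ℝ) ≃L[ℝ] (ℝ × ℝ), HasStrictFDerivAt (collapseTail n)
      (A : (ℝ × ℝ) →L[ℝ] (ℝ × ℝ)) (collapse ((3 ^ n : ℝ) • z)) := by
  induction n generalizing z with
  | zero => exact ⟨.refl ℝ _, hasStrictFDerivAt_id _⟩
  | succ n ih =>
    have e : (3 ^ (n + 1) : ℝ) • z = (3 ^ n : ℝ) • (3 : ℝ) • z := by rw [smul_smul, ← pow_succ]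
    obtain ⟨A, hA⟩ := ih (smul_three_mem_holeFree hz) (e ▸ hk)
    have e3 : ∀ w : ℝ, 3 * (1 / 3 * w) = w := fun w => by ring
    obtain ⟨B, hB⟩ := exists_equiv_hasStrictFDerivAt_cellCollapse
      (w := (1 / 3 : ℝ) • collapse ((3 : ℝ) • z))
      (fun m => by
        rw [Prod.smul_fst, smul_eq_mul, e3, Ne, collapse_fst_eq_int_iff]
        exact (ne_int_of_pow_smul_mem_cellHole hk m).1)
      (fun m => by
        rw [Prod.smul_snd, smul_eq_mul, e3, Ne, collapse_snd_eq_int_iff]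
        exact (ne_int_of_pow_smul_mem_cellHole hk m).2)
      (fun l => by
        rw [smul_collapse_mem_cellHole_iff]
        exact not_mem_cellHole_of_pow_smul_mem hz hk l)
    rw [← collapseTail_collapse n] at hB
    rw [e]
    let C : (ℝ × ℝ) ≃L[ℝ] (ℝ × ℝ) := ContinuousLinearEquiv.smulLeft (Units.mk0 (1 / 3 : ℝ) (by norm_num))
    have hC : HasStrictFDerivAt (fun z : ℝ × ℝ => (1 / 3 : ℝ) • z) (C : (ℝ × ℝ) →L[ℝ] (ℝ × ℝ))
        (collapseTail n (collapse ((3 ^ n : ℝ) • (3 : ℝ) • z))) :=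
      (C : (ℝ × ℝ) →L[ℝ] (ℝ × ℝ)).hasStrictFDerivAt
    exact ⟨(A.trans C).trans B, HasStrictFDerivAt.comp (g := cellCollapse)
      (f := fun ζ => (1 / 3 : ℝ) • collapseTail n ζ) _ hB (hC.comp _ hA)⟩

theorem mem_cellHole_of_collapse_eq {n : ℕ} {k : ℤ × ℤ} {z z' : ℝ × ℝ}
    (hz : z ∈ holeFree) (hk : (3 ^ n : ℝ) • z ∈ cellHole k) (h : collapse z = collapse z') :
    (3 ^ n : ℝ) • z' ∈ cellHole k := by
  induction n generalizing z z' with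
  | zero =>
    rw [pow_zero, one_smul] at hk ⊢
    rcases collapse_step h with h1 | ⟨l, h1, h2⟩
    · rwa [← smul_collapse_mem_cellHole_iff, ← h1, smul_collapse_mem_cellHole_iff]
    · have h3 := (collapse_of_mem_cellHole hk).symm.trans (collapse_of_mem_cellHole h1)
      simp only [Prod.mk.injEq, add_left_inj, Int.cast_inj] at h3
      rwa [Prod.ext h3.1 h3.2]
  | succ n ih =>
    rcases collapse_step h with h1 | ⟨l, h1, h2⟩
    · rw [pow_succ, ← smul_smul] at hk ⊢
      exact ih (smul_three_mem_holeFree hz) hk h1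
    · exact absurd h1 (not_mem_cellHole_of_pow_smul_mem hz hk l)

theorem smul_collapse_eq_self {k : ℤ × ℤ} {z : ℝ × ℝ} (h : z ∈ cellHole k)
    (h' : z ∉ openCellHole k) : (1 / 3 : ℝ) • collapse ((3 : ℝ) • z) = z := by
  have : collapse ((3 : ℝ) • z) = (3 : ℝ) • z := by
    rcases exists_int_of_mem_cellHole h h' with ⟨m, hm⟩ | ⟨m, hm⟩
    · exact collapse_of_fst_int hm
    · exact collapse_of_snd_int hm
  rw [this, smul_smul]
  norm_num

theorem cellCollapse_sub_center {k : ℤ × ℤ} {w : ℝ × ℝ} (h1 : ⌊w.1⌋ = k.1) (h2 : ⌊w.2⌋ = k.2) :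
    cellCollapse w - ((k.1 : ℝ) + 1 / 2, (k.2 : ℝ) + 1 / 2) =
      (1 - cellBump w.1 * cellBump w.2) • (w - ((k.1 : ℝ) + 1 / 2, (k.2 : ℝ) + 1 / 2)) := by
  rw [cellCollapse, cellOffset_of_floor_eq h1, cellOffset_of_floor_eq h2]
  ext
  · simp only [Prod.fst_sub, Prod.smul_fst, smul_eq_mul]; ring
  · simp only [Prod.snd_sub, Prod.smul_snd, smul_eq_mul]; ring

theorem exists_tendsto_collapse_dirFilter {n : ℕ} {k : ℤ × ℤ} {z : ℝ × ℝ}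
    (hz : z ∈ holeFree) (hk : (3 ^ n : ℝ) • z ∈ cellHole k) :
    ∃ A : (ℝ × ℝ) ≃L[ℝ] (ℝ × ℝ), ∀ x ∈ holeFree, (3 ^ n : ℝ) • x ∈ cellHole k →
      Tendsto collapse (𝓝[{y | collapse y ≠ collapse x}] x) (dirFilter (collapse x)
        (dir (A ((3 ^ n : ℝ) • x - ((k.1 : ℝ) + 1 / 2, (k.2 : ℝ) + 1 / 2))))) := by
  obtain ⟨A, hA⟩ := exists_equiv_hasStrictFDerivAt_collapseTail hz hk
  refine ⟨A, fun x hx hxk => ?_⟩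
  rw [collapse_of_mem_cellHole hk, ← collapse_of_mem_cellHole hxk] at hA
  have hnorm := norm_sub_of_mem_cellHole hxk (hx n k)
  have hself := smul_collapse_eq_self hxk (hx n k)
  have hcx := collapse_of_mem_cellHole hxk
  set q : ℝ × ℝ := ((k.1 : ℝ) + 1 / 2, (k.2 : ℝ) + 1 / 2) with hq
  set X := (3 ^ n : ℝ) • x with hX
  have hne : X - q ≠ 0 := by
    rw [← norm_ne_zero_iff, hnorm]; norm_num
  have hdir := hA.hasFDerivAt.dirAt (dir (X - q)) (norm_dir hne)
  have hdirA := dir_map_dir (A : (ℝ × ℝ) →L[ℝ] (ℝ × ℝ)) hne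
  simp only [ContinuousLinearEquiv.coe_coe] at hdirA
  rw [hdirA, collapseTail_collapse, hcx] at hdir
  suffices hsuff : Tendsto (fun y => collapse ((3 ^ n : ℝ) • y))
      (𝓝[{y | collapse y ≠ collapse x}] x) (dirFilter q (dir (X - q))) from
    (hdir.comp hsuff).congr fun y => collapseTail_collapse n y
  have hcont : Continuous fun y : ℝ × ℝ => (1 / 3 : ℝ) • collapse ((3 : ℝ) • (3 ^ n : ℝ) • y) :=
    (continuous_collapse.comp ((continuous_const_smul (3 : ℝ)).comp
      (continuous_const_smul (3 ^ n : ℝ)))).const_smul (1 / 3 : ℝ)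
  have hT : Tendsto (fun y : ℝ × ℝ => (1 / 3 : ℝ) • collapse ((3 : ℝ) • (3 ^ n : ℝ) • y)) (𝓝 x)
      (𝓝 X) := by
    have := hcont.tendsto x
    rwa [← hX, hself] at this
  rw [tendsto_dirFilter]
  have hnq : ∀ᶠ y in 𝓝[{y | collapse y ≠ collapse x}] x, collapse ((3 ^ n : ℝ) • y) ≠ q := by
    filter_upwards [self_mem_nhdsWithin] with y hy h
    refine hy ?_
    rw [← collapseTail_collapse n y, h, ← hcx, collapseTail_collapse]
  constructor
  · rw [tendsto_nhdsWithin_iff]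
    refine ⟨?_, hnq⟩
    have : Tendsto (fun y => collapse ((3 ^ n : ℝ) • y)) (𝓝 x) (𝓝 q) := by
      rw [← hcx]
      exact (continuous_collapse.comp (continuous_const_smul (3 ^ n : ℝ))).tendsto x
    exact this.mono_left nhdsWithin_le_nhds
  · have hlim := ((continuousAt_dir hne).tendsto.comp (hT.sub_const q)).mono_left
      (nhdsWithin_le_nhds (s := {y | collapse y ≠ collapse x}))
    refine hlim.congr' ?_
    have hbd : ∀ (t : ℝ) (l : ℤ), |t - (l + 1 / 2)| ≤ 1 / 6 → (l : ℝ) < t ∧ t < l + 1 := by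
      intro t l h
      have := abs_le.1 h
      constructor <;> linarith
    have b1 := hbd _ _ hxk.1
    have b2 := hbd _ _ hxk.2
    have F1 := (((continuous_fst.tendsto X).comp hT).eventually
      (eventually_floor_eq b1.1 b1.2)).filter_mono
      (nhdsWithin_le_nhds (s := {y | collapse y ≠ collapse x}))
    have F2 := (((continuous_snd.tendsto X).comp hT).eventually
      (eventually_floor_eq b2.1 b2.2)).filter_mono
      (nhdsWithin_le_nhds (s := {y | collapse y ≠ collapse x}))
    filter_upwards [F1, F2, hnq] with y h1 h2 h3
    have e := cellCollapse_sub_center h1 h2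
    rw [collapse_eq_cellCollapse] at h3 ⊢
    change dir (_ - q) = dir (_ - q)
    rw [e]
    have hpos := sub_nonneg.2 (cellBump_mul_le_one
      ((1 / 3 : ℝ) • collapse ((3 : ℝ) • (3 ^ n : ℝ) • y)).1
      ((1 / 3 : ℝ) • collapse ((3 : ℝ) • (3 ^ n : ℝ) • y)).2)
    rcases hpos.eq_or_lt with h0 | h0
    · rw [← h0, zero_smul] at e
      exact absurd (sub_eq_zero.1 e) h3
    · exact (dir_smul h0 _).symm

theorem tendsto_nhds_infty_of_norm {ι : Type*} {l : Filter ι} {f : ι → OnePoint (ℝ × ℝ)}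
    (h : ∀ R : ℝ, ∀ᶠ i in l, ∀ v : ℝ × ℝ, f i = v → R < ‖v‖) :
    Tendsto f l (𝓝 OnePoint.infty) := by
  rw [OnePoint.hasBasis_nhds_infty.tendsto_right_iff]
  rintro K ⟨-, hK⟩
  obtain ⟨R, hR⟩ := hK.isBounded.exists_norm_le
  filter_upwards [h R] with i hi
  induction hz : f i using OnePoint.rec with
  | infty => exact Or.inr rfl
  | coe v =>
    refine Or.inl ⟨v, fun hv => ?_, rfl⟩
    exact absurd (hR v hv) (not_le.2 (hi v hz))

/-- The point `u / D` of the sphere. -/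
noncomputable def planeRatio (u : ℝ × ℝ) (D : ℝ) : OnePoint (ℝ × ℝ) :=
  if D = 0 then OnePoint.infty else ((D⁻¹ • u : ℝ × ℝ) : OnePoint (ℝ × ℝ))

theorem planeRatio_of_ne {u : ℝ × ℝ} {D : ℝ} (h : D ≠ 0) :
    planeRatio u D = ((D⁻¹ • u : ℝ × ℝ) : OnePoint (ℝ × ℝ)) := if_neg h

@[simp] theorem planeRatio_zero (u : ℝ × ℝ) : planeRatio u 0 = OnePoint.infty := if_pos rfl

theorem planeRatio_eq_infty_iff {u : ℝ × ℝ} {D : ℝ} :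
    planeRatio u D = OnePoint.infty ↔ D = 0 := by
  by_cases h : D = 0
  · simp [h]
  · simp [planeRatio_of_ne h, h]

theorem toPlane_planeRatio (u : ℝ × ℝ) (D : ℝ) : toPlane (planeRatio u D) = D⁻¹ • u := by
  by_cases h : D = 0
  · subst h
    rw [planeRatio_zero, inv_zero, zero_smul]
    rfl
  · rw [planeRatio_of_ne h, toPlane_coe]

theorem tendsto_planeRatio {ι : Type*} {l : Filter ι} {u : ι → ℝ × ℝ} {D : ι → ℝ}
    {u₀ : ℝ × ℝ} {D₀ : ℝ} (hu : Tendsto u l (𝓝 u₀)) (hD : Tendsto D l (𝓝 D₀))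
    (h : D₀ ≠ 0 ∨ u₀ ≠ 0) :
    Tendsto (fun i => planeRatio (u i) (D i)) l (𝓝 (planeRatio u₀ D₀)) := by
  by_cases h0 : D₀ = 0
  · subst h0
    rw [planeRatio_zero]
    have hu0 : u₀ ≠ 0 := h.resolve_left (by simp)
    refine tendsto_nhds_infty_of_norm fun R => ?_
    have h1 : Tendsto (fun i => |D i| * R) l (𝓝 (|0| * R)) := hD.abs.mul_const R
    rw [abs_zero, zero_mul] at h1
    filter_upwards [h1.eventually_lt hu.norm (norm_pos_iff.2 hu0)] with i hi v hv
    by_cases hDi : D i = 0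
    · rw [hDi, planeRatio_zero] at hv
      exact absurd hv (OnePoint.infty_ne_coe v)
    · rw [planeRatio_of_ne hDi, OnePoint.coe_eq_coe] at hv
      rw [← hv, norm_smul, norm_inv, Real.norm_eq_abs, ← div_eq_inv_mul,
        lt_div_iff₀ (abs_pos.2 hDi), mul_comm]
      exact hi
  · rw [planeRatio_of_ne h0]
    have h1 : Tendsto (fun i => ((((D i)⁻¹ • u i : ℝ × ℝ)) : OnePoint (ℝ × ℝ))) l
        (𝓝 ((D₀⁻¹ • u₀ : ℝ × ℝ) : OnePoint (ℝ × ℝ))) :=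
      (OnePoint.continuous_coe.tendsto _).comp ((hD.inv₀ h0).smul hu)
    refine h1.congr' ?_
    filter_upwards [hD.eventually_ne h0] with i hi
    rw [planeRatio_of_ne hi]

/-- A polynomial which is positive in the open unit square and vanishes on its boundary. -/
def squareDefect (s : ℝ × ℝ) : ℝ := (1 - s.1 ^ 2) * (1 - s.2 ^ 2)

/-- The square of the Euclidean norm. -/
def normSqPlane (v : ℝ × ℝ) : ℝ := v.1 ^ 2 + v.2 ^ 2

theorem continuous_squareDefect : Continuous squareDefect := by
  unfold squareDefect; fun_prop

theorem continuous_normSqPlane : Continuous normSqPlane := by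
  unfold normSqPlane; fun_prop

theorem norm_lt_one_iff_sq {s : ℝ × ℝ} : ‖s‖ < 1 ↔ s.1 ^ 2 < 1 ∧ s.2 ^ 2 < 1 := by
  rw [Prod.norm_def, max_lt_iff, Real.norm_eq_abs, Real.norm_eq_abs, sq_lt_one_iff_abs_lt_one,
    sq_lt_one_iff_abs_lt_one]

theorem norm_le_one_iff_sq {s : ℝ × ℝ} : ‖s‖ ≤ 1 ↔ s.1 ^ 2 ≤ 1 ∧ s.2 ^ 2 ≤ 1 := by
  rw [Prod.norm_def, max_le_iff, Real.norm_eq_abs, Real.norm_eq_abs, sq_le_one_iff_abs_le_one,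
    sq_le_one_iff_abs_le_one]

theorem squareDefect_pos {s : ℝ × ℝ} (h : ‖s‖ < 1) : 0 < squareDefect s := by
  obtain ⟨h1, h2⟩ := norm_lt_one_iff_sq.1 h
  exact mul_pos (by linarith) (by linarith)

theorem squareDefect_eq_zero {s : ℝ × ℝ} (h : ‖s‖ = 1) : squareDefect s = 0 := by
  by_contra h0
  obtain ⟨h1, h2⟩ := norm_le_one_iff_sq.1 h.le
  have h3 : s.1 ^ 2 ≠ 1 := fun h3 => h0 (by rw [squareDefect, h3]; ring)
  have h4 : s.2 ^ 2 ≠ 1 := fun h3 => h0 (by rw [squareDefect, h3]; ring)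
  exact h.not_lt (norm_lt_one_iff_sq.2 ⟨lt_of_le_of_ne h1 h3, lt_of_le_of_ne h2 h4⟩)

theorem normSqPlane_eq_zero {v : ℝ × ℝ} : normSqPlane v = 0 ↔ v = 0 := by
  constructor
  · intro h
    unfold normSqPlane at h
    have h1 : v.1 ^ 2 = 0 := by nlinarith [sq_nonneg v.1, sq_nonneg v.2]
    have h2 : v.2 ^ 2 = 0 := by nlinarith [sq_nonneg v.1, sq_nonneg v.2]
    exact Prod.ext (by simpa using h1) (by simpa using h2)
  · rintro rfl
    simp [normSqPlane]

theorem normSqPlane_nonneg (v : ℝ × ℝ) : 0 ≤ normSqPlane v := by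
  unfold normSqPlane; positivity

theorem normSqPlane_smul (c : ℝ) (v : ℝ × ℝ) : normSqPlane (c • v) = c ^ 2 * normSqPlane v := by
  simp [normSqPlane]; ring

theorem normSqPlane_le (v : ℝ × ℝ) : normSqPlane v ≤ 2 * ‖v‖ ^ 2 := by
  have h1 : |v.1| ≤ ‖v‖ := norm_fst_le v
  have h2 : |v.2| ≤ ‖v‖ := norm_snd_le v
  have h3 := pow_le_pow_left₀ (abs_nonneg _) h1 2
  have h4 := pow_le_pow_left₀ (abs_nonneg _) h2 2
  rw [sq_abs] at h3 h4
  unfold normSqPlane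
  linarith

/-- The quotient of the closed unit square by its boundary, identified with the sphere: the
boundary goes to `0` and one interior point goes to infinity. -/
noncomputable def squareToSphere (b s : ℝ × ℝ) : OnePoint (ℝ × ℝ) :=
  planeRatio (squareDefect s • (s - squareDefect s • b)) (normSqPlane (s - squareDefect s • b))

theorem inv_squareDefect_smul_inj {s s' : ℝ × ℝ} (hs : ‖s‖ < 1) (hs' : ‖s'‖ < 1)
    (h : (squareDefect s)⁻¹ • s = (squareDefect s')⁻¹ • s') : s = s' := by
  wlog hle : squareDefect s ≤ squareDefect s' generalizing s s'
  · exact (this hs' hs h.symm (le_of_not_ge hle)).symm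
  have p := squareDefect_pos hs
  have p' := squareDefect_pos hs'
  have h1 : s = (squareDefect s / squareDefect s') • s' := by
    rw [div_eq_mul_inv, mul_smul, ← h, smul_smul, mul_inv_cancel₀ p.ne', one_smul]
  obtain ⟨r, hr⟩ : ∃ r, r = squareDefect s / squareDefect s' := ⟨_, rfl⟩
  rw [← hr] at h1
  have hr0 : 0 < r := by rw [hr]; positivity
  have hr1 : r ≤ 1 := by rw [hr]; exact (div_le_one p').2 hle
  have h2 : squareDefect s' ≤ squareDefect s := by
    obtain ⟨a1, a2⟩ := norm_lt_one_iff_sq.1 hs'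
    obtain ⟨a3, a4⟩ := norm_lt_one_iff_sq.1 hs
    have e1 : s.1 ^ 2 ≤ s'.1 ^ 2 := by
      rw [h1]
      simp only [Prod.smul_fst, smul_eq_mul, mul_pow]
      exact mul_le_of_le_one_left (sq_nonneg _) (pow_le_one₀ hr0.le hr1)
    have e2 : s.2 ^ 2 ≤ s'.2 ^ 2 := by
      rw [h1]
      simp only [Prod.smul_snd, smul_eq_mul, mul_pow]
      exact mul_le_of_le_one_left (sq_nonneg _) (pow_le_one₀ hr0.le hr1)
    unfold squareDefect
    exact mul_le_mul (by linarith) (by linarith) (by linarith) (by linarith)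
  have h3 : r = 1 := by rw [hr, le_antisymm hle h2, div_self p'.ne']
  rw [h1, h3, one_smul]

theorem exists_inv_squareDefect_smul (v : ℝ × ℝ) :
    ∃ s : ℝ × ℝ, ‖s‖ < 1 ∧ (squareDefect s)⁻¹ • s = v := by
  by_cases hv : v = 0
  · exact ⟨0, by simp, by simp [hv]⟩
  have hn : 0 < ‖v‖ := norm_pos_iff.2 hv
  have hc : ContinuousOn (fun r : ℝ => r - squareDefect (r • v)) (Icc 0 ‖v‖⁻¹) := by
    refine Continuous.continuousOn (continuous_id.sub (continuous_squareDefect.comp ?_))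
    fun_prop
  have hend : squareDefect (‖v‖⁻¹ • v) = 0 := squareDefect_eq_zero (by
    rw [norm_smul, norm_inv, norm_norm, inv_mul_cancel₀ hn.ne'])
  obtain ⟨r, ⟨hr0, hr1⟩, hr⟩ := intermediate_value_Icc (inv_pos.2 hn).le hc
    (show (0 : ℝ) ∈ _ by
      constructor
      · simp [squareDefect]
      · simp only [hend, sub_zero]; positivity)
  have hr : r = squareDefect (r • v) := by linarith [show r - squareDefect (r • v) = 0 from hr]
  have hr0' : 0 < r := by
    rcases hr0.eq_or_lt with h | h
    · rw [← h] at hr; simp [squareDefect] at hr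
    · exact h
  have hnorm : ‖r • v‖ = r * ‖v‖ := by rw [norm_smul, Real.norm_eq_abs, abs_of_pos hr0']
  refine ⟨r • v, ?_, ?_⟩
  · have hle : ‖r • v‖ ≤ 1 := by
      rw [hnorm]
      calc r * ‖v‖ ≤ ‖v‖⁻¹ * ‖v‖ := by gcongr
        _ = 1 := inv_mul_cancel₀ hn.ne'
    refine lt_of_le_of_ne hle fun h => ?_
    rw [squareDefect_eq_zero h] at hr
    exact hr0'.ne' hr
  · rw [← hr, smul_smul, inv_mul_cancel₀ hr0'.ne', one_smul]

theorem inv_normSqPlane_smul_invol (v : ℝ × ℝ) :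
    (normSqPlane ((normSqPlane v)⁻¹ • v))⁻¹ • ((normSqPlane v)⁻¹ • v) = v := by
  by_cases hv : v = 0
  · simp [hv]
  have h : normSqPlane v ≠ 0 := fun h => hv (normSqPlane_eq_zero.1 h)
  rw [normSqPlane_smul, smul_smul]
  have : ((normSqPlane v)⁻¹ ^ 2 * normSqPlane v)⁻¹ * (normSqPlane v)⁻¹ = 1 := by
    field_simp
  rw [this, one_smul]

theorem toPlane_squareToSphere {b s : ℝ × ℝ} (hs : squareDefect s ≠ 0) :
    toPlane (squareToSphere b s) =
      (normSqPlane ((squareDefect s)⁻¹ • s - b))⁻¹ • ((squareDefect s)⁻¹ • s - b) := by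
  have h : (squareDefect s)⁻¹ • s - b = (squareDefect s)⁻¹ • (s - squareDefect s • b) := by
    rw [smul_sub, smul_smul, inv_mul_cancel₀ hs, one_smul]
  rw [squareToSphere, toPlane_planeRatio, h, normSqPlane_smul, smul_smul, smul_smul]
  congr 1
  rw [mul_inv, inv_pow, inv_inv]
  field_simp

theorem squareToSphere_eq_infty_iff {b s : ℝ × ℝ} :
    squareToSphere b s = OnePoint.infty ↔ s = squareDefect s • b := by
  rw [squareToSphere, planeRatio_eq_infty_iff, normSqPlane_eq_zero, sub_eq_zero]

theorem squareToSphere_of_norm_eq_one {b s : ℝ × ℝ} (hs : ‖s‖ = 1) :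
    squareToSphere b s = ((0 : ℝ × ℝ) : OnePoint (ℝ × ℝ)) := by
  rw [squareToSphere, squareDefect_eq_zero hs, zero_smul, zero_smul, sub_zero,
    planeRatio_of_ne, smul_zero]
  exact fun h => ne_zero_of_norm_eq_one hs (normSqPlane_eq_zero.1 h)

theorem coe_toPlane {z : OnePoint (ℝ × ℝ)} (h : z ≠ OnePoint.infty) :
    ((toPlane z : ℝ × ℝ) : OnePoint (ℝ × ℝ)) = z := by
  obtain ⟨v, rfl⟩ := OnePoint.ne_infty_iff_exists.1 h
  rfl

theorem squareToSphere_ne_zero {b s : ℝ × ℝ} (hs : ‖s‖ < 1) :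
    squareToSphere b s ≠ ((0 : ℝ × ℝ) : OnePoint (ℝ × ℝ)) := by
  intro h
  have h1 := squareDefect_pos hs
  have h2 : s ≠ squareDefect s • b := fun h' => by
    rw [squareToSphere_eq_infty_iff.2 h'] at h
    exact OnePoint.infty_ne_coe _ h
  have h3 := sub_ne_zero.2 h2
  have h4 : normSqPlane (s - squareDefect s • b) ≠ 0 := fun h => h3 (normSqPlane_eq_zero.1 h)
  rw [squareToSphere, planeRatio_of_ne h4, OnePoint.coe_eq_coe] at h
  exact smul_ne_zero (inv_ne_zero h4) (smul_ne_zero h1.ne' h3) h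

theorem squareToSphere_fiber {b s s' : ℝ × ℝ} (hs : ‖s‖ ≤ 1) (hs' : ‖s'‖ ≤ 1)
    (h : squareToSphere b s = squareToSphere b s') : s = s' ∨ ‖s‖ = 1 := by
  rcases hs.eq_or_lt with h1 | h1
  · exact Or.inr h1
  left
  have h1' : ‖s'‖ < 1 := by
    refine lt_of_le_of_ne hs' fun h2 => ?_
    rw [squareToSphere_of_norm_eq_one h2] at h
    exact squareToSphere_ne_zero h1 h
  have p := squareDefect_pos h1
  have p' := squareDefect_pos h1'
  have key := congrArg toPlane h
  rw [toPlane_squareToSphere p.ne', toPlane_squareToSphere p'.ne'] at key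
  have key2 := inv_normSqPlane_smul_invol ((squareDefect s)⁻¹ • s - b)
  rw [key, inv_normSqPlane_smul_invol] at key2
  exact inv_squareDefect_smul_inj h1 h1' (sub_left_injective key2).symm

theorem exists_squareToSphere_eq (b : ℝ × ℝ) (z : OnePoint (ℝ × ℝ)) :
    ∃ s : ℝ × ℝ, ‖s‖ ≤ 1 ∧ squareToSphere b s = z := by
  induction z using OnePoint.rec with
  | infty =>
    obtain ⟨s, hs, h⟩ := exists_inv_squareDefect_smul b
    refine ⟨s, hs.le, squareToSphere_eq_infty_iff.2 ?_⟩
    rw [← h, smul_smul, mul_inv_cancel₀ (squareDefect_pos hs).ne', one_smul]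
  | coe v =>
    by_cases hv : v = 0
    · exact ⟨(1, 0), by simp, by rw [hv]; exact squareToSphere_of_norm_eq_one (by simp)⟩
    obtain ⟨s, hs, h⟩ := exists_inv_squareDefect_smul ((normSqPlane v)⁻¹ • v + b)
    have p := squareDefect_pos hs
    refine ⟨s, hs.le, ?_⟩
    have hne : squareToSphere b s ≠ OnePoint.infty := ?_
    · rw [← coe_toPlane hne, toPlane_squareToSphere p.ne', h, add_sub_cancel_right,
        inv_normSqPlane_smul_invol]
    intro h'
    rw [squareToSphere_eq_infty_iff] at h'
    have h2 : (squareDefect s)⁻¹ • s = b := (inv_smul_eq_iff₀ p.ne').2 h'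
    rw [h2, right_eq_add] at h
    refine smul_ne_zero (inv_ne_zero fun h => hv (normSqPlane_eq_zero.1 h)) hv h

theorem continuousAt_squareToSphere {b s : ℝ × ℝ} (hs : ‖s‖ ≤ 1) :
    ContinuousAt (squareToSphere b) s := by
  have hc : Continuous fun s => s - squareDefect s • b :=
    continuous_id.sub (continuous_squareDefect.smul continuous_const)
  by_cases h : s = squareDefect s • b
  · have h1 : ‖s‖ < 1 := by
      refine lt_of_le_of_ne hs fun h1 => ?_
      rw [squareDefect_eq_zero h1, zero_smul] at h
      exact ne_zero_of_norm_eq_one h1 h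
    have p := squareDefect_pos h1
    rw [ContinuousAt, squareToSphere_eq_infty_iff.2 h]
    refine tendsto_nhds_infty_of_norm fun R => ?_
    have t1 : Tendsto (fun s => 2 * ‖s - squareDefect s • b‖ * R) (𝓝 s) (𝓝 0) := by
      have := ((hc.norm.const_mul 2).mul_const R).tendsto s
      simpa [sub_eq_zero.2 h] using this
    filter_upwards [t1.eventually_lt (continuous_squareDefect.tendsto s) p,
      (continuous_squareDefect.tendsto s).eventually (lt_mem_nhds p)] with x hx hx0 v hv
    have hx1 : normSqPlane (x - squareDefect x • b) ≠ 0 := by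
      intro h0
      rw [squareToSphere, h0, planeRatio_zero] at hv
      exact OnePoint.infty_ne_coe _ hv
    have hx2 : x - squareDefect x • b ≠ 0 := fun h => hx1 (normSqPlane_eq_zero.2 h)
    rw [squareToSphere, planeRatio_of_ne hx1, OnePoint.coe_eq_coe] at hv
    rw [← hv]
    generalize x - squareDefect x • b = y at hx hx1 hx2
    have hy := norm_pos_iff.2 hx2
    have hN : 0 < normSqPlane y := lt_of_le_of_ne (normSqPlane_nonneg y) hx1.symm
    rw [norm_smul, norm_smul, norm_inv, Real.norm_of_nonneg hN.le, Real.norm_of_nonneg hx0.le,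
      ← div_eq_inv_mul, lt_div_iff₀ hN]
    by_cases hR : R ≤ 0
    · exact lt_of_le_of_lt (mul_nonpos_of_nonpos_of_nonneg hR hN.le) (by positivity)
    · push Not at hR
      calc R * normSqPlane y ≤ R * (2 * ‖y‖ ^ 2) := by gcongr; exact normSqPlane_le y
        _ = (2 * ‖y‖ * R) * ‖y‖ := by ring
        _ < _ := by gcongr
  · refine tendsto_planeRatio ((continuous_squareDefect.smul hc).tendsto s)
      ((continuous_normSqPlane.comp hc).tendsto s) (Or.inl fun h' => h ?_)
    exact sub_eq_zero.1 (normSqPlane_eq_zero.1 h')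

theorem exists_dirAt_squareToSphere {b s : ℝ × ℝ} (hs : ‖s‖ < 1)
    (h : squareToSphere b s ≠ OnePoint.infty) :
    ∃ B, DirAt (fun s => toPlane (squareToSphere b s)) s B := by
  have p := squareDefect_pos hs
  obtain ⟨A₁, hA₁⟩ : ∃ A : (ℝ × ℝ) ≃L[ℝ] (ℝ × ℝ), HasStrictFDerivAt
      (fun s => (squareDefect s)⁻¹ • s) (A : (ℝ × ℝ) →L[ℝ] (ℝ × ℝ)) s := by
    have hd : HasStrictFDerivAt squareDefect _ s :=
      (((hasStrictFDerivAt_fst (𝕜 := ℝ) (p := s)).pow 2).const_sub 1).mul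
        (((hasStrictFDerivAt_snd (𝕜 := ℝ) (p := s)).pow 2).const_sub 1)
    refine exists_equiv_hasStrictFDerivAt_smul_self
      (((hasStrictDerivAt_inv p.ne').hasStrictFDerivAt).comp s hd) (inv_ne_zero p.ne') ?_
    obtain ⟨a1, a2⟩ := norm_lt_one_iff_sq.1 hs
    apply ne_of_gt
    refine add_pos_of_pos_of_nonneg (inv_pos.2 p) ?_
    simp only [ContinuousLinearMap.comp_apply, add_apply,
      smul_apply, neg_apply,
      ContinuousLinearMap.toSpanSingleton_apply, ContinuousLinearMap.coe_fst',
      ContinuousLinearMap.coe_snd', smul_eq_mul, nsmul_eq_mul]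
    have e : ((1 - s.1 ^ 2) * -((((2 : ℕ) : ℝ) * s.2 ^ (2 - 1)) * s.2) +
      (1 - s.2 ^ 2) * -((((2 : ℕ) : ℝ) * s.1 ^ (2 - 1)) * s.1)) * -(squareDefect s ^ 2)⁻¹ =
      ((1 - s.1 ^ 2) * (2 * s.2 ^ 2) + (1 - s.2 ^ 2) * (2 * s.1 ^ 2)) * (squareDefect s ^ 2)⁻¹ := by
      push_cast
      ring
    rw [e]
    have := sub_pos.2 a1
    have := sub_pos.2 a2
    positivity
  obtain ⟨A₂, hA₂⟩ : ∃ A : (ℝ × ℝ) ≃L[ℝ] (ℝ × ℝ), HasStrictFDerivAt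
      (fun v => (normSqPlane v)⁻¹ • v) (A : (ℝ × ℝ) →L[ℝ] (ℝ × ℝ)) ((squareDefect s)⁻¹ • s - b) := by
    have hne : (squareDefect s)⁻¹ • s - b ≠ 0 := by
      intro h0
      apply h
      rw [squareToSphere_eq_infty_iff, ← sub_eq_zero.1 h0, smul_smul, mul_inv_cancel₀ p.ne',
        one_smul]
    generalize (squareDefect s)⁻¹ • s - b = v at hne
    have hN : normSqPlane v ≠ 0 := fun h => hne (normSqPlane_eq_zero.1 h)
    have hd : HasStrictFDerivAt normSqPlane _ v :=
      ((hasStrictFDerivAt_fst (𝕜 := ℝ) (p := v)).pow 2).add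
        ((hasStrictFDerivAt_snd (𝕜 := ℝ) (p := v)).pow 2)
    refine exists_equiv_hasStrictFDerivAt_smul_self
      (((hasStrictDerivAt_inv hN).hasStrictFDerivAt).comp v hd) (inv_ne_zero hN) ?_
    simp only [ContinuousLinearMap.comp_apply, add_apply,
      smul_apply, ContinuousLinearMap.toSpanSingleton_apply,
      ContinuousLinearMap.coe_fst', ContinuousLinearMap.coe_snd', smul_eq_mul, nsmul_eq_mul]
    have e : ((((2 : ℕ) : ℝ) * v.1 ^ (2 - 1)) * v.1 + (((2 : ℕ) : ℝ) * v.2 ^ (2 - 1)) * v.2) *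
        -(normSqPlane v ^ 2)⁻¹ = - 2 * (normSqPlane v)⁻¹ := by
      have : ((((2 : ℕ) : ℝ) * v.1 ^ (2 - 1)) * v.1 + (((2 : ℕ) : ℝ) * v.2 ^ (2 - 1)) * v.2) =
        2 * normSqPlane v := by
        simp only [normSqPlane]
        push_cast
        ring
      rw [this]
      field_simp
    rw [e]
    have := inv_ne_zero hN
    intro h
    apply this
    linarith
  have hd := (hA₂.comp s (hA₁.sub_const b)).hasFDerivAt
  refine ⟨A₁.trans A₂, (HasFDerivAt.dirAt (A := A₁.trans A₂) hd).congr ?_⟩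
  filter_upwards [(continuous_squareDefect.tendsto s).eventually_ne p.ne'] with x hx
  exact (toPlane_squareToSphere hx).symm

theorem tendsto_dir_squareToSphere (b : ℝ × ℝ) {s₀ : ℝ × ℝ} (hs : ‖s₀‖ = 1) :
    Tendsto (fun s => dir (toPlane (squareToSphere b s))) (𝓝[{s | ‖s‖ < 1}] s₀) (𝓝 s₀) := by
  have hc : Continuous fun s => s - squareDefect s • b :=
    continuous_id.sub (continuous_squareDefect.smul continuous_const)
  have h0 : s₀ - squareDefect s₀ • b = s₀ := by rw [squareDefect_eq_zero hs, zero_smul, sub_zero]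
  have hne : s₀ ≠ 0 := ne_zero_of_norm_eq_one hs
  have h1 : Tendsto (fun s => s - squareDefect s • b) (𝓝 s₀) (𝓝 s₀) := by
    have := hc.tendsto s₀
    rwa [h0] at this
  have h2 : Tendsto (fun s => dir (s - squareDefect s • b)) (𝓝 s₀) (𝓝 s₀) := by
    have := (continuousAt_dir hne).tendsto.comp h1
    rwa [dir_of_norm_eq_one hs] at this
  refine (h2.mono_left nhdsWithin_le_nhds).congr' ?_
  filter_upwards [self_mem_nhdsWithin, nhdsWithin_le_nhds (h1.eventually_ne hne)] with s hs1 hs2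
  have p := squareDefect_pos hs1
  have hN : 0 < normSqPlane (s - squareDefect s • b) := lt_of_le_of_ne (normSqPlane_nonneg _)
    fun h => hs2 (normSqPlane_eq_zero.1 h.symm)
  rw [squareToSphere, toPlane_planeRatio, dir_smul (inv_pos.2 hN), dir_smul p]

/-- The collapsing map, in coordinates in which the unit square is the unit ball. -/
noncomputable def centeredCollapse (x : ℝ × ℝ) : ℝ × ℝ := (2 : ℝ) • collapse x - (1, 1)

theorem continuous_centeredCollapse : Continuous centeredCollapse := by
  have := continuous_collapse
  unfold centeredCollapse
  fun_prop

theorem centeredCollapse_inj {x y : ℝ × ℝ} :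
    centeredCollapse x = centeredCollapse y ↔ collapse x = collapse y := by
  unfold centeredCollapse
  rw [sub_left_inj]
  exact (smul_right_injective (ℝ × ℝ) (two_ne_zero (α := ℝ))).eq_iff

theorem norm_two_smul_sub_one_le {w : ℝ × ℝ} :
    ‖(2 : ℝ) • w - (1, 1)‖ ≤ 1 ↔ w ∈ Icc (0 : ℝ × ℝ) 1 := by
  rw [Prod.norm_def, max_le_iff, Real.norm_eq_abs, Real.norm_eq_abs, abs_le, abs_le, mem_Icc,
    Prod.le_def, Prod.le_def]
  simp only [Prod.fst_sub, Prod.smul_fst, smul_eq_mul, Prod.snd_sub, Prod.smul_snd, Prod.fst_zero,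
    Prod.snd_zero, Prod.fst_one, Prod.snd_one]
  constructor
  · rintro ⟨⟨h1, h2⟩, h3, h4⟩
    exact ⟨⟨by linarith, by linarith⟩, by linarith, by linarith⟩
  · rintro ⟨⟨h1, h2⟩, h3, h4⟩
    exact ⟨⟨by linarith, by linarith⟩, by linarith, by linarith⟩

theorem norm_centeredCollapse_le_one_iff {x : ℝ × ℝ} :
    ‖centeredCollapse x‖ ≤ 1 ↔ x ∈ Icc (0 : ℝ × ℝ) 1 := by
  rw [centeredCollapse, norm_two_smul_sub_one_le, collapse_mem_Icc_iff]

theorem exists_int_of_norm_centeredCollapse_eq_one {x : ℝ × ℝ} (h : ‖centeredCollapse x‖ = 1) :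
    ∃ m : ℤ, x.1 = m ∨ x.2 = m := by
  rw [centeredCollapse, Prod.norm_def, Real.norm_eq_abs, Real.norm_eq_abs] at h
  rcases max_choice |((2 : ℝ) • collapse x - (1, 1)).1| |((2 : ℝ) • collapse x - (1, 1)).2| with
    h' | h' <;> rw [h', abs_eq zero_le_one] at h <;>
    simp only [Prod.fst_sub, Prod.smul_fst, smul_eq_mul, Prod.snd_sub, Prod.smul_snd] at h
  · rcases h with h | h
    · exact ⟨1, Or.inl ((collapse_fst_eq_int_iff _ _).1 (by push_cast; linarith))⟩
    · exact ⟨0, Or.inl ((collapse_fst_eq_int_iff _ _).1 (by push_cast; linarith))⟩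
  · rcases h with h | h
    · exact ⟨1, Or.inr ((collapse_snd_eq_int_iff _ _).1 (by push_cast; linarith))⟩
    · exact ⟨0, Or.inr ((collapse_snd_eq_int_iff _ _).1 (by push_cast; linarith))⟩

theorem collapse_eq_self_of_norm_eq_one {x : ℝ × ℝ} (h : ‖centeredCollapse x‖ = 1) :
    collapse x = x := by
  obtain ⟨m, h | h⟩ := exists_int_of_norm_centeredCollapse_eq_one h
  · exact collapse_of_fst_int h
  · exact collapse_of_snd_int h

theorem norm_centeredCollapse_lt_one {x : ℝ × ℝ} {n : ℕ} {k : ℤ × ℤ}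
    (hx : x ∈ Icc (0 : ℝ × ℝ) 1) (hk : (3 ^ n : ℝ) • x ∈ cellHole k) :
    ‖centeredCollapse x‖ < 1 := by
  refine lt_of_le_of_ne (norm_centeredCollapse_le_one_iff.2 hx) fun h => ?_
  obtain ⟨m, h⟩ := exists_int_of_norm_centeredCollapse_eq_one h
  obtain ⟨h1, h2⟩ := ne_int_of_mem_cellHole hk (3 ^ n * m)
  push_cast at h1 h2
  rcases h with h | h
  · exact h1 (by rw [Prod.smul_fst, h, smul_eq_mul])
  · exact h2 (by rw [Prod.smul_snd, h, smul_eq_mul])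

theorem collapse_eq_of_pow_smul_mem_cellHole {x : ℝ × ℝ} {n : ℕ} {k : ℤ × ℤ}
    (h : (3 ^ n : ℝ) • x ∈ cellHole k) :
    collapse x = collapseTail n ((k.1 : ℝ) + 1 / 2, (k.2 : ℝ) + 1 / 2) := by
  rw [← collapseTail_collapse n x, collapse_of_mem_cellHole h]

theorem countable_collapse_holes :
    (centeredCollapse '' {x | ∃ (n : ℕ) (k : ℤ × ℤ), (3 ^ n : ℝ) • x ∈ cellHole k}).Countable := by
  refine (countable_range fun nk : ℕ × (ℤ × ℤ) => (2 : ℝ) •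
    collapseTail nk.1 ((nk.2.1 : ℝ) + 1 / 2, (nk.2.2 : ℝ) + 1 / 2) - (1, 1)).mono ?_
  rintro _ ⟨x, ⟨n, k, h⟩, rfl⟩
  exact ⟨(n, k), by simp only [centeredCollapse, collapse_eq_of_pow_smul_mem_cellHole h]⟩

theorem exists_hole_center_near (x : ℝ × ℝ) {U : Set (ℝ × ℝ)} (hU : U ∈ 𝓝 x) :
    ∃ y ∈ U, ∃ (n : ℕ) (k : ℤ × ℤ), (3 ^ n : ℝ) • y ∈ openCellHole k := by
  obtain ⟨ε, hε, hU⟩ := Metric.mem_nhds_iff.1 hU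
  obtain ⟨n, hn⟩ := exists_pow_lt_of_lt_one hε (show (1 / 3 : ℝ) < 1 by norm_num)
  have h3 : (0 : ℝ) < 3 ^ n := by positivity
  have hn' : 1 < ε * 3 ^ n := by
    rw [one_div, inv_pow, inv_lt_iff_one_lt_mul₀ h3] at hn
    linarith
  refine ⟨((3 ^ n : ℝ)⁻¹) • ((⌊3 ^ n * x.1⌋ : ℝ) + 1 / 2, (⌊3 ^ n * x.2⌋ : ℝ) + 1 / 2), hU ?_, n,
    (⌊3 ^ n * x.1⌋, ⌊3 ^ n * x.2⌋), ?_⟩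
  · have key : ∀ t : ℝ, dist ((3 ^ n : ℝ)⁻¹ * ((⌊3 ^ n * t⌋ : ℝ) + 1 / 2)) t < ε := by
      intro t
      have h1 := Int.floor_le (3 ^ n * t)
      have h2 := Int.lt_floor_add_one (3 ^ n * t)
      rw [Real.dist_eq]
      have : (3 ^ n : ℝ)⁻¹ * ((⌊3 ^ n * t⌋ : ℝ) + 1 / 2) - t =
        (3 ^ n : ℝ)⁻¹ * ((⌊3 ^ n * t⌋ : ℝ) + 1 / 2 - 3 ^ n * t) := by field_simp
      rw [this, abs_mul, abs_of_pos (inv_pos.2 h3), ← div_eq_inv_mul, div_lt_iff₀ h3, abs_lt]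
      constructor <;> linarith
    rw [Metric.mem_ball, Prod.dist_eq, max_lt_iff]
    exact ⟨key x.1, key x.2⟩
  · rw [smul_smul, mul_inv_cancel₀ h3.ne', one_smul]
    simp [openCellHole]

theorem dir_inj_of_norm_eq {L : (ℝ × ℝ) ≃L[ℝ] (ℝ × ℝ)} {u v : ℝ × ℝ} (hu : u ≠ 0)
    (huv : ‖u‖ = ‖v‖) (h : dir (L u) = dir (L v)) : u = v := by
  have hv : v ≠ 0 := norm_ne_zero_iff.1 (huv ▸ norm_ne_zero_iff.2 hu)
  have h1 : u = (‖L u‖ * ‖L v‖⁻¹) • v := by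
    apply L.injective
    rw [map_smul, mul_smul]
    conv_lhs => rw [← norm_smul_dir (L u), h]
    rfl
  have hLv : 0 < ‖L v‖ := norm_pos_iff.2 (L.apply_ne_zero hv)
  have hLu : 0 < ‖L u‖ := norm_pos_iff.2 (L.apply_ne_zero hu)
  have h2 : ‖L u‖ * ‖L v‖⁻¹ = 1 := by
    have h3 := congrArg norm h1
    rw [norm_smul, Real.norm_of_nonneg (by positivity), huv] at h3
    have hv' : ‖v‖ ≠ 0 := norm_ne_zero_iff.2 hv
    exact mul_right_cancel₀ hv' (by rw [one_mul]; exact h3.symm)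
  rw [h1, h2, one_smul]

theorem exists_dirAt_two_smul_sub_one (w : ℝ × ℝ) :
    ∃ A, DirAt (fun w : ℝ × ℝ => (2 : ℝ) • w - (1, 1)) w A := by
  refine ⟨ContinuousLinearEquiv.smulLeft (Units.mk0 (2 : ℝ) two_ne_zero), HasFDerivAt.dirAt ?_⟩
  exact ((hasFDerivAt_id (𝕜 := ℝ) w).const_smul (2 : ℝ)).sub_const (1, 1)

/-- The carpet is the sphere with a countable dense set of points blown up. -/
theorem exists_isPlaneBlowUp_sierpinskiCarpet :
    ∃ (Ψ : sierpinskiCarpet → OnePoint (ℝ × ℝ)) (E : Set (ℝ × ℝ))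
      (a : ℝ × ℝ → sierpinskiCarpet → ℝ × ℝ),
      IsPlaneBlowUp Ψ E a ∧ E.Countable ∧ Dense E := by
  obtain ⟨b, hb⟩ : ∃ b : ℝ × ℝ, b ∉ (fun s => (squareDefect s)⁻¹ • s) '' (centeredCollapse ''
      {x | ∃ (n : ℕ) (k : ℤ × ℤ), (3 ^ n : ℝ) • x ∈ cellHole k}) :=
    ((countable_collapse_holes.image _).dense_compl ℝ).nonempty
  let Φ : ℝ × ℝ → OnePoint (ℝ × ℝ) := fun x => squareToSphere b (centeredCollapse x)
  have hmem : ∀ x ∈ sierpinskiCarpet, x ∈ Icc (0 : ℝ × ℝ) 1 ∧ x ∈ holeFree := fun x hx => by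
    rwa [sierpinskiCarpet_eq] at hx
  have hΦfin : ∀ x ∈ Icc (0 : ℝ × ℝ) 1, ∀ (n : ℕ) (k : ℤ × ℤ), (3 ^ n : ℝ) • x ∈ cellHole k →
      Φ x ≠ OnePoint.infty := by
    intro x hx n k hk h
    have h1 := squareToSphere_eq_infty_iff.1 h
    refine hb ⟨_, ⟨x, ⟨n, k, hk⟩, rfl⟩, ?_⟩
    exact (inv_smul_eq_iff₀ (squareDefect_pos (norm_centeredCollapse_lt_one hx hk)).ne').2 h1
  have hcont : ∀ x ∈ Icc (0 : ℝ × ℝ) 1, ContinuousAt Φ x := fun x hx =>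
    (continuousAt_squareToSphere (norm_centeredCollapse_le_one_iff.2 hx)).comp
      continuous_centeredCollapse.continuousAt
  have hcorner : ∀ x ∈ Icc (0 : ℝ × ℝ) 1, x ∉ holeFree → ∃ p ∈ sierpinskiCarpet,
      Φ p = Φ x ∧ ∃ (n : ℕ) (k : ℤ × ℤ), (3 ^ n : ℝ) • p ∈ cellHole k := by
    intro x hx hx'
    obtain ⟨p, hp, n, k, h1, h2⟩ := exists_corner hx hx'
    refine ⟨p, hp, ?_, n, k, h1⟩
    have : collapse p = collapse x := by
      rw [collapse_eq_of_pow_smul_mem_cellHole h1, collapse_eq_of_pow_smul_mem_cellHole h2]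
    simp only [Φ, centeredCollapse_inj.2 this]
  have hsurj : ∀ z, ∃ x ∈ Icc (0 : ℝ × ℝ) 1, Φ x = z := by
    intro z
    obtain ⟨s, hs, hz⟩ := exists_squareToSphere_eq b z
    obtain ⟨x, hx⟩ := collapse_surjective ((1 / 2 : ℝ) • (s + (1, 1)))
    have hxs : centeredCollapse x = s := by
      rw [centeredCollapse, hx, smul_smul]
      norm_num
    exact ⟨x, norm_centeredCollapse_le_one_iff.1 (hxs ▸ hs), by simp only [Φ, hxs, hz]⟩
  let E : Set (ℝ × ℝ) := insert 0 {e | ∃ x ∈ sierpinskiCarpet, ∃ (n : ℕ) (k : ℤ × ℤ),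
    (3 ^ n : ℝ) • x ∈ cellHole k ∧ Φ x = e}
  have hfib0 : ∀ x ∈ sierpinskiCarpet,
      Φ x = ((0 : ℝ × ℝ) : OnePoint (ℝ × ℝ)) ↔ ‖centeredCollapse x‖ = 1 := by
    intro x hx
    refine ⟨fun h => ?_, fun h => squareToSphere_of_norm_eq_one h⟩
    refine le_antisymm (norm_centeredCollapse_le_one_iff.2 (hmem x hx).1) (not_lt.1 fun h' => ?_)
    exact squareToSphere_ne_zero h' h
  have hangle : ∀ e ∈ E, ∃ α : sierpinskiCarpet → ℝ × ℝ,
      (∀ x : sierpinskiCarpet, Φ x = (e : OnePoint (ℝ × ℝ)) → ‖α x‖ = 1) ∧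
      InjOn α {x | Φ x = (e : OnePoint (ℝ × ℝ))} ∧
      ContinuousOn α {x | Φ x = (e : OnePoint (ℝ × ℝ))} ∧
      ∀ x : sierpinskiCarpet, Φ x = (e : OnePoint (ℝ × ℝ)) →
        Tendsto (fun x' : sierpinskiCarpet => dir (toPlane (Φ x') - e))
          (𝓝[{x' : sierpinskiCarpet | Φ x' ≠ (e : OnePoint (ℝ × ℝ))}] x) (𝓝 (α x)) := by
    rintro e (rfl | ⟨x₀, hx₀, n, k, hk, he⟩)
    · refine ⟨fun x => centeredCollapse x, fun x hx => (hfib0 x x.2).1 hx, ?_,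
        (continuous_centeredCollapse.comp continuous_subtype_val).continuousOn, ?_⟩
      · intro x hx y hy hxy
        have := centeredCollapse_inj.1 hxy
        rw [collapse_eq_self_of_norm_eq_one ((hfib0 x x.2).1 hx),
          collapse_eq_self_of_norm_eq_one ((hfib0 y y.2).1 hy)] at this
        exact Subtype.ext this
      · intro x hx
        have h1 := tendsto_dir_squareToSphere b ((hfib0 x x.2).1 hx)
        simp only [sub_zero]
        refine h1.comp (tendsto_nhdsWithin_iff.2 ⟨?_, ?_⟩)
        · exact ((continuous_centeredCollapse.comp continuous_subtype_val).tendsto x).mono_left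
            nhdsWithin_le_nhds
        · filter_upwards [self_mem_nhdsWithin] with y hy
          exact lt_of_le_of_ne (norm_centeredCollapse_le_one_iff.2 (hmem y y.2).1)
            fun h => hy ((hfib0 y y.2).2 h)
    · have hlt := norm_centeredCollapse_lt_one (hmem x₀ hx₀).1 hk
      obtain ⟨A, hA⟩ := exists_tendsto_collapse_dirFilter (hmem x₀ hx₀).2 hk
      obtain ⟨B₁, hB₁⟩ := exists_dirAt_squareToSphere hlt (hΦfin x₀ (hmem x₀ hx₀).1 n k hk)
      obtain ⟨B₂, hB₂⟩ := exists_dirAt_two_smul_sub_one (collapse x₀)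
      have hB := DirAt.comp (f := fun w : ℝ × ℝ => (2 : ℝ) • w - (1, 1)) hB₁ hB₂
      have hcol : ∀ x : sierpinskiCarpet, Φ x = (e : OnePoint (ℝ × ℝ)) →
          collapse x = collapse x₀ := by
        intro x hx
        rcases squareToSphere_fiber hlt.le (norm_centeredCollapse_le_one_iff.2 (hmem x x.2).1)
          (he.trans hx.symm) with h | h
        · exact (centeredCollapse_inj.1 h).symm
        · exact absurd h hlt.ne
      have hhole : ∀ x : sierpinskiCarpet, Φ x = (e : OnePoint (ℝ × ℝ)) →
          (3 ^ n : ℝ) • (x : ℝ × ℝ) ∈ cellHole k := fun x hx =>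
        mem_cellHole_of_collapse_eq (hmem x₀ hx₀).2 hk (hcol x hx).symm
      have hnorm : ∀ x : sierpinskiCarpet, Φ x = (e : OnePoint (ℝ × ℝ)) →
          ‖(3 ^ n : ℝ) • (x : ℝ × ℝ) - ((k.1 : ℝ) + 1 / 2, (k.2 : ℝ) + 1 / 2)‖ = 1 / 6 :=
        fun x hx => norm_sub_of_mem_cellHole (hhole x hx) ((hmem x x.2).2 n k)
      have hne : ∀ x : sierpinskiCarpet, Φ x = (e : OnePoint (ℝ × ℝ)) →
          (3 ^ n : ℝ) • (x : ℝ × ℝ) - ((k.1 : ℝ) + 1 / 2, (k.2 : ℝ) + 1 / 2) ≠ 0 := fun x hx h => by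
        have := hnorm x hx
        rw [h, norm_zero] at this
        norm_num at this
      refine ⟨fun x => dir ((A.trans (B₂.trans B₁)) ((3 ^ n : ℝ) • (x : ℝ × ℝ) -
        ((k.1 : ℝ) + 1 / 2, (k.2 : ℝ) + 1 / 2))), ?_, ?_, ?_, ?_⟩
      · exact fun x hx => norm_dir ((A.trans (B₂.trans B₁)).apply_ne_zero (hne x hx))
      · intro x hx y hy hxy
        have h1 := dir_inj_of_norm_eq (hne x hx) ((hnorm x hx).trans (hnorm y hy).symm) hxy
        have h2 := sub_left_injective h1
        exact Subtype.ext (smul_right_injective (ℝ × ℝ) (by positivity : (3 ^ n : ℝ) ≠ 0) h2)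
      · intro x hx
        refine ContinuousAt.continuousWithinAt ?_
        refine ContinuousAt.comp (g := dir)
          (continuousAt_dir ((A.trans (B₂.trans B₁)).apply_ne_zero (hne x hx))) ?_
        refine (A.trans (B₂.trans B₁)).continuous.continuousAt.comp ?_
        exact Continuous.continuousAt (by fun_prop)
      · intro x hx
        have h1 := hA x (hmem x x.2).2 (hhole x hx)
        rw [hcol x hx] at h1
        have h2 := (hB _ (norm_dir (A.apply_ne_zero (hne x hx)))).comp h1
        have h3 := (tendsto_dirFilter.1 h2).2
        have h4 := dir_map_dir ((B₂.trans B₁ : (ℝ × ℝ) ≃L[ℝ] (ℝ × ℝ)) : (ℝ × ℝ) →L[ℝ] (ℝ × ℝ))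
          (A.apply_ne_zero (hne x hx))
        have h5 : (fun w : ℝ × ℝ => toPlane (squareToSphere b w))
            ((2 : ℝ) • collapse x₀ - (1, 1)) = e := by
          change toPlane (Φ x₀) = e
          rw [he, toPlane_coe]
        have h6 : Tendsto (fun x' : sierpinskiCarpet => (x' : ℝ × ℝ))
            (𝓝[{x' : sierpinskiCarpet | Φ x' ≠ (e : OnePoint (ℝ × ℝ))}] x)
            (𝓝[{y | collapse y ≠ collapse x₀}] (x : ℝ × ℝ)) := by
          refine tendsto_nhdsWithin_iff.2 ⟨(continuous_subtype_val.tendsto x).mono_left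
            nhdsWithin_le_nhds, ?_⟩
          filter_upwards [self_mem_nhdsWithin] with y hy h
          exact hy (by rw [← he]; simp only [Φ, centeredCollapse_inj.2 h])
        have h7 := h3.comp h6
        change Tendsto _ _ (𝓝 (dir ((B₂.trans B₁ : (ℝ × ℝ) ≃L[ℝ] (ℝ × ℝ)) (dir _)))) at h7
        erw [h4] at h7
        refine h7.congr fun y => ?_
        rw [← h5]
        rfl
  choose! a ha using hangle
  refine ⟨fun x => Φ x, E, a, ⟨?_, ?_, ?_, fun e he => (ha e he).1, fun e he => (ha e he).2.1,
    fun e he => (ha e he).2.2.1, fun e he => (ha e he).2.2.2⟩, ?_, ?_⟩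
  · exact continuous_iff_continuousAt.2 fun x =>
      (hcont x (hmem x x.2).1).comp continuous_subtype_val.continuousAt
  · intro z
    obtain ⟨x, hx, rfl⟩ := hsurj z
    by_cases h : x ∈ holeFree
    · exact ⟨⟨x, by rw [sierpinskiCarpet_eq]; exact ⟨hx, h⟩⟩, rfl⟩
    · obtain ⟨p, hp, h1, -⟩ := hcorner x hx h
      exact ⟨⟨p, hp⟩, h1⟩
  · intro x y hxy
    rcases squareToSphere_fiber (norm_centeredCollapse_le_one_iff.2 (hmem x x.2).1)
      (norm_centeredCollapse_le_one_iff.2 (hmem y y.2).1) hxy with h | h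
    · rcases collapse_fiber (centeredCollapse_inj.1 h) with h | ⟨n, k, h, -⟩
      · exact Or.inl (Subtype.ext h)
      · have := coe_toPlane (hΦfin x (hmem x x.2).1 n k h)
        exact Or.inr ⟨toPlane (Φ x), Or.inr ⟨x, x.2, n, k, h, this.symm⟩, this.symm⟩
    · exact Or.inr ⟨0, Or.inl rfl, (hfib0 x x.2).2 h⟩
  · refine Countable.insert _ ((countable_collapse_holes.image
      fun s => toPlane (squareToSphere b s)).mono ?_)
    rintro e ⟨x, -, n, k, hk, he⟩
    refine ⟨_, ⟨x, ⟨n, k, hk⟩, rfl⟩, ?_⟩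
    change toPlane (Φ x) = e
    rw [he, toPlane_coe]
  · rw [dense_iff_inter_open]
    intro U hU hU'
    obtain ⟨v, hvU, hv0⟩ := (dense_compl_singleton (0 : ℝ × ℝ)).inter_open_nonempty U hU hU'
    obtain ⟨x, hx, hxv⟩ := hsurj v
    have hlt : ‖centeredCollapse x‖ < 1 := by
      refine lt_of_le_of_ne (norm_centeredCollapse_le_one_iff.2 hx) fun h => hv0 ?_
      have := hxv.symm.trans (squareToSphere_of_norm_eq_one h)
      exact OnePoint.coe_eq_coe.1 this
    have hopen : ((↑) : ℝ × ℝ → OnePoint (ℝ × ℝ)) '' U ∈ 𝓝 (Φ x) := by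
      rw [hxv]
      exact (OnePoint.isOpenEmbedding_coe.isOpenMap U hU).mem_nhds (mem_image_of_mem _ hvU)
    obtain ⟨y, ⟨hy1, hy2⟩, n, k, hy⟩ := exists_hole_center_near x
      (inter_mem ((hcont x hx).preimage_mem_nhds hopen)
        (continuous_centeredCollapse.norm.tendsto x |>.eventually (gt_mem_nhds hlt)))
    obtain ⟨p, hp, hpy, n', k', hk'⟩ := hcorner y
      (norm_centeredCollapse_le_one_iff.1 (le_of_lt hy2)) (fun h => h n k hy)
    obtain ⟨w, hw, hwy⟩ := hy1
    exact ⟨w, hw, Or.inr ⟨p, hp, n', k', hk', hpy.trans hwy.symm⟩⟩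

/-- The affine function which sends `3⁻ⁿ⁻¹` to `-2n - 2` and `3⁻ⁿ` to `-2n`. -/
noncomputable def logPiece (n : ℕ) (σ : ℝ) : ℝ := 3 ^ (n + 1) * σ - (2 * n + 3)

theorem logPiece_succ_sub (n : ℕ) (σ : ℝ) :
    logPiece (n + 1) σ - logPiece n σ = 2 * (3 ^ (n + 1) * σ - 1) := by
  unfold logPiece; push_cast; ring

theorem logPiece_strictMono (n : ℕ) : StrictMono (logPiece n) := by
  intro a b h
  have : (0 : ℝ) < 3 ^ (n + 1) := by positivity
  have := mul_lt_mul_of_pos_left h this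
  unfold logPiece; linarith

theorem logPiece_le {n : ℕ} {σ : ℝ} (hσ : 0 < σ) (h1 : 1 ≤ 3 ^ (n + 1) * σ) (h2 : 3 ^ n * σ ≤ 1)
    (m : ℕ) : logPiece n σ ≤ logPiece m σ := by
  rcases le_total n m with h | h
  · induction m, h using Nat.le_induction with
    | base => exact le_rfl
    | succ m hm ih =>
      have := logPiece_succ_sub m σ
      have h3 : (3 : ℝ) ^ (n + 1) * σ ≤ 3 ^ (m + 1) * σ := by gcongr; norm_num
      linarith
  · obtain ⟨d, rfl⟩ := Nat.exists_eq_add_of_le h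
    induction d with
    | zero => exact le_rfl
    | succ d ih =>
      have h0 : (3 : ℝ) ^ (m + d) * σ ≤ 3 ^ (m + (d + 1)) * σ := by gcongr <;> norm_num
      have h0' : (3 : ℝ) ^ (m + d + 1) * σ ≤ 1 := h2
      have key : logPiece (m + d + 1) σ ≤ logPiece (m + d) σ := by
        have := logPiece_succ_sub (m + d) σ
        linarith
      refine key.trans ?_
      clear ih
      have : ∀ j ≤ d, logPiece (m + d) σ ≤ logPiece (m + d - j) σ := by
        intro j hj
        induction j with
        | zero => exact le_rfl
        | succ j ih =>
          refine (ih (by omega)).trans ?_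
          have e : m + d - j = (m + d - (j + 1)) + 1 := by omega
          have := logPiece_succ_sub (m + d - (j + 1)) σ
          rw [← e] at this
          have h3 : (3 : ℝ) ^ (m + d - j) * σ ≤ 3 ^ (m + d) * σ := by
            gcongr
            · norm_num
            · omega
          linarith
      simpa using this d le_rfl

/-- A concave piecewise affine logarithm on `(0, 1]`, sending `3⁻ⁿ` to `-2n`. -/
noncomputable def foldLog (σ : ℝ) : ℝ := ⨅ n : ℕ, logPiece n σ

theorem foldLog_eq {n : ℕ} {σ : ℝ} (hσ : 0 < σ) (h1 : 1 ≤ 3 ^ (n + 1) * σ) (h2 : 3 ^ n * σ ≤ 1) :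
    foldLog σ = logPiece n σ :=
  le_antisymm (ciInf_le ⟨logPiece n σ, by rintro _ ⟨m, rfl⟩; exact logPiece_le hσ h1 h2 m⟩ n)
    (le_ciInf fun m => logPiece_le hσ h1 h2 m)

theorem exists_pow_three_mul {σ : ℝ} (hσ : 0 < σ) (h : σ ≤ 1) :
    ∃ n : ℕ, 1 < 3 ^ (n + 1) * σ ∧ 3 ^ n * σ ≤ 1 := by
  obtain ⟨n, h1, h2⟩ := exists_nat_pow_near_of_lt_one hσ h (y := (1 / 3 : ℝ)) (by norm_num)
    (by norm_num)
  refine ⟨n, ?_, ?_⟩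
  · rw [one_div, inv_pow, inv_lt_iff_one_lt_mul₀ (by positivity)] at h1
    linarith
  · rw [one_div, inv_pow, le_inv_comm₀ hσ (by positivity), ← one_div, le_div_iff₀ hσ] at h2
    exact h2

theorem foldLog_le {σ : ℝ} (hσ : 0 < σ) (h : σ ≤ 1) (m : ℕ) : foldLog σ ≤ logPiece m σ := by
  obtain ⟨n, h1, h2⟩ := exists_pow_three_mul hσ h
  rw [foldLog_eq hσ h1.le h2]
  exact logPiece_le hσ h1.le h2 m

theorem foldLog_strictMonoOn : StrictMonoOn foldLog (Ioc 0 1) := by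
  intro a ha b hb hab
  obtain ⟨n, h1, h2⟩ := exists_pow_three_mul hb.1 hb.2
  rw [foldLog_eq hb.1 h1.le h2]
  exact (foldLog_le ha.1 ha.2 n).trans_lt (logPiece_strictMono n hab)

theorem foldLog_one : foldLog 1 = 0 := by
  rw [foldLog_eq (n := 0) one_pos (by norm_num) (by norm_num)]
  norm_num [logPiece]

theorem exists_foldLog_eq {ℓ : ℝ} (h : ℓ ≤ 0) : ∃ σ ∈ Ioc (0 : ℝ) 1, foldLog σ = ℓ := by
  obtain ⟨n, hn⟩ : ∃ n, n = ⌊-ℓ / 2⌋₊ := ⟨_, rfl⟩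
  have h1 : (n : ℝ) ≤ -ℓ / 2 := by rw [hn]; exact Nat.floor_le (by linarith)
  have h2 : -ℓ / 2 < n + 1 := by rw [hn]; exact Nat.lt_floor_add_one _
  have h3 : (0 : ℝ) < 3 ^ n := by positivity
  have e : (3 : ℝ) ^ (n + 1) * ((ℓ + 2 * n + 3) / 3 ^ (n + 1)) = ℓ + 2 * n + 3 := by field_simp
  have e' : (3 : ℝ) ^ n * ((ℓ + 2 * n + 3) / 3 ^ (n + 1)) = (ℓ + 2 * n + 3) / 3 := by
    rw [pow_succ]; field_simp
  have p : 0 < (ℓ + 2 * n + 3) / 3 ^ (n + 1) := div_pos (by linarith) (by positivity)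
  refine ⟨(ℓ + 2 * n + 3) / 3 ^ (n + 1), ⟨p, ?_⟩, ?_⟩
  · rw [div_le_one (by positivity)]
    have : (3 : ℝ) ≤ 3 ^ (n + 1) := by
      rw [pow_succ]
      have := one_le_pow₀ (n := n) (show (1 : ℝ) ≤ 3 by norm_num)
      linarith
    linarith
  · rw [foldLog_eq (n := n) p (by rw [e]; linarith) (by rw [e']; linarith), logPiece, e]
    ring

theorem continuousOn_foldLog : ContinuousOn foldLog (Ioc 0 1) := by
  have himg : foldLog '' Ioc 0 1 = Iic 0 := by
    ext ℓ
    constructor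
    · rintro ⟨σ, hσ, rfl⟩
      rw [mem_Iic, ← foldLog_one]
      exact foldLog_strictMonoOn.monotoneOn hσ ⟨one_pos, le_rfl⟩ hσ.2
    · intro h
      exact exists_foldLog_eq h
  intro σ hσ
  rcases hσ.2.eq_or_lt with h | h
  · have hs : Ioc (0 : ℝ) 1 ∈ 𝓝[≤] (1 : ℝ) := Ioc_mem_nhdsLE one_pos
    subst h
    refine (foldLog_strictMonoOn.continuousWithinAt_left_of_image_mem_nhdsWithin hs ?_).mono
      fun x hx => hx.2
    rw [himg, foldLog_one]
    exact self_mem_nhdsWithin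
  · refine (foldLog_strictMonoOn.continuousAt_of_image_mem_nhds (Ioc_mem_nhds hσ.1 h)
      ?_).continuousWithinAt
    rw [himg]
    refine Iic_mem_nhds ?_
    rw [← foldLog_one]
    exact foldLog_strictMonoOn hσ ⟨one_pos, le_rfl⟩ h

/-- The odd extension of `foldLog` to `(0, 2)`. -/
noncomputable def stripLog (σ : ℝ) : ℝ := foldLog (min σ 1) - foldLog (min (2 - σ) 1)

theorem stripLog_two_sub (σ : ℝ) : stripLog (2 - σ) = -stripLog σ := by
  rw [stripLog, stripLog, sub_sub_cancel, neg_sub]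

theorem stripLog_of_le {σ : ℝ} (h : σ ≤ 1) : stripLog σ = foldLog σ := by
  rw [stripLog, min_eq_left h, min_eq_right (by linarith), foldLog_one, sub_zero]

theorem stripLog_strictMonoOn : StrictMonoOn stripLog (Ioo 0 2) := by
  have m : ∀ {x : ℝ}, 0 < x → min x 1 ∈ Ioc (0 : ℝ) 1 := fun hx =>
    ⟨lt_min hx one_pos, min_le_right _ _⟩
  intro a ha b hb hab
  unfold stripLog
  rcases le_or_gt 1 a with h | h
  · rw [min_eq_right h, min_eq_right (h.trans hab.le)]
    have := foldLog_strictMonoOn (m (sub_pos.2 hb.2)) (m (sub_pos.2 ha.2)) (by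
      rw [min_eq_left (by linarith), min_eq_left (by linarith)]; linarith)
    linarith
  · have h1 := foldLog_strictMonoOn (m ha.1) (m hb.1) (by
      rw [min_eq_left h.le]
      rcases le_or_gt b 1 with h | h'
      · rwa [min_eq_left h]
      · rw [min_eq_right h'.le]
        exact h)
    have h2 := foldLog_strictMonoOn.monotoneOn (m (sub_pos.2 hb.2)) (m (sub_pos.2 ha.2))
      (min_le_min_right _ (by linarith))
    linarith

theorem continuousOn_stripLog : ContinuousOn stripLog (Ioo 0 2) := by
  refine (continuousOn_foldLog.comp (Continuous.continuousOn (by fun_prop)) ?_).sub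
    (continuousOn_foldLog.comp (Continuous.continuousOn (by fun_prop)) ?_)
  · exact fun x hx => ⟨lt_min hx.1 one_pos, min_le_right _ _⟩
  · exact fun x hx => ⟨lt_min (sub_pos.2 hx.2) one_pos, min_le_right _ _⟩

theorem exists_stripLog_eq (ℓ : ℝ) : ∃ σ ∈ Ioo (0 : ℝ) 2, stripLog σ = ℓ := by
  rcases le_total ℓ 0 with h | h
  · obtain ⟨σ, hσ, e⟩ := exists_foldLog_eq h
    exact ⟨σ, ⟨hσ.1, by linarith [hσ.2]⟩, by rw [stripLog_of_le hσ.2, e]⟩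
  · obtain ⟨σ, hσ, e⟩ := exists_foldLog_eq (neg_nonpos.2 h)
    refine ⟨2 - σ, ⟨by linarith [hσ.2], by linarith [hσ.1]⟩, ?_⟩
    rw [stripLog_two_sub, stripLog_of_le hσ.2, e, neg_neg]

theorem eventually_lt_abs_stripLog (R : ℝ) :
    ∃ ε > 0, ∀ σ ∈ Ioo (0 : ℝ) 2, σ < ε ∨ 2 - ε < σ → R < |stripLog σ| := by
  obtain ⟨σ₀, hσ₀, h0⟩ := exists_stripLog_eq (-(|R| + 1))
  have hR := le_abs_self R
  have hn := abs_nonneg R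
  refine ⟨σ₀, hσ₀.1, ?_⟩
  have key : ∀ σ ∈ Ioo (0 : ℝ) 2, σ < σ₀ → R < |stripLog σ| := by
    intro σ hσ h
    have := stripLog_strictMonoOn hσ hσ₀ h
    have h2 := neg_le_abs (stripLog σ)
    linarith
  rintro σ hσ (h | h)
  · exact key σ hσ h
  · have := key (2 - σ) ⟨by linarith [hσ.2], by linarith [hσ.1]⟩ (by linarith)
    rwa [stripLog_two_sub, abs_neg] at this

/-- The distance to the nearest odd integer. -/
noncomputable def oddDist (ℓ : ℝ) : ℝ := |2 * Int.fract (ℓ / 2) - 1|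

/-- A periodic odd bump function vanishing at the integers. -/
noncomputable def oddBump (ℓ : ℝ) : ℝ :=
  (2 * Int.fract (ℓ / 2) - 1) * (1 - |2 * Int.fract (ℓ / 2) - 1|)

theorem continuous_oddDist : Continuous oddDist := by
  have h : Continuous ((fun t : ℝ => |2 * t - 1|) ∘ Int.fract) :=
    ContinuousOn.comp_fract'' (Continuous.continuousOn (by fun_prop)) (by norm_num)
  exact h.comp (continuous_id.div_const 2)

theorem continuous_oddBump : Continuous oddBump := by
  have h : Continuous ((fun t : ℝ => (2 * t - 1) * (1 - |2 * t - 1|)) ∘ Int.fract) :=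
    ContinuousOn.comp_fract'' (Continuous.continuousOn (by fun_prop)) (by norm_num)
  exact h.comp (continuous_id.div_const 2)

theorem fract_half_eq (m : ℤ) {c : ℝ} (hc : |c| ≤ 1) (hc1 : c ≠ 1) :
    2 * Int.fract ((2 * m + 1 + c) / 2) - 1 = c := by
  have h := abs_le.1 hc
  have hlt := lt_of_le_of_ne h.2 hc1
  have : (2 * (m : ℝ) + 1 + c) / 2 = m + (1 + c) / 2 := by ring
  rw [this, Int.fract_intCast_add, Int.fract_eq_self.2 ⟨by linarith, by linarith⟩]
  ring

theorem fract_half_eq_neg_one (m : ℤ) : 2 * Int.fract ((2 * (m : ℝ) + 1 + 1) / 2) - 1 = -1 := by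
  have : (2 * (m : ℝ) + 1 + 1) / 2 = ((m + 1 : ℤ) : ℝ) := by push_cast; ring
  rw [this, Int.fract_intCast]
  norm_num

theorem oddDist_eq (m : ℤ) {c : ℝ} (hc : |c| ≤ 1) : oddDist (2 * m + 1 + c) = |c| := by
  by_cases h : c = 1
  · subst h
    rw [oddDist, fract_half_eq_neg_one, abs_neg]
  · rw [oddDist, fract_half_eq m hc h]

theorem oddBump_eq (m : ℤ) {c : ℝ} (hc : |c| ≤ 1) : oddBump (2 * m + 1 + c) = c * (1 - |c|) := by
  by_cases h : c = 1
  · subst h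
    rw [oddBump, fract_half_eq_neg_one, abs_neg, abs_one]
    ring
  · rw [oddBump, fract_half_eq m hc h]

/-- The strip `ℝ × [-1, 1]` is mapped to the sphere by folding every segment of its boundary
between two consecutive even integers, the even integers of the boundary going to infinity. -/
noncomputable def stripFold (ℓ τ : ℝ) : OnePoint (ℝ × ℝ) :=
  planeRatio (ℓ * (1 - oddDist ℓ * |τ|) - |τ| * oddBump ℓ, τ) (1 - oddDist ℓ * |τ|)

theorem stripFold_eq (m : ℤ) {c : ℝ} (τ : ℝ) (hc : |c| ≤ 1) :
    stripFold (2 * m + 1 + c) τ =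
      planeRatio ((2 * m + 1) * (1 - |c| * |τ|) + c * (1 - |τ|), τ) (1 - |c| * |τ|) := by
  rw [stripFold, oddDist_eq m hc, oddBump_eq m hc]
  congr 2
  ring

theorem exists_strip_coord (ℓ : ℝ) :
    ∃ (m : ℤ) (c : ℝ), |c| ≤ 1 ∧ c < 1 ∧ ℓ = 2 * m + 1 + c := by
  refine ⟨⌊ℓ / 2⌋, 2 * Int.fract (ℓ / 2) - 1, ?_, ?_, ?_⟩
  · have h1 := Int.fract_nonneg (ℓ / 2)
    have h2 := Int.fract_lt_one (ℓ / 2)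
    rw [abs_le]
    constructor <;> linarith
  · linarith [Int.fract_lt_one (ℓ / 2)]
  · have := Int.floor_add_fract (ℓ / 2)
    linarith

theorem continuous_stripFold : Continuous fun p : ℝ × ℝ => stripFold p.1 p.2 := by
  have h1 := continuous_oddDist
  have h2 := continuous_oddBump
  rw [continuous_iff_continuousAt]
  intro p
  have hu : Continuous fun p : ℝ × ℝ =>
    (p.1 * (1 - oddDist p.1 * |p.2|) - |p.2| * oddBump p.1, p.2) := by fun_prop
  have hD : Continuous fun p : ℝ × ℝ => 1 - oddDist p.1 * |p.2| := by fun_prop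
  refine tendsto_planeRatio (hu.tendsto p) (hD.tendsto p) ?_
  by_cases h : p.2 = 0
  · left; simp [h]
  · right
    intro h'
    exact h (congrArg Prod.snd h')

theorem map_planeRatio (L : (ℝ × ℝ) →ₗ[ℝ] (ℝ × ℝ)) (u : ℝ × ℝ) (D : ℝ) :
    OnePoint.map L (planeRatio u D) = planeRatio (L u) D := by
  by_cases h : D = 0
  · subst h; simp
  · rw [planeRatio_of_ne h, planeRatio_of_ne h, OnePoint.map_some, map_smul]

/-- Reflection of the plane in the first axis. -/
def reflectSnd : (ℝ × ℝ) ≃L[ℝ] (ℝ × ℝ) :=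
  (ContinuousLinearEquiv.refl ℝ ℝ).prodCongr (ContinuousLinearEquiv.neg ℝ)

@[simp] theorem reflectSnd_apply (v : ℝ × ℝ) : reflectSnd v = (v.1, -v.2) := rfl

theorem stripFold_neg_right (ℓ τ : ℝ) :
    stripFold ℓ (-τ) = OnePoint.map reflectSnd (stripFold ℓ τ) := by
  have := map_planeRatio (reflectSnd : (ℝ × ℝ) →ₗ[ℝ] (ℝ × ℝ))
    (ℓ * (1 - oddDist ℓ * |τ|) - |τ| * oddBump ℓ, τ) (1 - oddDist ℓ * |τ|)
  rw [stripFold, stripFold, abs_neg]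
  exact this.symm

theorem stripFold_neg_neg (ℓ τ : ℝ) :
    stripFold (-ℓ) (-τ) = OnePoint.map (ContinuousLinearEquiv.neg ℝ : (ℝ × ℝ) ≃L[ℝ] (ℝ × ℝ))
      (stripFold ℓ τ) := by
  obtain ⟨m, c, hc, -, rfl⟩ := exists_strip_coord ℓ
  have e : -(2 * (m : ℝ) + 1 + c) = 2 * ((-m - 1 : ℤ) : ℝ) + 1 + -c := by push_cast; ring
  have := map_planeRatio
    ((ContinuousLinearEquiv.neg ℝ : (ℝ × ℝ) ≃L[ℝ] (ℝ × ℝ)) : (ℝ × ℝ) →ₗ[ℝ] (ℝ × ℝ))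
    ((2 * m + 1) * (1 - |c| * |τ|) + c * (1 - |τ|), τ) (1 - |c| * |τ|)
  rw [e, stripFold_eq _ _ (by rwa [abs_neg]), stripFold_eq _ _ hc, abs_neg, abs_neg]
  refine Eq.trans ?_ this.symm
  congr 1
  refine Prod.ext ?_ rfl
  change _ = - _
  push_cast
  ring

theorem stripFold_partner (m : ℤ) {c τ : ℝ} (hc : |c| ≤ 1) (hτ : |τ| = 1) :
    stripFold (2 * m + 1 - c) τ = stripFold (2 * m + 1 + c) τ := by
  rw [sub_eq_add_neg, stripFold_eq m τ hc, stripFold_eq m τ (by rwa [abs_neg]), abs_neg, hτ]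
  congr 2
  ring

theorem stripFold_eq_infty_iff (m : ℤ) {c τ : ℝ} (hc : |c| ≤ 1) (hτ : |τ| ≤ 1) :
    stripFold (2 * m + 1 + c) τ = OnePoint.infty ↔ |c| = 1 ∧ |τ| = 1 := by
  rw [stripFold_eq m τ hc, planeRatio_eq_infty_iff]
  constructor
  · intro h
    have h1 : |c| * |τ| ≤ |c| := mul_le_of_le_one_right (abs_nonneg _) hτ
    have h2 : |c| * |τ| ≤ |τ| := mul_le_of_le_one_left (abs_nonneg _) hc
    exact ⟨by linarith, by linarith⟩
  · rintro ⟨h1, h2⟩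
    rw [h1, h2]; norm_num

theorem columnDen_pos {c τ : ℝ} (hc : |c| ≤ 1) (hτ : |τ| ≤ 1) (h : ¬(|c| = 1 ∧ |τ| = 1)) :
    0 < 1 - |c| * |τ| := by
  have h1 : |c| * |τ| ≤ |c| := mul_le_of_le_one_right (abs_nonneg _) hτ
  have h2 : |c| * |τ| ≤ |τ| := mul_le_of_le_one_left (abs_nonneg _) hc
  rcases (sub_nonneg.2 (h1.trans hc)).eq_or_lt with h3 | h3
  · exact absurd ⟨by linarith, by linarith⟩ h
  · exact h3

theorem stripFold_eq_coe (m : ℤ) {c τ : ℝ} (hc : |c| ≤ 1) (h : 0 < 1 - |c| * |τ|) :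
    stripFold (2 * m + 1 + c) τ = ((2 * m + 1 + c * (1 - |τ|) / (1 - |c| * |τ|),
      τ / (1 - |c| * |τ|)) : ℝ × ℝ) := by
  rw [stripFold_eq m τ hc, planeRatio_of_ne h.ne']
  congr 1
  refine Prod.ext ?_ ?_
  · simp only [Prod.smul_mk, smul_eq_mul]
    field_simp
  · simp only [Prod.smul_mk, smul_eq_mul]
    field_simp

theorem abs_column_le {c τ : ℝ} (hc : |c| ≤ 1) (hτ : |τ| ≤ 1) (h : 0 < 1 - |c| * |τ|) :
    |c * (1 - |τ|) / (1 - |c| * |τ|)| ≤ |c| := by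
  rw [abs_div, abs_mul, abs_of_pos h, div_le_iff₀ h, abs_of_nonneg (sub_nonneg.2 hτ)]
  refine mul_le_mul_of_nonneg_left ?_ (abs_nonneg _)
  have : |c| * |τ| ≤ |τ| := mul_le_of_le_one_left (abs_nonneg _) hc
  linarith

theorem abs_le_of_stripFold_eq {ℓ τ : ℝ} {v : ℝ × ℝ} (hτ : |τ| ≤ 1) (h : stripFold ℓ τ = v) :
    |ℓ| ≤ ‖v‖ + 2 := by
  obtain ⟨m, c, hc, -, rfl⟩ := exists_strip_coord ℓ
  have hD : 0 < 1 - |c| * |τ| := columnDen_pos hc hτ fun h' => by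
    rw [(stripFold_eq_infty_iff m hc hτ).2 h'] at h
    exact OnePoint.infty_ne_coe _ h
  rw [stripFold_eq_coe m hc hD, OnePoint.coe_eq_coe] at h
  have h1 : |v.1| ≤ ‖v‖ := norm_fst_le v
  rw [← h] at h1 ⊢
  have h2 := (abs_column_le hc hτ hD).trans hc
  simp only at h1
  rw [abs_le] at h1 h2 hc ⊢
  constructor <;> linarith [h1.1, h1.2, h2.1, h2.2, hc.1, hc.2]

theorem column_inj_nonneg {p t p' t' : ℝ} (hp : 0 ≤ p) (hp' : 0 ≤ p')
    (ht : 0 ≤ t) (ht1 : t ≤ 1) (ht1' : t' ≤ 1)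
    (hD : 0 < 1 - p * t) (hD' : 0 < 1 - p' * t')
    (h1 : p * (1 - t) / (1 - p * t) = p' * (1 - t') / (1 - p' * t'))
    (h2 : t / (1 - p * t) = t' / (1 - p' * t')) : p = p' ∧ t = t' := by
  obtain ⟨w, hw⟩ : ∃ w, w = t / (1 - p * t) := ⟨_, rfl⟩
  obtain ⟨A, hA⟩ : ∃ A, A = p * (1 - t) / (1 - p * t) := ⟨_, rfl⟩
  rw [← hw] at h2
  rw [← hA] at h1
  have key : ∀ p t : ℝ, 0 < 1 - p * t → t ≤ 1 → w = t / (1 - p * t) →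
      A = p * (1 - t) / (1 - p * t) →
      A = p * (1 + p * w - w) ∧ 0 ≤ 1 + p * w - w ∧ t * (1 + p * w) = w := by
    intro p t hD ht hw hA
    have e : 1 + p * w - w = (1 - t) / (1 - p * t) := by
      rw [hw]; field_simp; ring
    refine ⟨by rw [e, hA]; ring, by rw [e]; exact div_nonneg (by linarith) hD.le, ?_⟩
    have e2 : w * (1 - p * t) = t := by rw [hw]; exact div_mul_cancel₀ _ hD.ne'
    linear_combination -e2
  have hw0 : 0 ≤ w := by rw [hw]; exact div_nonneg ht hD.le
  obtain ⟨a1, a2, a3⟩ := key p t hD ht1 hw hA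
  obtain ⟨b1, b2, b3⟩ := key p' t' hD' ht1' h2 h1
  have lt_aux : ∀ p p' : ℝ, 0 ≤ p → p < p' → 0 ≤ 1 + p * w - w →
      p * (1 + p * w - w) < p' * (1 + p' * w - w) := by
    intro p p' hp h h0
    have e : p' * (1 + p' * w - w) - p * (1 + p * w - w) =
      (p' - p) * ((1 + p * w - w) + p' * w) := by ring
    have : 0 < (1 + p * w - w) + p' * w := by
      rcases hw0.eq_or_lt with h | h
      · rw [← h]; norm_num
      · have := mul_pos (hp.trans_lt ‹p < p'›) h
        linarith
    have := mul_pos (sub_pos.2 h) this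
    linarith
  have hpp : p = p' := by
    rcases lt_trichotomy p p' with h | h | h
    · exact absurd (a1.symm.trans b1) (lt_aux p p' hp h a2).ne
    · exact h
    · exact absurd (b1.symm.trans a1) (lt_aux p' p hp' h b2).ne
  refine ⟨hpp, ?_⟩
  subst hpp
  have : 0 < 1 + p * w := by positivity
  exact mul_right_cancel₀ this.ne' (a3.trans b3.symm)

theorem stripFold_fiber {ℓ τ ℓ' τ' : ℝ} (hτ : |τ| ≤ 1) (hτ' : |τ'| ≤ 1)
    (h : stripFold ℓ τ = stripFold ℓ' τ') (hfin : stripFold ℓ τ ≠ OnePoint.infty) :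
    τ = τ' ∧ (ℓ = ℓ' ∨ |τ| = 1 ∧ ∃ (m : ℤ) (c : ℝ), |c| < 1 ∧ ℓ = 2 * m + 1 + c ∧
      ℓ' = 2 * m + 1 - c) := by
  obtain ⟨m, c, hc, hc1, rfl⟩ := exists_strip_coord ℓ
  obtain ⟨m', c', hc', hc1', rfl⟩ := exists_strip_coord ℓ'
  have hD : 0 < 1 - |c| * |τ| := columnDen_pos hc hτ fun h' =>
    hfin ((stripFold_eq_infty_iff m hc hτ).2 h')
  have hD' : 0 < 1 - |c'| * |τ'| := columnDen_pos hc' hτ' fun h' =>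
    hfin (h.trans ((stripFold_eq_infty_iff m' hc' hτ').2 h'))
  rw [stripFold_eq_coe m hc hD, stripFold_eq_coe m' hc' hD', OnePoint.coe_eq_coe,
    Prod.mk.injEq] at h
  obtain ⟨h1, h2⟩ := h
  have bound : ∀ c τ : ℝ, |c| ≤ 1 → c < 1 → |τ| ≤ 1 → 0 < 1 - |c| * |τ| →
      -1 ≤ c * (1 - |τ|) / (1 - |c| * |τ|) ∧ c * (1 - |τ|) / (1 - |c| * |τ|) < 1 := by
    intro c τ hc hc1 hτ hD
    have h := abs_column_le hc hτ hD
    refine ⟨by linarith [(abs_le.1 h).1], ?_⟩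
    rcases lt_or_ge c 0 with h0 | h0
    · refine lt_of_le_of_lt ?_ one_pos
      exact div_nonpos_of_nonpos_of_nonneg
        (mul_nonpos_of_nonpos_of_nonneg h0.le (sub_nonneg.2 hτ)) hD.le
    · have := abs_of_nonneg h0
      linarith [(abs_le.1 h).2]
  obtain ⟨x1, x2⟩ := bound c τ hc hc1 hτ hD
  obtain ⟨y1, y2⟩ := bound c' τ' hc' hc1' hτ' hD'
  have hm : m = m' := by
    have a1 : (m : ℝ) < m' + 1 := by linarith
    have a2 : (m' : ℝ) < m + 1 := by linarith
    have a1' : m < m' + 1 := by exact_mod_cast a1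
    have a2' : m' < m + 1 := by exact_mod_cast a2
    omega
  subst hm
  have h1' : c * (1 - |τ|) / (1 - |c| * |τ|) = c' * (1 - |τ'|) / (1 - |c'| * |τ'|) := by linarith
  obtain ⟨e1, e2⟩ := column_inj_nonneg (abs_nonneg c) (abs_nonneg c') (abs_nonneg τ)
    hτ hτ' hD hD'
    (by
      have := congrArg abs h1'
      rwa [abs_div, abs_div, abs_mul, abs_mul, abs_of_pos hD, abs_of_pos hD',
        abs_of_nonneg (sub_nonneg.2 hτ), abs_of_nonneg (sub_nonneg.2 hτ')] at this)
    (by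
      have := congrArg abs h2
      rwa [abs_div, abs_div, abs_of_pos hD, abs_of_pos hD'] at this)
  rw [← e1, ← e2] at h2 h1'
  have hττ : τ = τ' := (div_left_inj' hD.ne').1 h2
  refine ⟨hττ, ?_⟩
  have h3 : c * (1 - |τ|) = c' * (1 - |τ|) := (div_left_inj' hD.ne').1 h1'
  rcases abs_eq_abs.1 e1 with h4 | h4
  · left; rw [h4]
  · by_cases h5 : |τ| = 1
    · right
      refine ⟨h5, m, c, lt_of_le_of_ne hc fun h6 => ?_, rfl, by rw [h4]; ring⟩
      rw [h6, h5] at hD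
      norm_num at hD
    · left
      rw [mul_right_cancel₀ (sub_ne_zero.2 (Ne.symm h5)) h3]

theorem exists_stripFold_eq (z : OnePoint (ℝ × ℝ)) : ∃ ℓ τ : ℝ, |τ| ≤ 1 ∧ stripFold ℓ τ = z := by
  induction z using OnePoint.rec with
  | infty =>
    refine ⟨2 * ((0 : ℤ) : ℝ) + 1 + 1, 1, by simp, ?_⟩
    rw [stripFold_eq_infty_iff 0 (by simp) (by simp)]
    simp
  | coe v =>
    obtain ⟨m, X, hX, -, hm⟩ := exists_strip_coord v.1
    obtain ⟨w, hw⟩ : ∃ w, w = |v.2| := ⟨_, rfl⟩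
    have hw0 : 0 ≤ w := hw ▸ abs_nonneg _
    obtain ⟨p, hp0, hp1, hpw, hpA⟩ : ∃ p : ℝ, 0 ≤ p ∧ p ≤ 1 ∧ 0 ≤ 1 + p * w - w ∧
        p * (1 + p * w - w) = |X| := by
      rcases hw0.eq_or_lt with hw1 | hw1
      · refine ⟨|X|, abs_nonneg _, hX, ?_, ?_⟩ <;> rw [← hw1] <;> norm_num
      have hc : ContinuousOn (fun p : ℝ => p * (1 + p * w - w)) (Icc (max 0 (1 - 1 / w)) 1) :=
        Continuous.continuousOn (by fun_prop)
      have hle : max 0 (1 - 1 / w) ≤ 1 :=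
        max_le zero_le_one (sub_le_self _ (div_nonneg zero_le_one hw0))
      have hlow : ∀ p, max 0 (1 - 1 / w) ≤ p → 0 ≤ 1 + p * w - w := by
        intro p hp
        rcases hw0.eq_or_lt with h | h
        · rw [← h]; norm_num
        · have h1 := (le_max_right 0 (1 - 1 / w)).trans hp
          have h2 := mul_le_mul_of_nonneg_right h1 hw0
          have h3 : (1 - 1 / w) * w = w - 1 := by field_simp
          linarith
      have hmem : |X| ∈ Icc ((fun p : ℝ => p * (1 + p * w - w)) (max 0 (1 - 1 / w)))
          ((fun p : ℝ => p * (1 + p * w - w)) 1) := by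
        constructor
        · refine le_trans (le_of_eq ?_) (abs_nonneg X)
          simp only
          rcases le_total (1 - 1 / w) 0 with h | h
          · rw [max_eq_left h, zero_mul]
          · rw [max_eq_right h]
            field_simp
            ring
        · simp only
          linarith
      obtain ⟨p, ⟨hp, hp'⟩, hpA⟩ := intermediate_value_Icc hle hc hmem
      exact ⟨p, (le_max_left _ _).trans hp, hp', hlow p hp, hpA⟩
    have hpos : 0 < 1 + p * w := by positivity
    have ht1 : w / (1 + p * w) ≤ 1 := (div_le_one hpos).2 (by linarith)
    have ht0 : 0 ≤ w / (1 + p * w) := by positivity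
    have hD : 1 - p * (w / (1 + p * w)) = 1 / (1 + p * w) := by field_simp; ring
    have hsign : ∀ x : ℝ, ∃ ε : ℝ, |ε| = 1 ∧ ε * |x| = x := by
      intro x
      rcases le_total 0 x with h | h
      · exact ⟨1, by simp, by rw [abs_of_nonneg h, one_mul]⟩
      · exact ⟨-1, by simp, by rw [abs_of_nonpos h]; ring⟩
    obtain ⟨ε, hε, hεX⟩ := hsign X
    obtain ⟨η, hη, hηv⟩ := hsign v.2
    have hcabs : |ε * p| = p := by rw [abs_mul, hε, one_mul, abs_of_nonneg hp0]
    have htabs : |η * (w / (1 + p * w))| = w / (1 + p * w) := by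
      rw [abs_mul, hη, one_mul, abs_of_nonneg ht0]
    refine ⟨2 * m + 1 + ε * p, η * (w / (1 + p * w)), htabs.trans_le ht1, ?_⟩
    rw [stripFold_eq_coe m (hcabs.trans_le hp1) (by rw [hcabs, htabs, hD]; positivity),
      OnePoint.coe_eq_coe, hcabs, htabs, hD]
    refine Prod.ext ?_ ?_
    · rw [hm, ← hεX, ← hpA]
      simp only
      field_simp
    · rw [← hηv, ← hw]
      simp only
      field_simp

/-- The transverse coordinate of the unit square with respect to its main diagonal. -/
noncomputable def squareTau (q : ℝ × ℝ) : ℝ := (q.1 - q.2) / min (q.1 + q.2) (2 - (q.1 + q.2))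

open Classical in
/-- The unit square is mapped onto the sphere by folding countably many segments of its boundary,
the end points of these segments going to infinity. -/
noncomputable def squareFold (q : ℝ × ℝ) : OnePoint (ℝ × ℝ) :=
  if q.1 + q.2 ∈ Ioo 0 2 then stripFold (stripLog (q.1 + q.2)) (squareTau q) else OnePoint.infty

/-- The unit square. -/
def unitSquare : Set (ℝ × ℝ) := Icc 0 1 ×ˢ Icc 0 1

theorem isCompact_unitSquare : IsCompact unitSquare := isCompact_Icc.prod isCompact_Icc

theorem squareFold_of_mem {q : ℝ × ℝ} (h : q.1 + q.2 ∈ Ioo (0 : ℝ) 2) :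
    squareFold q = stripFold (stripLog (q.1 + q.2)) (squareTau q) := if_pos h

theorem squareTau_swap (x y : ℝ) : squareTau (y, x) = -squareTau (x, y) := by
  simp only [squareTau]
  rw [add_comm y x, ← neg_div, neg_sub]

theorem squareTau_rotate (x y : ℝ) : squareTau (1 - x, 1 - y) = -squareTau (x, y) := by
  simp only [squareTau]
  rw [← neg_div, min_comm]
  congr 1
  · ring
  · congr 1 <;> ring

theorem squareFold_swap (x y : ℝ) :
    squareFold (y, x) = OnePoint.map reflectSnd (squareFold (x, y)) := by
  by_cases h : x + y ∈ Ioo (0 : ℝ) 2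
  · have h' : y + x ∈ Ioo (0 : ℝ) 2 := by rwa [add_comm]
    rw [squareFold_of_mem h', squareFold_of_mem h, squareTau_swap, stripFold_neg_right]
    simp only
    rw [add_comm]
  · have h' : y + x ∉ Ioo (0 : ℝ) 2 := by rwa [add_comm]
    rw [squareFold, squareFold, if_neg h', if_neg h, OnePoint.map_infty]

theorem squareFold_rotate (x y : ℝ) :
    squareFold (1 - x, 1 - y) = OnePoint.map (ContinuousLinearEquiv.neg ℝ :
      (ℝ × ℝ) ≃L[ℝ] (ℝ × ℝ)) (squareFold (x, y)) := by
  have e : 1 - x + (1 - y) = 2 - (x + y) := by ring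
  by_cases h : x + y ∈ Ioo (0 : ℝ) 2
  · have h' : 1 - x + (1 - y) ∈ Ioo (0 : ℝ) 2 := by
      rw [e]; exact ⟨by linarith [h.2], by linarith [h.1]⟩
    rw [squareFold_of_mem h', squareFold_of_mem h, squareTau_rotate, ← stripFold_neg_neg,
      ← stripLog_two_sub]
    simp only
    rw [e]
  · have h' : 1 - x + (1 - y) ∉ Ioo (0 : ℝ) 2 := by
      rw [e]
      exact fun h' => h ⟨by linarith [h'.2], by linarith [h'.1]⟩
    rw [squareFold, squareFold, if_neg h', if_neg h, OnePoint.map_infty]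

theorem onePoint_map_injective (L : (ℝ × ℝ) ≃L[ℝ] (ℝ × ℝ)) :
    Function.Injective (OnePoint.map L) :=
  (Homeomorph.onePointCongr L.toHomeomorph).injective

theorem squareFold_swap_eq_iff {x y x' y' : ℝ} :
    squareFold (y, x) = squareFold (y', x') ↔ squareFold (x, y) = squareFold (x', y') := by
  rw [squareFold_swap, squareFold_swap x' y', (onePoint_map_injective _).eq_iff]

theorem squareFold_rotate_eq_iff {x y x' y' : ℝ} :
    squareFold (1 - x, 1 - y) = squareFold (1 - x', 1 - y') ↔
      squareFold (x, y) = squareFold (x', y') := by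
  rw [squareFold_rotate, squareFold_rotate x' y', (onePoint_map_injective _).eq_iff]

theorem squareFold_swap_eq_infty_iff {x y : ℝ} :
    squareFold (y, x) = OnePoint.infty ↔ squareFold (x, y) = OnePoint.infty := by
  rw [squareFold_swap, ← OnePoint.map_infty reflectSnd, (onePoint_map_injective _).eq_iff,
    OnePoint.map_infty]

theorem squareFold_rotate_eq_infty_iff {x y : ℝ} :
    squareFold (1 - x, 1 - y) = OnePoint.infty ↔ squareFold (x, y) = OnePoint.infty := by
  rw [squareFold_rotate, ← OnePoint.map_infty (ContinuousLinearEquiv.neg ℝ :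
      (ℝ × ℝ) ≃L[ℝ] (ℝ × ℝ)), (onePoint_map_injective _).eq_iff, OnePoint.map_infty]

theorem abs_squareTau_le {q : ℝ × ℝ} (hq : q ∈ unitSquare) (h : q.1 + q.2 ∈ Ioo (0 : ℝ) 2) :
    |squareTau q| ≤ 1 := by
  obtain ⟨⟨h1, h2⟩, h3, h4⟩ := hq
  have hm : 0 < min (q.1 + q.2) (2 - (q.1 + q.2)) := lt_min h.1 (by linarith [h.2])
  rw [squareTau, abs_div, abs_of_pos hm, div_le_one hm, abs_le, neg_le, le_min_iff, le_min_iff]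
  refine ⟨⟨?_, ?_⟩, ?_, ?_⟩ <;> linarith

theorem continuousAt_squareFold_of_mem {q : ℝ × ℝ} (h : q.1 + q.2 ∈ Ioo (0 : ℝ) 2) :
    ContinuousAt squareFold q := by
  have hadd : Continuous fun q : ℝ × ℝ => q.1 + q.2 := by fun_prop
  have hev : ∀ᶠ p : ℝ × ℝ in 𝓝 q, p.1 + p.2 ∈ Ioo (0 : ℝ) 2 :=
    hadd.continuousAt.eventually (isOpen_Ioo.mem_nhds h)
  have hlog : ContinuousAt (fun p : ℝ × ℝ => stripLog (p.1 + p.2)) q :=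
    ContinuousAt.comp (f := fun p : ℝ × ℝ => p.1 + p.2)
      (continuousOn_stripLog.continuousAt (isOpen_Ioo.mem_nhds h)) hadd.continuousAt
  have hm : 0 < min (q.1 + q.2) (2 - (q.1 + q.2)) := lt_min h.1 (by linarith [h.2])
  have htau : ContinuousAt squareTau q := by
    refine ContinuousAt.div ?_ ?_ hm.ne' <;> exact Continuous.continuousAt (by fun_prop)
  have := (continuous_stripFold.continuousAt (x := (stripLog (q.1 + q.2), squareTau q))).comp
    (f := fun p : ℝ × ℝ => (stripLog (p.1 + p.2), squareTau p)) (hlog.prodMk htau)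
  refine this.congr ?_
  filter_upwards [hev] with p hp
  exact (squareFold_of_mem hp).symm

theorem continuousOn_squareFold : ContinuousOn squareFold unitSquare := by
  intro q hq
  by_cases h : q.1 + q.2 ∈ Ioo (0 : ℝ) 2
  · exact (continuousAt_squareFold_of_mem h).continuousWithinAt
  have hval : squareFold q = OnePoint.infty := if_neg h
  rw [ContinuousWithinAt, hval]
  refine tendsto_nhds_infty_of_norm fun R => ?_
  obtain ⟨ε, hε, H⟩ := eventually_lt_abs_stripLog (R + 2)
  have hadd : Continuous fun q : ℝ × ℝ => q.1 + q.2 := by fun_prop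
  have hopen : IsOpen {t : ℝ | t < ε ∨ 2 - ε < t} :=
    (isOpen_Iio (a := ε)).union (isOpen_Ioi (a := 2 - ε))
  have hmem : q.1 + q.2 ∈ {t : ℝ | t < ε ∨ 2 - ε < t} := by
    obtain ⟨⟨h1, h2⟩, h3, h4⟩ := hq
    rw [mem_Ioo, not_and_or] at h
    rcases h with h | h
    · left; linarith
    · right; linarith
  have hev : ∀ᶠ p : ℝ × ℝ in 𝓝 q, p.1 + p.2 ∈ {t : ℝ | t < ε ∨ 2 - ε < t} :=
    hadd.continuousAt.eventually (hopen.mem_nhds hmem)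
  filter_upwards [nhdsWithin_le_nhds hev, self_mem_nhdsWithin] with p hp hpQ v hv
  by_cases hp2 : p.1 + p.2 ∈ Ioo (0 : ℝ) 2
  · rw [squareFold_of_mem hp2] at hv
    have h1 := abs_le_of_stripFold_eq (abs_squareTau_le hpQ hp2) hv
    have h2 := H _ hp2 hp
    linarith
  · rw [squareFold, if_neg hp2] at hv
    exact absurd hv (OnePoint.infty_ne_coe _)

theorem exists_squareFold_eq (z : OnePoint (ℝ × ℝ)) : ∃ q ∈ unitSquare, squareFold q = z := by
  obtain ⟨ℓ, τ, hτ, rfl⟩ := exists_stripFold_eq z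
  obtain ⟨σ, hσ, rfl⟩ := exists_stripLog_eq ℓ
  have hm : 0 < min σ (2 - σ) := lt_min hσ.1 (by linarith [hσ.2])
  have h1 := min_le_left σ (2 - σ)
  have h2 := min_le_right σ (2 - σ)
  have h3 : |τ * min σ (2 - σ)| ≤ min σ (2 - σ) := by
    rw [abs_mul, abs_of_pos hm]
    exact mul_le_of_le_one_left hm.le hτ
  rw [abs_le] at h3
  obtain ⟨h4, h5⟩ := h3
  have e : (σ + τ * min σ (2 - σ)) / 2 + (σ - τ * min σ (2 - σ)) / 2 = σ := by ring
  refine ⟨((σ + τ * min σ (2 - σ)) / 2, (σ - τ * min σ (2 - σ)) / 2),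
    ⟨⟨?_, ?_⟩, ?_, ?_⟩, ?_⟩
  · simp only; linarith
  · simp only; linarith
  · simp only; linarith
  · simp only; linarith
  · rw [squareFold_of_mem (by simp only; rwa [e]), squareTau]
    simp only
    rw [e]
    congr 1
    rw [div_eq_iff hm.ne']
    ring

theorem stripLog_piece (n : ℕ) {c : ℝ} (hc : |c| ≤ 1) :
    stripLog ((2 + c) / 3 ^ (n + 1)) = 2 * ((-n - 1 : ℤ) : ℝ) + 1 + c := by
  obtain ⟨h1, h2⟩ := abs_le.1 hc
  have h3 : (0 : ℝ) < 3 ^ n := by positivity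
  have h3' : (1 : ℝ) ≤ 3 ^ n := one_le_pow₀ (by norm_num)
  have hpos : 0 < (2 + c) / 3 ^ (n + 1) := div_pos (by linarith) (by positivity)
  have hle : (2 + c) / 3 ^ (n + 1) ≤ 1 := by
    rw [div_le_one (by positivity), pow_succ]; linarith
  have e : 3 ^ (n + 1) * ((2 + c) / 3 ^ (n + 1)) = 2 + c := by field_simp
  rw [stripLog_of_le hle, foldLog_eq (n := n) hpos (by rw [e]; linarith) ?_, logPiece, e]
  · push_cast; ring
  · have e' : 3 ^ n * ((2 + c) / 3 ^ (n + 1)) = (2 + c) / 3 := by field_simp; ring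
    linarith

theorem piece_mem (n : ℕ) {c : ℝ} (hc : |c| ≤ 1) : (2 + c) / 3 ^ (n + 1) ∈ Ioc (0 : ℝ) 1 := by
  obtain ⟨h1, h2⟩ := abs_le.1 hc
  have h3' : (1 : ℝ) ≤ 3 ^ n := one_le_pow₀ (by norm_num)
  refine ⟨div_pos (by linarith) (by positivity), ?_⟩
  rw [div_le_one (by positivity), pow_succ]; linarith

theorem eq_of_stripLog_eq {σ : ℝ} (hσ : σ ∈ Ioo (0 : ℝ) 2) (n : ℕ) {c : ℝ} (hc : |c| ≤ 1)
    (h : stripLog σ = 2 * ((-n - 1 : ℤ) : ℝ) + 1 + c) : σ = (2 + c) / 3 ^ (n + 1) := by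
  obtain ⟨h1, h2⟩ := piece_mem n hc
  exact stripLog_strictMonoOn.injOn hσ ⟨h1, by linarith⟩ (h.trans (stripLog_piece n hc).symm)

theorem eq_of_stripLog_eq_nonneg {σ : ℝ} (hσ : σ ∈ Ioo (0 : ℝ) 2) (n : ℕ) {c : ℝ} (hc : |c| ≤ 1)
    (h : stripLog σ = 2 * (n : ℝ) + 1 + c) : 2 - σ = (2 - c) / 3 ^ (n + 1) := by
  have := eq_of_stripLog_eq (σ := 2 - σ) ⟨by linarith [hσ.2], by linarith [hσ.1]⟩ n (c := -c)
    (by rwa [abs_neg]) (by rw [stripLog_two_sub, h]; push_cast; ring)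
  rw [this]; ring

/-- Two numbers in the unit interval are partners if they are symmetric with respect to the middle
of a triadic interval `[3⁻ⁿ⁻¹, 3⁻ⁿ]`. -/
def TriadicPartner (t t' : ℝ) : Prop :=
  ∃ (n : ℕ) (c : ℝ), |c| < 1 ∧ t = (2 + c) / 3 ^ (n + 1) ∧ t' = (2 - c) / 3 ^ (n + 1)

/-- A number is a triadic end point if it is zero or `3⁻ⁿ`. -/
def TriadicEnd (t : ℝ) : Prop := t = 0 ∨ ∃ n : ℕ, t = 1 / 3 ^ n

theorem squareTau_eq_one_of_le {q : ℝ × ℝ} (h : q.1 + q.2 ∈ Ioc (0 : ℝ) 1) :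
    (squareTau q = 1 ↔ q.2 = 0) ∧ (squareTau q = -1 ↔ q.1 = 0) := by
  rw [squareTau, min_eq_left (by linarith [h.2]), div_eq_iff h.1.ne', div_eq_iff h.1.ne']
  constructor <;> constructor <;> intro h <;> linarith

theorem squareTau_eq_one_of_ge {q : ℝ × ℝ} (h : q.1 + q.2 ∈ Ico (1 : ℝ) 2) :
    (squareTau q = 1 ↔ q.1 = 1) ∧ (squareTau q = -1 ↔ q.2 = 1) := by
  have h0 : 2 - (q.1 + q.2) ≠ 0 := (sub_pos.2 h.2).ne'
  rw [squareTau, min_eq_right (by linarith [h.1]), div_eq_iff h0, div_eq_iff h0]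
  constructor <;> constructor <;> intro h <;> linarith

theorem squareFold_bottom_partner (n : ℕ) {c : ℝ} (hc : |c| ≤ 1) :
    squareFold ((2 + c) / 3 ^ (n + 1), 0) = squareFold ((2 - c) / 3 ^ (n + 1), 0) := by
  have key : ∀ c : ℝ, |c| ≤ 1 → squareFold ((2 + c) / 3 ^ (n + 1), 0) =
      stripFold (2 * ((-n - 1 : ℤ) : ℝ) + 1 + c) 1 := by
    intro c hc
    obtain ⟨h1, h2⟩ := piece_mem n hc
    rw [squareFold_of_mem (by simp only [add_zero]; exact ⟨h1, by linarith⟩)]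
    rw [(squareTau_eq_one_of_le (by simp only [add_zero]; exact ⟨h1, h2⟩)).1.2 rfl]
    simp only [add_zero]
    rw [stripLog_piece n hc]
  rw [key c hc, ← stripFold_partner _ hc abs_one, sub_eq_add_neg 2 c,
    key (-c) (by rwa [abs_neg]), ← sub_eq_add_neg]

theorem TriadicPartner.squareFold_bottom {t t' : ℝ} (h : TriadicPartner t t') :
    squareFold (t, 0) = squareFold (t', 0) := by
  obtain ⟨n, c, hc, rfl, rfl⟩ := h
  exact squareFold_bottom_partner n hc.le

theorem squareFold_eq_infty_iff {x y : ℝ} (hq : (x, y) ∈ unitSquare) :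
    squareFold (x, y) = OnePoint.infty ↔ y = 0 ∧ TriadicEnd x ∨ x = 0 ∧ TriadicEnd y ∨
      x = 1 ∧ TriadicEnd (1 - y) ∨ y = 1 ∧ TriadicEnd (1 - x) := by
  obtain ⟨⟨hx0, hx1⟩, hy0, hy1⟩ := id hq
  simp only at hx0 hx1 hy0 hy1
  have bottom : ∀ x, TriadicEnd x → squareFold (x, 0) = OnePoint.infty := by
    rintro x (rfl | ⟨n, rfl⟩)
    · exact if_neg (by simp)
    · have h1 : (0 : ℝ) < 1 / 3 ^ n := by positivity
      have h2 : (1 : ℝ) / 3 ^ n ≤ 1 := by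
        rw [div_le_one (by positivity)]; exact one_le_pow₀ (by norm_num)
      have e : (1 : ℝ) / 3 ^ n = (2 + 1) / 3 ^ (n + 1) := by field_simp; ring
      rw [squareFold_of_mem (by simp only [add_zero]; exact ⟨h1, by linarith⟩)]
      rw [(squareTau_eq_one_of_le (by simp only [add_zero]; exact ⟨h1, h2⟩)).1.2 rfl]
      simp only [add_zero]
      rw [e, stripLog_piece n (by simp), stripFold_eq_infty_iff _ (by simp) (by simp)]
      simp
  constructor
  · intro h
    by_cases hs : x + y ∈ Ioo (0 : ℝ) 2
    · rw [squareFold_of_mem hs] at h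
      have ht := abs_squareTau_le hq hs
      obtain ⟨m, c, hc, hc1, hm⟩ := exists_strip_coord (stripLog (x + y))
      simp only at h
      rw [hm, stripFold_eq_infty_iff m hc ht] at h
      obtain ⟨h1, h2⟩ := h
      have hc' : c = -1 := by
        rcases (abs_eq zero_le_one).1 h1 with h | h
        · exact absurd h hc1.ne
        · exact h
      subst hc'
      rcases lt_or_ge m 0 with h0 | h0
      · obtain ⟨n, rfl⟩ : ∃ n : ℕ, m = -n - 1 := ⟨(-m - 1).toNat, by omega⟩
        have e := eq_of_stripLog_eq hs n hc hm
        have hE : TriadicEnd (x + y) := Or.inr ⟨n + 1, by rw [e]; norm_num⟩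
        have hle : x + y ≤ 1 := e ▸ (piece_mem n hc).2
        have := squareTau_eq_one_of_le (q := (x, y)) ⟨hs.1, hle⟩
        rcases (abs_eq zero_le_one).1 h2 with h | h
        · have hy := this.1.1 h
          simp only at hy
          subst hy
          exact Or.inl ⟨rfl, by rwa [add_zero] at hE⟩
        · have hx := this.2.1 h
          simp only at hx
          subst hx
          exact Or.inr (Or.inl ⟨rfl, by rwa [zero_add] at hE⟩)
      · obtain ⟨n, rfl⟩ : ∃ n : ℕ, m = n := ⟨m.toNat, by omega⟩
        have e := eq_of_stripLog_eq_nonneg hs n hc (by rw [hm]; push_cast; ring)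
        have hE : TriadicEnd (2 - (x + y)) := Or.inr ⟨n, by rw [e]; field_simp; ring⟩
        have hle : 1 ≤ x + y := by
          have := (piece_mem n (c := 1) (by simp)).2
          norm_num at this e
          linarith
        have := squareTau_eq_one_of_ge (q := (x, y)) ⟨hle, hs.2⟩
        rcases (abs_eq zero_le_one).1 h2 with h | h
        · have hy := this.1.1 h
          simp only at hy
          subst hy
          exact Or.inr (Or.inr (Or.inl ⟨rfl, by convert hE using 1; ring⟩))
        · have hx := this.2.1 h
          simp only at hx
          subst hx
          exact Or.inr (Or.inr (Or.inr ⟨rfl, by convert hE using 1; ring⟩))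
    · rw [mem_Ioo, not_and_or] at hs
      rcases hs with hs | hs
      · left
        exact ⟨by linarith, Or.inl (by linarith)⟩
      · right; right; left
        exact ⟨by linarith, Or.inl (by linarith)⟩
  · rintro (⟨rfl, h⟩ | ⟨rfl, h⟩ | ⟨rfl, h⟩ | ⟨rfl, h⟩)
    · exact bottom x h
    · exact squareFold_swap_eq_infty_iff.1 (bottom y h)
    · have := squareFold_rotate_eq_infty_iff.2 (squareFold_swap_eq_infty_iff.1 (bottom _ h))
      simpa using this
    · have := squareFold_rotate_eq_infty_iff.2 (bottom _ h)
      simpa using this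

theorem squareFold_fiber {x y x' y' : ℝ} (hq : (x, y) ∈ unitSquare) (hq' : (x', y') ∈ unitSquare)
    (h : squareFold (x, y) = squareFold (x', y')) (hfin : squareFold (x, y) ≠ OnePoint.infty) :
    (x = x' ∧ y = y') ∨ (y = 0 ∧ y' = 0 ∧ TriadicPartner x x') ∨
      (x = 0 ∧ x' = 0 ∧ TriadicPartner y y') ∨
      (x = 1 ∧ x' = 1 ∧ TriadicPartner (1 - y) (1 - y')) ∨
      (y = 1 ∧ y' = 1 ∧ TriadicPartner (1 - x) (1 - x')) := by
  have mem : ∀ q : ℝ × ℝ, squareFold q ≠ OnePoint.infty → q.1 + q.2 ∈ Ioo (0 : ℝ) 2 := by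
    intro q hq
    by_contra h
    exact hq (if_neg h)
  have hs := mem _ hfin
  have hs' := mem _ (h ▸ hfin)
  have ht := abs_squareTau_le hq hs
  have ht' := abs_squareTau_le hq' hs'
  simp only at hs hs'
  rw [squareFold_of_mem hs] at h hfin
  rw [squareFold_of_mem hs'] at h
  obtain ⟨e1, e2⟩ := stripFold_fiber ht ht' h hfin
  simp only at e2
  rcases e2 with e2 | ⟨h1, m, c, hc, hm, hm'⟩
  · left
    have e3 := stripLog_strictMonoOn.injOn hs hs' e2
    rw [squareTau, squareTau] at e1
    simp only at e1
    have hpos : 0 < min (x' + y') (2 - (x' + y')) := lt_min hs'.1 (by linarith [hs'.2])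
    rw [e3, div_left_inj' hpos.ne'] at e1
    constructor <;> linarith
  right
  have hc' : |-c| ≤ 1 := by rw [abs_neg]; exact hc.le
  rcases lt_or_ge m 0 with h0 | h0
  · obtain ⟨n, rfl⟩ : ∃ n : ℕ, m = -n - 1 := ⟨(-m - 1).toNat, by omega⟩
    have e := eq_of_stripLog_eq hs n hc.le hm
    have e' := eq_of_stripLog_eq hs' n hc' (hm'.trans (by ring))
    have hP : TriadicPartner (x + y) (x' + y') := ⟨n, c, hc, e, by rw [e']; ring⟩
    have k := squareTau_eq_one_of_le (q := (x, y)) ⟨hs.1, e ▸ (piece_mem n hc.le).2⟩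
    have k' := squareTau_eq_one_of_le (q := (x', y')) ⟨hs'.1, e' ▸ (piece_mem n hc').2⟩
    rw [← e1] at k'
    rcases (abs_eq zero_le_one).1 h1 with h | h
    · have a := k.1.1 h
      have a' := k'.1.1 h
      simp only at a a'
      subst a a'
      simp only [add_zero] at hP
      exact Or.inl ⟨rfl, rfl, hP⟩
    · have a := k.2.1 h
      have a' := k'.2.1 h
      simp only at a a'
      subst a a'
      simp only [zero_add] at hP
      exact Or.inr (Or.inl ⟨rfl, rfl, hP⟩)
  · obtain ⟨n, rfl⟩ : ∃ n : ℕ, m = n := ⟨m.toNat, by omega⟩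
    have e := eq_of_stripLog_eq_nonneg hs n hc.le (by rw [hm]; push_cast; ring)
    have e' := eq_of_stripLog_eq_nonneg hs' n hc' (by rw [hm']; push_cast; ring)
    have hP : TriadicPartner (2 - (x + y)) (2 - (x' + y')) :=
      ⟨n, -c, by rwa [abs_neg], by rw [e]; ring, by rw [e']⟩
    have b := (piece_mem n hc').2
    have b' := (piece_mem n hc.le).2
    rw [← sub_eq_add_neg, ← e] at b
    rw [sub_neg_eq_add] at e'
    rw [← e'] at b'
    have k := squareTau_eq_one_of_ge (q := (x, y)) ⟨by simp only; linarith, hs.2⟩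
    have k' := squareTau_eq_one_of_ge (q := (x', y')) ⟨by simp only; linarith, hs'.2⟩
    rw [← e1] at k'
    rcases (abs_eq zero_le_one).1 h1 with h | h
    · have a := k.1.1 h
      have a' := k'.1.1 h
      simp only at a a'
      subst a a'
      refine Or.inr (Or.inr (Or.inl ⟨rfl, rfl, ?_⟩))
      convert hP using 1 <;> ring
    · have a := k.2.1 h
      have a' := k'.2.1 h
      simp only at a a'
      subst a a'
      refine Or.inr (Or.inr (Or.inr ⟨rfl, rfl, ?_⟩))
      convert hP using 1 <;> ring

/-- The inverse branches of the three-fold tent map. -/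
noncomputable def tentBranch (i : Fin 3) (u : ℝ) : ℝ := ![u / 3, (2 - u) / 3, (2 + u) / 3] i

@[simp] theorem tentBranch_zero (u : ℝ) : tentBranch 0 u = u / 3 := rfl
@[simp] theorem tentBranch_one (u : ℝ) : tentBranch 1 u = (2 - u) / 3 := rfl
@[simp] theorem tentBranch_two (u : ℝ) : tentBranch 2 u = (2 + u) / 3 := rfl

theorem tentBranch_mem (i : Fin 3) {u : ℝ} (hu : u ∈ Icc (0 : ℝ) 1) :
    tentBranch i u ∈ Icc (0 : ℝ) 1 := by
  obtain ⟨h0, h1⟩ := hu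
  fin_cases i <;> constructor <;> simp <;> linarith

theorem continuous_tentBranch (i : Fin 3) : Continuous (tentBranch i) := by
  fin_cases i
  · exact continuous_id.div_const 3
  · exact (continuous_const.sub continuous_id).div_const 3
  · exact (continuous_const.add continuous_id).div_const 3

theorem exists_tentBranch_eq {x : ℝ} (hx : x ∈ Icc (0 : ℝ) 1) :
    ∃ (i : Fin 3) (u : ℝ), u ∈ Icc (0 : ℝ) 1 ∧ tentBranch i u = x := by
  obtain ⟨h0, h1⟩ := hx
  rcases le_total x (1 / 3) with h | h
  · exact ⟨0, 3 * x, ⟨by linarith, by linarith⟩, by simp⟩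
  rcases le_total x (2 / 3) with h' | h'
  · exact ⟨1, 2 - 3 * x, ⟨by linarith, by linarith⟩, by simp⟩
  · exact ⟨2, 3 * x - 2, ⟨by linarith, by linarith⟩, by simp⟩

theorem one_sub_tentBranch (i : Fin 3) (u : ℝ) :
    1 - tentBranch i u = tentBranch i.rev (1 - u) := by
  fin_cases i
  · change 1 - u / 3 = (2 + (1 - u)) / 3; ring
  · change 1 - (2 - u) / 3 = (2 - (1 - u)) / 3; ring
  · change 1 - (2 + u) / 3 = (1 - u) / 3; ring

theorem tentBranch_injective (i : Fin 3) : Function.Injective (tentBranch i) := by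
  intro u v h
  fin_cases i <;> simp at h <;> linarith

theorem tentBranch_eq_tentBranch {i j : Fin 3} {u v : ℝ} (hu : u ∈ Icc (0 : ℝ) 1)
    (hv : v ∈ Icc (0 : ℝ) 1) (h : tentBranch i u = tentBranch j v) (hij : i ≠ j) :
    u = v ∧ (u = 1 ∧ (i = 0 ∧ j = 1 ∨ i = 1 ∧ j = 0) ∨ u = 0 ∧ (i = 1 ∧ j = 2 ∨ i = 2 ∧ j = 1)) := by
  obtain ⟨a, b⟩ := hu
  obtain ⟨c, d⟩ := hv
  fin_cases i <;> fin_cases j <;> simp at h hij ⊢ <;>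
    first
    | (exfalso; linarith)
    | (constructor <;> linarith)

theorem TriadicEnd.div_three {t : ℝ} (h : TriadicEnd t) : TriadicEnd (t / 3) := by
  rcases h with rfl | ⟨n, rfl⟩
  · left; simp
  · right; exact ⟨n + 1, by rw [pow_succ]; field_simp⟩

theorem triadicEnd_one_third : TriadicEnd (1 / 3) := Or.inr ⟨1, by simp⟩

theorem TriadicEnd.of_tentBranch {i : Fin 3} {u : ℝ} (hu : u ∈ Icc (0 : ℝ) 1)
    (h : TriadicEnd (tentBranch i u)) : i = 0 ∧ TriadicEnd u ∨ u = 1 ∧ (i = 1 ∨ i = 2) := by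
  obtain ⟨h0, h1⟩ := hu
  rcases h with h | ⟨n, h⟩
  · fin_cases i
    · simp at h
      exact Or.inl ⟨rfl, Or.inl h⟩
    · simp at h; linarith
    · simp at h; linarith
  · rcases n with _ | n
    · fin_cases i
      · simp at h; linarith
      · simp at h; linarith
      · simp at h
        exact Or.inr ⟨by linarith, Or.inr rfl⟩
    · have h3 : (1 : ℝ) / 3 ^ (n + 1) = (1 / 3 ^ n) / 3 := by rw [pow_succ]; field_simp
      have h4 : (1 : ℝ) / 3 ^ n ≤ 1 := by
        rw [div_le_one (by positivity)]; exact one_le_pow₀ (by norm_num)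
      rw [h3] at h
      fin_cases i
      · simp only [Fin.zero_eta, tentBranch_zero] at h
        exact Or.inl ⟨rfl, Or.inr ⟨n, by linarith⟩⟩
      · simp only [Fin.mk_one, tentBranch_one] at h
        exact Or.inr ⟨by linarith, Or.inl rfl⟩
      · simp only [Fin.reduceFinMk, tentBranch_two] at h
        linarith

theorem one_sub_mem_unitInterval {u : ℝ} (hu : u ∈ Icc (0 : ℝ) 1) : 1 - u ∈ Icc (0 : ℝ) 1 :=
  ⟨by linarith [hu.2], by linarith [hu.1]⟩

theorem tentBranch_eq_zero {i : Fin 3} {u : ℝ} (hu : u ∈ Icc (0 : ℝ) 1)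
    (h : tentBranch i u = 0) : i = 0 ∧ u = 0 := by
  obtain ⟨h0, h1⟩ := hu
  fin_cases i
  · simp at h; exact ⟨rfl, h⟩
  · simp at h; linarith
  · simp at h; linarith

theorem mk_mem_unitSquare {x y : ℝ} (hx : x ∈ Icc (0 : ℝ) 1) (hy : y ∈ Icc (0 : ℝ) 1) :
    (x, y) ∈ unitSquare := ⟨hx, hy⟩

theorem squareFold_infty_exchange {i : Fin 3} {u y : ℝ} (hu : u ∈ Icc (0 : ℝ) 1)
    (hy : y ∈ Icc (0 : ℝ) 1) (h : squareFold (tentBranch i u, y) = OnePoint.infty) :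
    squareFold (u, tentBranch i y) = OnePoint.infty := by
  have key : ∀ {i : Fin 3} {u y : ℝ}, u ∈ Icc (0 : ℝ) 1 → y ∈ Icc (0 : ℝ) 1 →
      (y = 0 ∧ TriadicEnd (tentBranch i u) ∨ tentBranch i u = 0 ∧ TriadicEnd y) →
      squareFold (u, tentBranch i y) = OnePoint.infty := by
    rintro i u y hu hy (⟨rfl, h⟩ | ⟨h, h'⟩)
    · rw [squareFold_eq_infty_iff (mk_mem_unitSquare hu (tentBranch_mem i hy))]
      rcases h.of_tentBranch hu with ⟨rfl, h2⟩ | ⟨rfl, rfl | rfl⟩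
      · left; simpa using h2
      · right; right; left
        refine ⟨rfl, ?_⟩
        convert triadicEnd_one_third using 1
        norm_num
      · right; right; left
        refine ⟨rfl, ?_⟩
        convert triadicEnd_one_third using 1
        norm_num
    · rw [squareFold_eq_infty_iff (mk_mem_unitSquare hu (tentBranch_mem i hy))]
      obtain ⟨rfl, rfl⟩ := tentBranch_eq_zero hu h
      right; left
      exact ⟨rfl, h'.div_three⟩
  rw [squareFold_eq_infty_iff (mk_mem_unitSquare (tentBranch_mem i hu) hy)] at h
  rcases h with h | h | h | h
  · exact key hu hy (Or.inl h)
  · exact key hu hy (Or.inr h)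
  all_goals
    rw [← squareFold_rotate_eq_infty_iff, one_sub_tentBranch]
    refine key (one_sub_mem_unitInterval hu) (one_sub_mem_unitInterval hy) ?_
    rw [← one_sub_tentBranch]
  · right; exact ⟨by rw [h.1, sub_self], h.2⟩
  · left; exact ⟨by rw [h.1, sub_self], h.2⟩

theorem TriadicPartner.div_three {t t' : ℝ} (h : TriadicPartner t t') :
    TriadicPartner (t / 3) (t' / 3) := by
  obtain ⟨n, c, hc, rfl, rfl⟩ := h
  exact ⟨n + 1, c, hc, by rw [pow_succ _ (n + 1)]; field_simp, by rw [pow_succ _ (n + 1)]; field_simp⟩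

theorem TriadicPartner.of_tentBranch {i j : Fin 3} {u u' : ℝ} (hu : u ∈ Icc (0 : ℝ) 1)
    (hu' : u' ∈ Icc (0 : ℝ) 1) (h : TriadicPartner (tentBranch i u) (tentBranch j u')) :
    (i = 0 ∧ j = 0 ∧ TriadicPartner u u') ∨ (u = u' ∧ i ≠ 0 ∧ j ≠ 0) := by
  obtain ⟨h0, h1⟩ := hu
  obtain ⟨h0', h1'⟩ := hu'
  obtain ⟨n, c, hc, e, e'⟩ := h
  obtain ⟨hc0, hc1⟩ := abs_lt.1 hc
  rcases n with _ | n
  · right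
    simp only [zero_add, pow_one] at e e'
    fin_cases i <;> fin_cases j <;> simp at e e' ⊢ <;> linarith
  · left
    have h3 : ∀ x : ℝ, x / 3 ^ (n + 1 + 1) = x / 3 ^ (n + 1) / 3 := by
      intro x; rw [pow_succ _ (n + 1)]; field_simp
    have b := (piece_mem n hc.le)
    have b' := (piece_mem n (c := -c) (by rw [abs_neg]; exact hc.le))
    have s : 2 + c < 3 := by linarith
    rw [h3] at e e'
    have lt : ∀ x : ℝ, x < 3 → x / 3 ^ (n + 1) < 1 := by
      intro x hx
      rw [div_lt_one (by positivity), pow_succ]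
      have : (1 : ℝ) ≤ 3 ^ n := one_le_pow₀ (by norm_num)
      linarith
    have l1 := lt (2 + c) (by linarith)
    have l2 := lt (2 - c) (by linarith)
    have hi : i = 0 := by
      fin_cases i
      · rfl
      · simp only [Fin.mk_one, tentBranch_one] at e; linarith
      · simp only [Fin.reduceFinMk, tentBranch_two] at e; linarith
    have hj : j = 0 := by
      fin_cases j
      · rfl
      · simp only [Fin.mk_one, tentBranch_one] at e'; linarith
      · simp only [Fin.reduceFinMk, tentBranch_two] at e'; linarith
    subst hi hj
    simp only [tentBranch_zero] at e e'
    exact ⟨rfl, rfl, n, c, hc, by linarith, by linarith⟩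

theorem squareFold_left_middle {y : ℝ} (hy : y ∈ Icc (0 : ℝ) 1) :
    squareFold (0, (2 - y) / 3) = squareFold (0, (2 + y) / 3) := by
  rw [squareFold_swap_eq_iff]
  have := squareFold_bottom_partner 0 (c := y) (abs_le.2 ⟨by linarith [hy.1], hy.2⟩)
  simpa using this.symm

theorem squareFold_right_middle {y : ℝ} (hy : y ∈ Icc (0 : ℝ) 1) :
    squareFold (1, y / 3) = squareFold (1, (2 - y) / 3) := by
  rw [← squareFold_rotate_eq_iff]
  have := squareFold_left_middle (one_sub_mem_unitInterval hy)
  rw [sub_self]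
  convert this.symm using 3 <;> ring

theorem squareFold_exchange {i j : Fin 3} {u y u' y' : ℝ} (hu : u ∈ Icc (0 : ℝ) 1)
    (hy : y ∈ Icc (0 : ℝ) 1) (hu' : u' ∈ Icc (0 : ℝ) 1) (hy' : y' ∈ Icc (0 : ℝ) 1)
    (h : squareFold (tentBranch i u, y) = squareFold (tentBranch j u', y')) :
    squareFold (u, tentBranch i y) = squareFold (u', tentBranch j y') := by
  by_cases hfin : squareFold (tentBranch i u, y) = OnePoint.infty
  · rw [squareFold_infty_exchange hu hy hfin, squareFold_infty_exchange hu' hy' (h ▸ hfin)]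
  have key : ∀ {i j : Fin 3} {u y u' y' : ℝ}, u ∈ Icc (0 : ℝ) 1 → u' ∈ Icc (0 : ℝ) 1 →
      (y = 0 ∧ y' = 0 ∧ TriadicPartner (tentBranch i u) (tentBranch j u')) ∨
      (tentBranch i u = 0 ∧ tentBranch j u' = 0 ∧ TriadicPartner y y') →
      squareFold (u, tentBranch i y) = squareFold (u', tentBranch j y') := by
    rintro i j u y u' y' hu hu' (⟨rfl, rfl, h⟩ | ⟨h, h', hP⟩)
    · have h0 : ∀ i : Fin 3, i ≠ 0 → tentBranch i 0 = 2 / 3 := by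
        intro i hi
        fin_cases i <;> simp at hi ⊢
      rcases h.of_tentBranch hu hu' with ⟨rfl, rfl, h2⟩ | ⟨rfl, hi, hj⟩
      · rw [tentBranch_zero, zero_div]
        exact h2.squareFold_bottom
      · rw [h0 i hi, h0 j hj]
    · obtain ⟨rfl, rfl⟩ := tentBranch_eq_zero hu h
      obtain ⟨rfl, rfl⟩ := tentBranch_eq_zero hu' h'
      rw [squareFold_swap_eq_iff]
      exact hP.div_three.squareFold_bottom
  rcases squareFold_fiber (mk_mem_unitSquare (tentBranch_mem i hu) hy) 
    (mk_mem_unitSquare (tentBranch_mem j hu') hy') h hfin with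
    ⟨h1, rfl⟩ | h | h | h | h
  · by_cases hij : i = j
    · subst hij
      rw [tentBranch_injective i h1]
    · obtain ⟨rfl, ⟨rfl, ⟨rfl, rfl⟩ | ⟨rfl, rfl⟩⟩ | ⟨rfl, ⟨rfl, rfl⟩ | ⟨rfl, rfl⟩⟩⟩ :=
        tentBranch_eq_tentBranch hu hu' h1 hij
      · exact squareFold_right_middle hy
      · exact (squareFold_right_middle hy).symm
      · exact squareFold_left_middle hy
      · exact (squareFold_left_middle hy).symm
  · exact key hu hu' (Or.inl h)
  · exact key hu hu' (Or.inr h)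
  all_goals
    rw [← squareFold_rotate_eq_iff, one_sub_tentBranch, one_sub_tentBranch]
    refine key (one_sub_mem_unitInterval hu) (one_sub_mem_unitInterval hu') ?_
    rw [← one_sub_tentBranch, ← one_sub_tentBranch]
  · right; exact ⟨by rw [h.1, sub_self], by rw [h.2.1, sub_self], h.2.2⟩
  · left; exact ⟨by rw [h.1, sub_self], by rw [h.2.1, sub_self], h.2.2⟩

theorem exists_homeomorph_of_fiber_eq {X Y : Type*} [TopologicalSpace X] [CompactSpace X]
    [TopologicalSpace Y] [T2Space Y] {g g' : X → Y} (hg : Continuous g) (hg' : Continuous g')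
    (hs : Function.Surjective g) (hs' : Function.Surjective g')
    (h : ∀ a b, g a = g b ↔ g' a = g' b) : ∃ F : Y ≃ₜ Y, ∀ a, F (g a) = g' a := by
  choose s hs1 using hs
  choose s' hs1' using hs'
  have e1 : ∀ a, g' (s (g a)) = g' a := fun a => (h _ _).1 (hs1 _)
  have e2 : ∀ a, g (s' (g' a)) = g a := fun a => (h _ _).2 (hs1' _)
  have q : IsQuotientMap g := hg.isClosedMap.isQuotientMap hg fun y => ⟨s y, hs1 y⟩
  have q' : IsQuotientMap g' := hg'.isClosedMap.isQuotientMap hg' fun y => ⟨s' y, hs1' y⟩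
  refine ⟨⟨⟨fun y => g' (s y), fun y => g (s' y), fun y => ?_, fun y => ?_⟩, ?_, ?_⟩, e1⟩
  · exact (e2 _).trans (hs1 y)
  · exact (e1 _).trans (hs1' y)
  · refine q.continuous_iff.2 (hg'.congr fun a => (e1 a).symm)
  · refine q'.continuous_iff.2 (hg.congr fun a => (e2 a).symm)

theorem exists_baker_homeomorph : ∃ F : OnePoint (ℝ × ℝ) ≃ₜ OnePoint (ℝ × ℝ),
    ∀ (i : Fin 3) (u y : ℝ), u ∈ Icc (0 : ℝ) 1 → y ∈ Icc (0 : ℝ) 1 →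
      F (squareFold (tentBranch i u, y)) = squareFold (u, tentBranch i y) := by
  have : CompactSpace unitSquare := isCompact_iff_compactSpace.1 isCompact_unitSquare
  have c1 : Continuous fun a : Fin 3 × unitSquare =>
      squareFold (tentBranch a.1 a.2.1.1, a.2.1.2) := by
    refine continuousOn_squareFold.comp_continuous ?_ fun a => ⟨tentBranch_mem _ a.2.2.1, a.2.2.2⟩
    rw [continuous_prod_of_discrete_left]
    intro i
    exact ((continuous_tentBranch i).comp (continuous_fst.comp continuous_subtype_val)).prodMk
      (continuous_snd.comp continuous_subtype_val)
  have c2 : Continuous fun a : Fin 3 × unitSquare =>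
      squareFold (a.2.1.1, tentBranch a.1 a.2.1.2) := by
    refine continuousOn_squareFold.comp_continuous ?_ fun a => ⟨a.2.2.1, tentBranch_mem _ a.2.2.2⟩
    rw [continuous_prod_of_discrete_left]
    intro i
    exact (continuous_fst.comp continuous_subtype_val).prodMk
      ((continuous_tentBranch i).comp (continuous_snd.comp continuous_subtype_val))
  obtain ⟨F, hF⟩ := exists_homeomorph_of_fiber_eq c1 c2
    (by
      intro z
      obtain ⟨⟨x, y⟩, hq, rfl⟩ := exists_squareFold_eq z
      obtain ⟨i, u, hu, rfl⟩ := exists_tentBranch_eq hq.1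
      exact ⟨(i, ⟨(u, y), hu, hq.2⟩), rfl⟩)
    (by
      intro z
      obtain ⟨⟨x, y⟩, hq, rfl⟩ := exists_squareFold_eq z
      obtain ⟨i, u, hu, rfl⟩ := exists_tentBranch_eq hq.2
      exact ⟨(i, ⟨(x, u), hq.1, hu⟩), rfl⟩)
    (by
      rintro ⟨i, ⟨u, y⟩, hu, hy⟩ ⟨j, ⟨u', y'⟩, hu', hy'⟩
      refine ⟨squareFold_exchange hu hy hu' hy', fun h => ?_⟩
      have h' := squareFold_swap_eq_iff.1 h
      exact squareFold_swap_eq_iff.1 (squareFold_exchange hy hu hy' hu' h'))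
  exact ⟨F, fun i u y hu hy => hF (i, ⟨(u, y), hu, hy⟩)⟩

/-- The map `f` is differentiable at `q` with invertible derivative. -/
def HasInvFDerivAt (f : ℝ × ℝ → ℝ × ℝ) (q : ℝ × ℝ) : Prop :=
  ∃ A : (ℝ × ℝ) ≃L[ℝ] (ℝ × ℝ), HasFDerivAt f (A : (ℝ × ℝ) →L[ℝ] (ℝ × ℝ)) q

theorem HasInvFDerivAt.comp {f g : ℝ × ℝ → ℝ × ℝ} {q : ℝ × ℝ} (hg : HasInvFDerivAt g (f q))
    (hf : HasInvFDerivAt f q) : HasInvFDerivAt (fun p => g (f p)) q := by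
  obtain ⟨A, hA⟩ := hf
  obtain ⟨B, hB⟩ := hg
  exact ⟨A.trans B, HasFDerivAt.comp q hB hA⟩

theorem HasInvFDerivAt.congr {f g : ℝ × ℝ → ℝ × ℝ} {q : ℝ × ℝ} (hf : HasInvFDerivAt f q)
    (h : f =ᶠ[𝓝 q] g) : HasInvFDerivAt g q := by
  obtain ⟨A, hA⟩ := hf
  exact ⟨A, hA.congr_of_eventuallyEq h.symm⟩

theorem hasInvFDerivAt_mk {f g : ℝ × ℝ → ℝ} {f' g' : (ℝ × ℝ) →L[ℝ] ℝ} {q : ℝ × ℝ}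
    (hf : HasFDerivAt f f' q) (hg : HasFDerivAt g g' q)
    (h : ∀ a b : ℝ, f' (a, b) = 0 → g' (a, b) = 0 → a = 0 ∧ b = 0) :
    HasInvFDerivAt (fun p => (f p, g p)) q := by
  obtain ⟨A, hA⟩ := exists_continuousLinearEquiv_coe_eq (L := f'.prod g') (by
    rintro ⟨a, b⟩ h0
    obtain ⟨rfl, rfl⟩ := h a b (congrArg Prod.fst h0) (congrArg Prod.snd h0)
    rfl)
  exact ⟨A, hA ▸ hf.prodMk hg⟩

theorem hasFDerivAt_div_real {f g : ℝ × ℝ → ℝ} {f' g' : (ℝ × ℝ) →L[ℝ] ℝ} {q : ℝ × ℝ}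
    (hf : HasFDerivAt f f' q) (hg : HasFDerivAt g g' q) (h : g q ≠ 0) :
    HasFDerivAt (fun p => f p / g p) ((g q ^ 2)⁻¹ • (g q • f' - f q • g')) q := by
  have h1 := hf.mul ((hasDerivAt_inv h).comp_hasFDerivAt q hg)
  have e : f q • (-(g q ^ 2)⁻¹ • g') + (Inv.inv ∘ g) q • f' =
      (g q ^ 2)⁻¹ • (g q • f' - f q • g') := by
    ext <;> simp <;> field_simp <;> ring
  rw [e] at h1
  exact h1.congr_of_eventuallyEq (Eventually.of_forall fun p => div_eq_mul_inv _ _)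

theorem hasInvFDerivAt_diagonal_coord (k : ℝ) (hk : k ≠ 0) {q : ℝ × ℝ} (hq : q.1 + q.2 ≠ 0) :
    HasInvFDerivAt (fun p => (k * (p.1 + p.2) - 2, (p.1 - p.2) / (p.1 + p.2))) q := by
  have hs : HasFDerivAt (fun p : ℝ × ℝ => p.1 + p.2) _ q :=
    (hasFDerivAt_fst (𝕜 := ℝ) (p := q)).add (hasFDerivAt_snd (𝕜 := ℝ) (p := q))
  have hd : HasFDerivAt (fun p : ℝ × ℝ => p.1 - p.2) _ q :=
    (hasFDerivAt_fst (𝕜 := ℝ) (p := q)).sub (hasFDerivAt_snd (𝕜 := ℝ) (p := q))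
  refine hasInvFDerivAt_mk ((hs.const_mul k).sub_const 2) (hasFDerivAt_div_real hd hs hq) ?_
  intro a b h1 h2
  simp at h1 h2
  have h1 : a + b = 0 := by
    refine (mul_eq_zero.1 (?_ : k * (a + b) = 0)).resolve_left hk
    linarith
  have h3 : (q.1 + q.2) * (a - b) = 0 := by
    rcases h2 with h2 | h2
    · exact absurd h2 hq
    · linear_combination h2 + (q.1 - q.2) * h1
  have h4 := (mul_eq_zero.1 h3).resolve_left hq
  constructor <;> linarith

theorem hasInvFDerivAt_column (C : ℝ) {ε c τ : ℝ} (hc0 : 0 < ε * c) (hc1 : ε * c < 1)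
    (hτ0 : 0 < τ) (hτ1 : τ < 1) :
    HasInvFDerivAt (fun p => (C + p.1 * (1 - p.2) / (1 - ε * p.1 * p.2), p.2 / (1 - ε * p.1 * p.2)))
      (c, τ) := by
  have h1 := hasFDerivAt_fst (𝕜 := ℝ) (E := ℝ) (F := ℝ) (p := (c, τ))
  have h2 := hasFDerivAt_snd (𝕜 := ℝ) (E := ℝ) (F := ℝ) (p := (c, τ))
  have hD : HasFDerivAt (fun p : ℝ × ℝ => 1 - ε * p.1 * p.2) _ (c, τ) :=
    ((h1.const_mul ε).mul h2).const_sub 1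
  have hN : HasFDerivAt (fun p : ℝ × ℝ => p.1 * (1 - p.2)) _ (c, τ) := h1.mul (h2.const_sub 1)
  have hpos : 0 < 1 - ε * c * τ := by nlinarith
  refine hasInvFDerivAt_mk ((hasFDerivAt_div_real hN hD hpos.ne').const_add C)
    (hasFDerivAt_div_real h2 hD hpos.ne') ?_
  intro a b e1 e2
  simp [hpos.ne'] at e1 e2
  have e2' : b + ε * τ ^ 2 * a = 0 := by linear_combination e2
  have e1' : a * (1 - τ) + b * (ε * c ^ 2 - c) = 0 := by linear_combination e1
  have hb : b = -(ε * τ ^ 2 * a) := by linarith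
  have : a * ((1 - τ) + τ ^ 2 * (ε * c * (1 - ε * c))) = 0 := by
    rw [hb] at e1'
    linear_combination e1'
  have hp : 0 < (1 - τ) + τ ^ 2 * (ε * c * (1 - ε * c)) := by
    have := mul_pos hc0 (sub_pos.2 hc1)
    have := sub_pos.2 hτ1
    positivity
  have ha := (mul_eq_zero.1 this).resolve_right hp.ne'
  exact ⟨ha, by rw [hb, ha]; ring⟩

/-- A real number none of whose multiples by powers of three is an integer. -/
def NotTriadic (t : ℝ) : Prop := ∀ (n : ℕ) (k : ℤ), 3 ^ n * t ≠ k

theorem NotTriadic.sub_left {t : ℝ} (h : NotTriadic t) (m : ℤ) : NotTriadic (m - t) := by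
  intro n k hk
  refine h n (3 ^ n * m - k) ?_
  push_cast
  linarith

/-- The points of the plane avoiding the lines along which the folding map is not smooth. -/
def RegularPoint (q : ℝ × ℝ) : Prop :=
  NotTriadic q.1 ∧ NotTriadic q.2 ∧ NotTriadic (q.1 + q.2) ∧ q.1 ≠ q.2

theorem RegularPoint.swap {x y : ℝ} (h : RegularPoint (x, y)) : RegularPoint (y, x) := by
  obtain ⟨h1, h2, h3, h4⟩ := h
  exact ⟨h2, h1, by simpa [add_comm] using h3, h4.symm⟩

theorem RegularPoint.rotate {x y : ℝ} (h : RegularPoint (x, y)) :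
    RegularPoint (1 - x, 1 - y) := by
  obtain ⟨h1, h2, h3, h4⟩ := h
  simp only at h1 h2 h3 h4
  refine ⟨by simpa using h1.sub_left 1, by simpa using h2.sub_left 1, ?_, ?_⟩
  · have := h3.sub_left 2
    convert this using 1
    push_cast
    ring
  · intro h
    simp only at h
    exact h4 (by linarith)

theorem NotTriadic.mem_Ioo {t : ℝ} (h : NotTriadic t) (ht : t ∈ Icc (0 : ℝ) 1) :
    t ∈ Ioo (0 : ℝ) 1 := by
  refine ⟨lt_of_le_of_ne ht.1 fun h0 => h 0 0 ?_, lt_of_le_of_ne ht.2 fun h0 => h 0 1 ?_⟩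
  · rw [← h0]; simp
  · rw [h0]; simp

theorem toPlane_map (L : (ℝ × ℝ) ≃L[ℝ] (ℝ × ℝ)) (z : OnePoint (ℝ × ℝ)) :
    toPlane (OnePoint.map L z) = L (toPlane z) := by
  induction z using OnePoint.rec with
  | infty => rw [OnePoint.map_infty]; exact (map_zero L).symm
  | coe v => rw [OnePoint.map_some, toPlane_coe, toPlane_coe]

theorem hasInvFDerivAt_squareFold_aux {x y : ℝ} (hy0 : 0 < y) (hxy : y < x) (h1 : x + y < 1)
    (h : NotTriadic (x + y)) : HasInvFDerivAt (fun p => toPlane (squareFold p)) (x, y) := by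
  have hσ : 0 < x + y := by linarith
  obtain ⟨n, hn1, hn2⟩ := exists_pow_three_mul hσ h1.le
  have h3 : (0 : ℝ) < 3 ^ (n + 1) := by positivity
  have e3 : (3 : ℝ) ^ (n + 1) * (x + y) = 3 * (3 ^ n * (x + y)) := by rw [pow_succ]; ring
  have hn3 : 3 ^ (n + 1) * (x + y) < 3 := by
    refine lt_of_le_of_ne (by linarith) ?_
    exact_mod_cast h (n + 1) 3
  have hc2 : 3 ^ (n + 1) * (x + y) - 2 ≠ 0 := sub_ne_zero.2 (by exact_mod_cast h (n + 1) 2)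
  obtain ⟨ε, hε, hεc⟩ : ∃ ε : ℝ, ε * ε = 1 ∧ 0 < ε * (3 ^ (n + 1) * (x + y) - 2) := by
    rcases lt_or_gt_of_ne hc2 with h | h
    · exact ⟨-1, by norm_num, by linarith⟩
    · exact ⟨1, by norm_num, by linarith⟩
  have hε' : ε = 1 ∨ ε = -1 := mul_self_eq_one_iff.1 hε
  have hτ0 : 0 < (x - y) / (x + y) := div_pos (by linarith) hσ
  have hτ1 : (x - y) / (x + y) < 1 := (div_lt_one hσ).2 (by linarith)
  have hεc1 : ε * (3 ^ (n + 1) * (x + y) - 2) < 1 := by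
    rcases hε' with rfl | rfl <;> linarith
  have hcol := HasInvFDerivAt.comp (q := (x, y))
    (f := fun p => (3 ^ (n + 1) * (p.1 + p.2) - 2, (p.1 - p.2) / (p.1 + p.2)))
    (hasInvFDerivAt_column (2 * ((-n - 1 : ℤ) : ℝ) + 1) hεc hεc1 hτ0 hτ1)
    (hasInvFDerivAt_diagonal_coord (3 ^ (n + 1)) h3.ne' (q := (x, y)) hσ.ne')
  refine hcol.congr ?_
  have ev1 : ∀ᶠ p : ℝ × ℝ in 𝓝 (x, y), 0 < p.1 + p.2 :=
    (Continuous.tendsto (by fun_prop) (x, y)).eventually_const_lt (v := x + y) hσ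
  have ev1' : ∀ᶠ p : ℝ × ℝ in 𝓝 (x, y), p.1 + p.2 < 1 :=
    (Continuous.tendsto (by fun_prop) (x, y)).eventually_lt_const (v := x + y) h1
  have ev2 : ∀ᶠ p : ℝ × ℝ in 𝓝 (x, y), p.2 < p.1 :=
    (continuous_snd.tendsto (x, y)).eventually_lt (continuous_fst.tendsto (x, y)) hxy
  have ev3 : ∀ᶠ p : ℝ × ℝ in 𝓝 (x, y), 0 < p.2 :=
    (continuous_snd.tendsto (x, y)).eventually_const_lt hy0
  have hcont : Continuous fun p : ℝ × ℝ => ε * (3 ^ (n + 1) * (p.1 + p.2) - 2) := by fun_prop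
  have ev4 : ∀ᶠ p : ℝ × ℝ in 𝓝 (x, y), 0 < ε * (3 ^ (n + 1) * (p.1 + p.2) - 2) :=
    (hcont.tendsto (x, y)).eventually_const_lt hεc
  have ev5 : ∀ᶠ p : ℝ × ℝ in 𝓝 (x, y), ε * (3 ^ (n + 1) * (p.1 + p.2) - 2) < 1 :=
    (hcont.tendsto (x, y)).eventually_lt_const hεc1
  filter_upwards [ev1, ev1', ev2, ev3, ev4, ev5] with p p1 p1' p2 p3 p4 p5
  obtain ⟨c, hc⟩ : ∃ c, c = 3 ^ (n + 1) * (p.1 + p.2) - 2 := ⟨_, rfl⟩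
  rw [← hc] at p4 p5 ⊢
  have hτ : squareTau p = (p.1 - p.2) / (p.1 + p.2) := by
    rw [squareTau, min_eq_left (by linarith)]
  have hτ0 : 0 < (p.1 - p.2) / (p.1 + p.2) := div_pos (by linarith) p1
  have hτ1 : (p.1 - p.2) / (p.1 + p.2) < 1 := (div_lt_one p1).2 (by linarith)
  have hcabs : |c| = ε * c := by
    rcases hε' with rfl | rfl
    · rw [one_mul] at p4 ⊢; exact abs_of_pos p4
    · rw [neg_one_mul]; exact abs_of_neg (by linarith)
  have hc1 : |c| ≤ 1 := by rw [hcabs]; exact p5.le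
  have hs : p.1 + p.2 = (2 + c) / 3 ^ (n + 1) := by rw [hc]; field_simp; ring
  have hD : 0 < 1 - |c| * |squareTau p| := by
    rw [hcabs, hτ, abs_of_pos hτ0]
    nlinarith
  rw [squareFold_of_mem ⟨p1, by linarith⟩, show stripLog (p.1 + p.2) = _ from
    hs ▸ stripLog_piece n hc1, stripFold_eq_coe _ hc1 hD, toPlane_coe, hcabs, hτ, abs_of_pos hτ0]

theorem hasInvFDerivAt_of_symm {f : ℝ × ℝ → ℝ × ℝ} {q : ℝ × ℝ} {s : ℝ × ℝ → ℝ × ℝ}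
    (L : (ℝ × ℝ) ≃L[ℝ] (ℝ × ℝ)) (h : ∀ p, f (s p) = L (f p)) (hs : HasInvFDerivAt s q)
    (hf : HasInvFDerivAt f (s q)) : HasInvFDerivAt f q := by
  have h1 := hf.comp hs
  have h2 : HasInvFDerivAt L.symm (f (s q)) := ⟨L.symm, L.symm.hasFDerivAt⟩
  refine (HasInvFDerivAt.comp (f := fun p => f (s p)) h2 h1).congr (Eventually.of_forall fun p => ?_)
  simp only
  rw [h, L.symm_apply_apply]

theorem hasInvFDerivAt_squareFold {x y : ℝ} (hx : x ∈ Icc (0 : ℝ) 1) (hy : y ∈ Icc (0 : ℝ) 1)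
    (h : RegularPoint (x, y)) : HasInvFDerivAt (fun p => toPlane (squareFold p)) (x, y) := by
  have half : ∀ {x y : ℝ}, x ∈ Icc (0 : ℝ) 1 → y ∈ Icc (0 : ℝ) 1 → RegularPoint (x, y) →
      x + y < 1 → HasInvFDerivAt (fun p => toPlane (squareFold p)) (x, y) := by
    intro x y hx hy h h1
    rcases lt_or_gt_of_ne h.2.2.2 with h2 | h2
    · refine hasInvFDerivAt_of_symm (s := Prod.swap) reflectSnd (fun p => ?_)
        ⟨ContinuousLinearEquiv.prodComm ℝ ℝ ℝ,
          (ContinuousLinearEquiv.prodComm ℝ ℝ ℝ).hasFDerivAt⟩ ?_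
      · rw [← toPlane_map, ← squareFold_swap]; rfl
      · exact hasInvFDerivAt_squareFold_aux (h.1.mem_Ioo hx).1 h2 (by linarith) h.swap.2.2.1
    · exact hasInvFDerivAt_squareFold_aux (h.2.1.mem_Ioo hy).1 h2 h1 h.2.2.1
  have hne : x + y ≠ 1 := by simpa using h.2.2.1 0 1
  rcases lt_or_gt_of_ne hne with h1 | h1
  · exact half hx hy h h1
  · refine hasInvFDerivAt_of_symm (s := fun p => (1 - p.1, 1 - p.2))
      (ContinuousLinearEquiv.neg ℝ) (fun p => ?_) ?_ ?_
    · rw [← toPlane_map, ← squareFold_rotate]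
    · refine hasInvFDerivAt_mk (hasFDerivAt_fst.const_sub 1) (hasFDerivAt_snd.const_sub 1) ?_
      intro a b ha hb
      simp at ha hb
      exact ⟨ha, hb⟩
    · exact half (one_sub_mem_unitInterval hx) (one_sub_mem_unitInterval hy) h.rotate
        (by linarith)

theorem squareFold_ne_infty {x y : ℝ} (hx : x ∈ Ioo (0 : ℝ) 1) (hy : y ∈ Ioo (0 : ℝ) 1) :
    squareFold (x, y) ≠ OnePoint.infty := by
  rw [Ne, squareFold_eq_infty_iff (mk_mem_unitSquare (Ioo_subset_Icc_self hx)
    (Ioo_subset_Icc_self hy))]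
  rintro (⟨h, -⟩ | ⟨h, -⟩ | ⟨h, -⟩ | ⟨h, -⟩)
  · exact hy.1.ne' h
  · exact hx.1.ne' h
  · exact hx.2.ne h
  · exact hy.2.ne h

theorem eq_of_squareFold_eq {x y : ℝ} (hx : x ∈ Ioo (0 : ℝ) 1) (hy : y ∈ Ioo (0 : ℝ) 1)
    {p : ℝ × ℝ} (hp : p ∈ unitSquare) (h : squareFold p = squareFold (x, y)) : p = (x, y) := by
  rcases squareFold_fiber (mk_mem_unitSquare (Ioo_subset_Icc_self hx)
    (Ioo_subset_Icc_self hy)) (x' := p.1) (y' := p.2) hp h.symm (squareFold_ne_infty hx hy) with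
    ⟨h1, h2⟩ | ⟨h, -⟩ | ⟨h, -⟩ | ⟨h, -⟩ | ⟨h, -⟩
  · exact Prod.ext h1.symm h2.symm
  · exact absurd h hy.1.ne'
  · exact absurd h hx.1.ne'
  · exact absurd h hx.2.ne
  · exact absurd h hy.2.ne

theorem tendsto_section_of_unique_fiber {X Y : Type*} [TopologicalSpace X] [TopologicalSpace Y]
    [T2Space Y] {K : X → Y} {Q : Set X} (hQ : IsCompact Q) (hK : ContinuousOn K Q) {s : Y → X}
    (hsQ : ∀ z, s z ∈ Q) (hs : ∀ z, K (s z) = z) {q : X}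
    (hq : ∀ p ∈ Q, K p = K q → p = q) : Tendsto s (𝓝 (K q)) (𝓝 q) := by
  intro U hU
  obtain ⟨W, hWU, hW, hqW⟩ := mem_nhds_iff.1 hU
  have hc : IsClosed (K '' (Q \ W)) :=
    ((hQ.diff hW).image_of_continuousOn (hK.mono sdiff_subset)).isClosed
  have hn : K q ∉ K '' (Q \ W) := by
    rintro ⟨p, ⟨hp, hpW⟩, h⟩
    exact hpW (hq p hp h ▸ hqW)
  rw [Filter.mem_map]
  filter_upwards [hc.isOpen_compl.mem_nhds hn] with z hz
  by_contra h
  exact hz ⟨s z, ⟨hsQ z, fun h' => h (hWU h')⟩, hs z⟩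

/-- The affine inverse of a branch of the tent map. -/
noncomputable def tentInv (i : Fin 3) (x : ℝ) : ℝ := ![3 * x, 2 - 3 * x, 3 * x - 2] i

theorem tentBranch_tentInv (i : Fin 3) (x : ℝ) : tentBranch i (tentInv i x) = x := by
  fin_cases i <;> simp [tentInv]

theorem tentInv_tentBranch (i : Fin 3) (u : ℝ) : tentInv i (tentBranch i u) = u :=
  tentBranch_injective i (tentBranch_tentInv i _)

theorem exists_hasDerivAt_tentInv (i : Fin 3) (x : ℝ) :
    ∃ a : ℝ, a ≠ 0 ∧ HasDerivAt (tentInv i) a x := by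
  have h := (hasDerivAt_id x).const_mul (3 : ℝ)
  fin_cases i
  · exact ⟨_, by norm_num, h⟩
  · exact ⟨_, by norm_num, h.const_sub 2⟩
  · exact ⟨_, by norm_num, h.sub_const 2⟩

theorem exists_hasDerivAt_tentBranch (i : Fin 3) (x : ℝ) :
    ∃ a : ℝ, a ≠ 0 ∧ HasDerivAt (tentBranch i) a x := by
  have h := hasDerivAt_id x
  fin_cases i
  · exact ⟨_, by norm_num, h.div_const 3⟩
  · exact ⟨_, by norm_num, (h.const_sub 2).div_const 3⟩
  · exact ⟨_, by norm_num, (h.const_add 2).div_const 3⟩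

theorem exists_dirAt_baker {F : OnePoint (ℝ × ℝ) ≃ₜ OnePoint (ℝ × ℝ)}
    (hF : ∀ (i : Fin 3) (u y : ℝ), u ∈ Icc (0 : ℝ) 1 → y ∈ Icc (0 : ℝ) 1 →
      F (squareFold (tentBranch i u, y)) = squareFold (u, tentBranch i y))
    {i : Fin 3} {u y : ℝ} (hu : u ∈ Icc (0 : ℝ) 1) (hy : y ∈ Icc (0 : ℝ) 1)
    (h1 : RegularPoint (tentBranch i u, y)) (h2 : RegularPoint (u, tentBranch i y)) :
    ∃ A, DirAt (fun v : ℝ × ℝ => toPlane (F v)) (toPlane (squareFold (tentBranch i u, y))) A := by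
  have hx := tentBranch_mem i hu
  have hfin := squareFold_ne_infty (h1.1.mem_Ioo hx) (h1.2.1.mem_Ioo hy)
  obtain ⟨v₀, hv₀⟩ : ∃ v₀, v₀ = toPlane (squareFold (tentBranch i u, y)) := ⟨_, rfl⟩
  have hv : (v₀ : OnePoint (ℝ × ℝ)) = squareFold (tentBranch i u, y) := by
    rw [hv₀, coe_toPlane hfin]
  rw [← hv₀]
  choose s hsQ hs using exists_squareFold_eq
  have hts : Tendsto s (𝓝 (squareFold (tentBranch i u, y))) (𝓝 (tentBranch i u, y)) :=
    tendsto_section_of_unique_fiber isCompact_unitSquare continuousOn_squareFold hsQ hs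
      fun p hp h => eq_of_squareFold_eq (h1.1.mem_Ioo hx) (h1.2.1.mem_Ioo hy) hp h
  have hsv : s v₀ = (tentBranch i u, y) :=
    eq_of_squareFold_eq (h1.1.mem_Ioo hx) (h1.2.1.mem_Ioo hy) (hsQ _) ((hs _).trans hv)
  have hgt : Tendsto (fun v : ℝ × ℝ => s v) (𝓝 v₀) (𝓝 (tentBranch i u, y)) := by
    rw [← hv] at hts
    exact hts.comp (OnePoint.continuous_coe.tendsto v₀)
  have hg : HasInvFDerivAt (fun v : ℝ × ℝ => s v) v₀ := by
    obtain ⟨A, hA⟩ := hasInvFDerivAt_squareFold hx hy h1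
    rw [← hsv] at hA
    refine ⟨A.symm, HasFDerivAt.of_local_left_inverse ?_ hA ?_⟩
    · rw [ContinuousAt, hsv]; exact hgt
    · exact Eventually.of_forall fun v => by rw [hs, toPlane_coe]
  have hb : HasInvFDerivAt (fun p : ℝ × ℝ => (tentInv i p.1, tentBranch i p.2)) (s v₀) := by
    obtain ⟨a, ha, hda⟩ := exists_hasDerivAt_tentInv i (s v₀).1
    obtain ⟨b, hb, hdb⟩ := exists_hasDerivAt_tentBranch i (s v₀).2
    refine hasInvFDerivAt_mk (hda.comp_hasFDerivAt _ hasFDerivAt_fst)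
      (hdb.comp_hasFDerivAt _ hasFDerivAt_snd) ?_
    intro c d hc hd
    simp [ha, hb] at hc hd
    exact ⟨hc, hd⟩
  have hb' := hb.comp hg
  have hK : HasInvFDerivAt (fun p => toPlane (squareFold p))
      ((fun v : ℝ × ℝ => (tentInv i (s v).1, tentBranch i (s v).2)) v₀) := by
    simp only
    rw [hsv, tentInv_tentBranch]
    exact hasInvFDerivAt_squareFold hu (tentBranch_mem i hy) h2
  obtain ⟨A, hA⟩ := hK.comp hb'
  refine ⟨A, hA.dirAt.congr ?_⟩
  have hcont : Continuous fun p : ℝ × ℝ => tentInv i p.1 := by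
    have : Continuous (tentInv i) := by
      refine continuous_iff_continuousAt.2 fun x => ?_
      obtain ⟨a, -, h⟩ := exists_hasDerivAt_tentInv i x
      exact h.continuousAt
    fun_prop
  have hev : ∀ᶠ v : ℝ × ℝ in 𝓝 v₀, tentInv i (s v).1 ∈ Ioo (0 : ℝ) 1 := by
    refine ((hcont.tendsto _).comp hgt).eventually (isOpen_Ioo.mem_nhds ?_)
    rw [tentInv_tentBranch]
    exact h2.1.mem_Ioo hu
  filter_upwards [hev] with v hv
  have := hF i (tentInv i (s v).1) (s v).2 (Ioo_subset_Icc_self hv) (hsQ v).2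
  rw [tentBranch_tentInv] at this
  rw [← this]
  change _ = toPlane (F v)
  rw [← hs v, hs, hs]

/-- The orientation of a branch of the three-fold tent map. -/
def tentSign (i : Fin 3) : ℝ := ![1, -1, 1] i

/-- Three times the value at `0` of a branch of the three-fold tent map. -/
def tentShift (i : Fin 3) : ℝ := ![0, 2, 2] i

theorem tentBranch_eq_affine (i : Fin 3) (u : ℝ) :
    tentBranch i u = tentShift i / 3 + tentSign i / 3 * u := by
  fin_cases i <;> simp [tentShift, tentSign] <;> ring

theorem abs_tentSign (i : Fin 3) : |tentSign i| = 1 := by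
  fin_cases i <;> simp [tentSign]

theorem abs_tentShift_le (i : Fin 3) : |tentShift i| ≤ 2 := by
  fin_cases i <;> simp [tentShift]

/-- The point of the unit interval with prescribed itinerary under the three-fold tent map. -/
noncomputable def tentPoint (a : ℕ → Fin 3) : ℝ :=
  ∑' n, (∏ k ∈ Finset.range n, tentSign (a k)) * (tentShift (a n) / 3 ^ (n + 1))

theorem norm_tentPoint_term_le (a : ℕ → Fin 3) (n : ℕ) :
    ‖(∏ k ∈ Finset.range n, tentSign (a k)) * (tentShift (a n) / 3 ^ (n + 1))‖ ≤
      2 / 3 * (1 / 3) ^ n := by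
  rw [norm_mul, Real.norm_eq_abs, Finset.abs_prod]
  simp only [abs_tentSign, Finset.prod_const_one, one_mul, Real.norm_eq_abs, abs_div]
  rw [abs_of_pos (by positivity : (0 : ℝ) < 3 ^ (n + 1))]
  calc |tentShift (a n)| / 3 ^ (n + 1) ≤ 2 / 3 ^ (n + 1) := by
        gcongr; exact abs_tentShift_le _
    _ = 2 / 3 * (1 / 3) ^ n := by rw [pow_succ, one_div, inv_pow]; field_simp

theorem hasSum_two_thirds : HasSum (fun n : ℕ => (2 / 3 : ℝ) * (1 / 3) ^ n) 1 := by
  have := (hasSum_geometric_of_lt_one (r := (1 / 3 : ℝ)) (by norm_num) (by norm_num)).mul_left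
    (2 / 3 : ℝ)
  norm_num at this ⊢
  exact this

theorem summable_tentPoint_term (a : ℕ → Fin 3) :
    Summable fun n => (∏ k ∈ Finset.range n, tentSign (a k)) * (tentShift (a n) / 3 ^ (n + 1)) :=
  .of_norm_bounded hasSum_two_thirds.summable (norm_tentPoint_term_le a)

theorem continuous_tentPoint : Continuous tentPoint := by
  refine continuous_tsum (fun n => ?_) hasSum_two_thirds.summable
    (fun n a => norm_tentPoint_term_le a n)
  refine .mul (continuous_finsetProd _ fun k _ => ?_) (.div_const ?_ _)
  · exact continuous_of_discreteTopology.comp (continuous_apply k)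
  · exact continuous_of_discreteTopology.comp (continuous_apply n)

theorem abs_tentPoint_le (a : ℕ → Fin 3) : |tentPoint a| ≤ 1 :=
  tsum_of_norm_bounded hasSum_two_thirds (norm_tentPoint_term_le a)

theorem tentPoint_eq (a : ℕ → Fin 3) :
    tentPoint a = tentBranch (a 0) (tentPoint fun k => a (k + 1)) := by
  rw [tentPoint, (summable_tentPoint_term a).tsum_eq_zero_add, tentBranch_eq_affine, tentPoint,
    ← tsum_mul_left]
  congr 1
  · simp
  · refine tsum_congr fun n => ?_
    rw [Finset.prod_range_succ', pow_succ _ (n + 1)]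
    field_simp

/-- The composition of the first `n` branches of an itinerary. -/
noncomputable def tentWord (a : ℕ → Fin 3) : ℕ → ℝ → ℝ
  | 0, u => u
  | n + 1, u => tentWord a n (tentBranch (a n) u)

theorem tentWord_mem (a : ℕ → Fin 3) (n : ℕ) {u : ℝ} (hu : u ∈ Icc (0 : ℝ) 1) :
    tentWord a n u ∈ Icc (0 : ℝ) 1 := by
  induction n generalizing u with
  | zero => exact hu
  | succ n ih => exact ih (tentBranch_mem _ hu)

theorem abs_tentWord_sub (a : ℕ → Fin 3) (n : ℕ) (u v : ℝ) :
    |tentWord a n u - tentWord a n v| = |u - v| / 3 ^ n := by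
  induction n generalizing u v with
  | zero => simp [tentWord]
  | succ n ih =>
    rw [tentWord, tentWord, ih, tentBranch_eq_affine, tentBranch_eq_affine, add_sub_add_left_eq_sub,
      ← mul_sub, abs_mul, abs_div, abs_tentSign, pow_succ, abs_of_pos (by norm_num : (0 : ℝ) < 3)]
    field_simp

theorem tentWord_congr {a b : ℕ → Fin 3} {n : ℕ} (h : ∀ k < n, a k = b k) (u : ℝ) :
    tentWord a n u = tentWord b n u := by
  induction n generalizing u with
  | zero => rfl
  | succ n ih =>
    rw [tentWord, tentWord, h n n.lt_succ_self, ih fun k hk => h k (hk.trans n.lt_succ_self)]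

theorem tentWord_apply_eq {a : ℕ → Fin 3} {x : ℕ → ℝ}
    (h : ∀ n, x n = tentBranch (a n) (x (n + 1))) (n : ℕ) : tentWord a n (x n) = x 0 := by
  induction n with
  | zero => rfl
  | succ n ih => rw [tentWord, ← h, ih]

theorem tentPoint_tail_eq (a : ℕ → Fin 3) (n : ℕ) :
    tentPoint (fun k => a (k + n)) =
      tentBranch (a n) (tentPoint fun k => a (k + (n + 1))) := by
  rw [tentPoint_eq, zero_add]
  simp only [add_assoc, add_comm 1]

theorem tentWord_tentPoint (a : ℕ → Fin 3) (n : ℕ) :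
    tentWord a n (tentPoint fun k => a (k + n)) = tentPoint a :=
  tentWord_apply_eq (x := fun n => tentPoint fun k => a (k + n)) (tentPoint_tail_eq a) n

theorem tendsto_div_three_pow (C : ℝ) : Tendsto (fun n : ℕ => C / 3 ^ n) atTop (𝓝 0) := by
  simpa [div_eq_mul_inv] using
    (tendsto_pow_atTop_nhds_zero_of_lt_one (r := (3⁻¹ : ℝ)) (by norm_num) (by norm_num)).const_mul C

theorem tentPoint_eq_of_forall {a : ℕ → Fin 3} {x : ℕ → ℝ}
    (h : ∀ n, x n = tentBranch (a n) (x (n + 1))) (hx : ∀ n, x n ∈ Icc (0 : ℝ) 1) :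
    tentPoint a = x 0 := by
  refine sub_eq_zero.1 (abs_nonpos_iff.1 (ge_of_tendsto' (tendsto_div_three_pow 2) fun n => ?_))
  rw [← tentWord_tentPoint a n, ← tentWord_apply_eq h n, abs_tentWord_sub]
  gcongr
  obtain ⟨h0, h1⟩ := hx n
  obtain ⟨h2, h3⟩ := abs_le.1 (abs_tentPoint_le fun k => a (k + n))
  rw [abs_le]; constructor <;> linarith

theorem tentPoint_mem (a : ℕ → Fin 3) : tentPoint a ∈ Icc (0 : ℝ) 1 := by
  refine isClosed_Icc.mem_of_tendsto (b := atTop) (f := fun n => tentWord a n 0) ?_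
    (Eventually.of_forall fun n => tentWord_mem a n (by simp))
  rw [tendsto_iff_dist_tendsto_zero]
  refine squeeze_zero (fun _ => dist_nonneg) (fun n => ?_) (tendsto_div_three_pow 1)
  rw [← tentWord_tentPoint a n, Real.dist_eq, abs_tentWord_sub, zero_sub, abs_neg]
  gcongr
  exact abs_tentPoint_le _

theorem exists_tentPoint_eq {x : ℝ} (hx : x ∈ Icc (0 : ℝ) 1) : ∃ a, tentPoint a = x := by
  choose! i u hu hiu using fun (x : ℝ) (hx : x ∈ Icc (0 : ℝ) 1) => exists_tentBranch_eq hx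
  have hmem : ∀ n, u^[n] x ∈ Icc (0 : ℝ) 1 := fun n => by
    induction n with
    | zero => exact hx
    | succ n ih => rw [Function.iterate_succ_apply']; exact hu _ ih
  refine ⟨fun n => i (u^[n] x), tentPoint_eq_of_forall (x := fun n => u^[n] x) (fun n => ?_) hmem⟩
  rw [Function.iterate_succ_apply', hiu _ (hmem n)]

theorem tentPoint_rev (a : ℕ → Fin 3) : tentPoint (fun k => (a k).rev) = 1 - tentPoint a := by
  refine tentPoint_eq_of_forall (x := fun n => 1 - tentPoint fun k => a (k + n)) (fun n => ?_)
    fun n => one_sub_mem_unitInterval (tentPoint_mem _)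
  rw [← one_sub_tentBranch, ← tentPoint_tail_eq]

theorem digit_eq_zero_of_tentPoint_eq_zero {a : ℕ → Fin 3} (h : tentPoint a = 0) (n : ℕ) :
    a n = 0 := by
  have H : ∀ n, tentPoint (fun k => a (k + n)) = 0 := fun n => by
    induction n with
    | zero => exact h
    | succ n ih => rw [tentPoint_tail_eq] at ih; exact (tentBranch_eq_zero (tentPoint_mem _) ih).2
  have := H n
  rw [tentPoint_tail_eq] at this
  exact (tentBranch_eq_zero (tentPoint_mem _) this).1

theorem digit_eq_two_of_tentPoint_eq_one {a : ℕ → Fin 3} (h : tentPoint a = 1) (n : ℕ) :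
    a n = 2 := by
  have := digit_eq_zero_of_tentPoint_eq_zero (a := fun k => (a k).rev)
    (by rw [tentPoint_rev, h, sub_self]) n
  rw [← Fin.rev_rev (a n), this]; rfl

theorem eq_of_tentPoint_eq {a b : ℕ → Fin 3} (h : tentPoint a = tentPoint b)
    (ha : ∀ n, tentPoint (fun k => a (k + n)) ∈ Ioo (0 : ℝ) 1) : a = b := by
  have key : ∀ n, tentPoint (fun k => a (k + n)) = tentPoint (fun k => b (k + n)) → a n = b n := by
    intro n hn
    by_contra hne
    rw [tentPoint_tail_eq a n, tentPoint_tail_eq b n] at hn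
    have h1 := ha (n + 1)
    rcases (tentBranch_eq_tentBranch (tentPoint_mem _) (tentPoint_mem _) hn hne).2 with h2 | h2
    · exact h1.2.ne h2.1
    · exact h1.1.ne' h2.1
  have H : ∀ n, tentPoint (fun k => a (k + n)) = tentPoint (fun k => b (k + n)) := fun n => by
    induction n with
    | zero => exact h
    | succ n ih =>
      have e := key n ih
      rw [tentPoint_tail_eq, tentPoint_tail_eq b, e] at ih
      exact tentBranch_injective _ ih
  exact funext fun n => key n (H n)

theorem tentPoint_const_zero : tentPoint (fun _ => 0) = 0 :=
  tentPoint_eq_of_forall (x := fun _ => 0) (by simp) (by simp)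

theorem tentPoint_const_two : tentPoint (fun _ => 2) = 1 :=
  tentPoint_eq_of_forall (x := fun _ => 1) (by norm_num) (by simp)

theorem tentPoint_ne_of_tails (a b : ℕ → Fin 3) (N : ℕ) (h : ∀ k < N, a k = b k)
    (ha : ∀ k, a (k + N) = 0) (hb : ∀ k, b (k + N) = 2) : tentPoint a ≠ tentPoint b := by
  intro e
  rw [← tentWord_tentPoint a N, ← tentWord_tentPoint b N, tentWord_congr h] at e
  simp only [ha, hb, tentPoint_const_zero, tentPoint_const_two] at e
  have := abs_tentWord_sub b N 0 1
  rw [e] at this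
  norm_num at this
  exact pow_ne_zero N three_ne_zero this.symm

/-- The translation by `n` on two-sided sequences. -/
def shiftBy {A : Type*} (n : ℤ) (α : ℤ → A) : ℤ → A := fun i => α (i + n)

theorem shiftBy_shiftBy {A : Type*} (m n : ℤ) (α : ℤ → A) :
    shiftBy m (shiftBy n α) = shiftBy (m + n) α :=
  funext fun i => congrArg α (add_assoc i m n)

theorem shiftBy_zero {A : Type*} (α : ℤ → A) : shiftBy 0 α = α :=
  funext fun i => congrArg α (add_zero i)

theorem continuous_shiftBy {A : Type*} [TopologicalSpace A] (n : ℤ) :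
    Continuous (shiftBy n : (ℤ → A) → ℤ → A) :=
  continuous_pi fun i => continuous_apply (i + n)

/-- The translation by `n` on two-sided sequences as a homeomorphism. -/
def shiftHomeomorph (A : Type*) [TopologicalSpace A] (n : ℤ) : (ℤ → A) ≃ₜ (ℤ → A) where
  toFun := shiftBy n
  invFun := shiftBy (-n)
  left_inv α := by rw [shiftBy_shiftBy, neg_add_cancel, shiftBy_zero]
  right_inv α := by rw [shiftBy_shiftBy, add_neg_cancel, shiftBy_zero]
  continuous_toFun := continuous_shiftBy n
  continuous_invFun := continuous_shiftBy (-n)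

/-- The point of the unit square coded by a two-sided sequence: the future gives the first
coordinate and the past the second one. -/
noncomputable def bakerPoint (α : ℤ → Fin 3) : ℝ × ℝ :=
  (tentPoint fun k : ℕ => α k, tentPoint fun k : ℕ => α (-1 - k))

theorem continuous_bakerPoint : Continuous bakerPoint :=
  (continuous_tentPoint.comp (continuous_pi fun k : ℕ => continuous_apply (k : ℤ))).prodMk
    (continuous_tentPoint.comp (continuous_pi fun k : ℕ => continuous_apply (-1 - k : ℤ)))

theorem bakerPoint_mem (α : ℤ → Fin 3) : bakerPoint α ∈ unitSquare :=
  mk_mem_unitSquare (tentPoint_mem _) (tentPoint_mem _)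

theorem bakerPoint_fst_eq (α : ℤ → Fin 3) :
    (bakerPoint α).1 = tentBranch (α 0) (bakerPoint (shiftBy 1 α)).1 := by
  change tentPoint _ = tentBranch _ (tentPoint _)
  rw [tentPoint_eq]
  rfl

theorem bakerPoint_snd_shift (α : ℤ → Fin 3) :
    (bakerPoint (shiftBy 1 α)).2 = tentBranch (α 0) (bakerPoint α).2 := by
  change tentPoint _ = tentBranch _ (tentPoint _)
  rw [tentPoint_eq]
  have h0 : shiftBy 1 α (-1 - (0 : ℕ)) = α 0 := by simp [shiftBy]
  have h1 : (fun k : ℕ => shiftBy 1 α (-1 - (k + 1 : ℕ))) = fun k : ℕ => α (-1 - k) := by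
    funext k
    simp only [shiftBy]
    congr 1
    push_cast
    ring
  rw [h0, h1]

theorem exists_bakerPoint_eq {q : ℝ × ℝ} (hq : q ∈ unitSquare) : ∃ α, bakerPoint α = q := by
  obtain ⟨a, ha⟩ := exists_tentPoint_eq hq.1
  obtain ⟨b, hb⟩ := exists_tentPoint_eq hq.2
  refine ⟨fun i => if 0 ≤ i then a i.toNat else b (-1 - i).toNat, Prod.ext ?_ ?_⟩
  · rw [← ha]
    simp [bakerPoint]
  · rw [← hb]
    refine congrArg tentPoint (funext fun k => ?_)
    have : ¬ (0 : ℤ) ≤ -1 - (k : ℤ) := by omega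
    simp only [this, if_false]
    congr 1
    omega

/-- The point of the sphere coded by a two-sided sequence. -/
noncomputable def spherePoint (α : ℤ → Fin 3) : OnePoint (ℝ × ℝ) := squareFold (bakerPoint α)

theorem continuous_spherePoint : Continuous spherePoint :=
  continuousOn_squareFold.comp_continuous continuous_bakerPoint bakerPoint_mem

theorem spherePoint_surjective : Function.Surjective spherePoint := fun z => by
  obtain ⟨q, hq, rfl⟩ := exists_squareFold_eq z
  obtain ⟨α, rfl⟩ := exists_bakerPoint_eq hq
  exact ⟨α, rfl⟩

theorem spherePoint_shift {F : OnePoint (ℝ × ℝ) ≃ₜ OnePoint (ℝ × ℝ)}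
    (hF : ∀ i u y, u ∈ Icc (0 : ℝ) 1 → y ∈ Icc (0 : ℝ) 1 →
      F (squareFold (tentBranch i u, y)) = squareFold (u, tentBranch i y)) (α : ℤ → Fin 3) :
    spherePoint (shiftBy 1 α) = F (spherePoint α) := by
  have h := hF (α 0) (bakerPoint (shiftBy 1 α)).1 (bakerPoint α).2 (bakerPoint_mem _).1
    (bakerPoint_mem _).2
  rw [← bakerPoint_fst_eq, ← bakerPoint_snd_shift] at h
  exact h.symm

/-- Two-sided sequences whose whole orbit is coded by interior points of the square. -/
def interiorWords : Set (ℤ → Fin 3) :=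
  {α | ∀ n : ℤ, (bakerPoint (shiftBy n α)).1 ∈ Ioo (0 : ℝ) 1 ∧
    (bakerPoint (shiftBy n α)).2 ∈ Ioo (0 : ℝ) 1}

theorem eq_of_bakerPoint_eq {α β : ℤ → Fin 3} (hα : α ∈ interiorWords)
    (h : bakerPoint α = bakerPoint β) : α = β := by
  have h1 : (fun k : ℕ => α k) = fun k : ℕ => β k := by
    refine eq_of_tentPoint_eq (congrArg Prod.fst h) fun n => ?_
    have := (hα n).1
    simpa [bakerPoint, shiftBy] using this
  have h2 : (fun k : ℕ => α (-1 - k)) = fun k : ℕ => β (-1 - k) := by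
    refine eq_of_tentPoint_eq (congrArg Prod.snd h) fun n => ?_
    have := (hα (-n)).2
    have e : (fun k : ℕ => α (-1 - (k + n : ℕ))) = fun k : ℕ => shiftBy (-n) α (-1 - k) :=
      funext fun k => congrArg α (by push_cast; ring)
    rw [e]
    exact this
  funext i
  rcases le_or_gt 0 i with hi | hi
  · lift i to ℕ using hi
    exact congrFun h1 i
  · have := congrFun h2 (-1 - i).toNat
    rwa [Int.toNat_of_nonneg (by omega), sub_sub_cancel] at this

theorem eq_of_spherePoint_eq {α β : ℤ → Fin 3} (hα : α ∈ interiorWords)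
    (h : spherePoint α = spherePoint β) : α = β := by
  have h0 := hα 0
  rw [shiftBy_zero] at h0
  exact eq_of_bakerPoint_eq hα (eq_of_squareFold_eq h0.1 h0.2 (bakerPoint_mem β) h.symm).symm

theorem dense_of_forall_window {U : Set (ℤ → Fin 3)}
    (h : ∀ (α : ℤ → Fin 3) (N : ℕ), ∃ β ∈ U, ∀ i : ℤ, -N ≤ i → i < N → β i = α i) :
    Dense U := by
  rw [dense_iff_inter_open]
  rintro W hW ⟨α, hα⟩
  obtain ⟨I, u, hu, hsub⟩ := isOpen_pi_iff.1 hW α hα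
  obtain ⟨N, hN⟩ : ∃ N : ℕ, ∀ i ∈ I, -(N : ℤ) ≤ i ∧ i < N := by
    refine ⟨I.sup Int.natAbs + 1, fun i hi => ?_⟩
    have := Finset.le_sup (f := Int.natAbs) hi
    omega
  obtain ⟨β, hβ, hβα⟩ := h α N
  refine ⟨β, hsub fun i hi => ?_, hβ⟩
  rw [hβα i (hN i hi).1 (hN i hi).2]
  exact (hu i hi).2

theorem dense_bakerPoint_ne_of_fst (f : ℝ × ℝ → ℝ) (hf : ∀ y x x', f (x, y) = f (x', y) → x = x')
    (c : ℝ) : Dense {α | f (bakerPoint α) ≠ c} := by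
  refine dense_of_forall_window fun α N => ?_
  let w (d : Fin 3) : ℤ → Fin 3 := fun i => if i < N then α i else d
  have hw : ∀ d (i : ℤ), i < N → w d i = α i := fun d i hi => if_pos hi
  have hne : f (bakerPoint (w 0)) ≠ f (bakerPoint (w 2)) := by
    intro e
    have hs : (bakerPoint (w 0)).2 = (bakerPoint (w 2)).2 := by
      refine congrArg tentPoint (funext fun k => ?_)
      rw [hw _ _ (by omega), hw _ _ (by omega)]
    have e' : f ((bakerPoint (w 0)).1, (bakerPoint (w 0)).2) =
      f ((bakerPoint (w 2)).1, (bakerPoint (w 0)).2) := by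
        conv_rhs => rw [hs]
        exact e
    refine tentPoint_ne_of_tails _ _ N (fun k hk => ?_) (fun k => ?_) (fun k => ?_) (hf _ _ _ e')
    · rw [hw _ _ (by omega), hw _ _ (by omega)]
    · exact if_neg (by omega)
    · exact if_neg (by omega)
  by_cases h : f (bakerPoint (w 0)) = c
  · exact ⟨w 2, fun h' => hne (h.trans h'.symm), fun i _ hi => hw _ i hi⟩
  · exact ⟨w 0, h, fun i _ hi => hw _ i hi⟩

theorem dense_bakerPoint_ne_of_snd (f : ℝ × ℝ → ℝ) (hf : ∀ x y y', f (x, y) = f (x, y') → y = y')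
    (c : ℝ) : Dense {α | f (bakerPoint α) ≠ c} := by
  refine dense_of_forall_window fun α N => ?_
  let w (d : Fin 3) : ℤ → Fin 3 := fun i => if -N ≤ i then α i else d
  have hw : ∀ d (i : ℤ), -N ≤ i → w d i = α i := fun d i hi => if_pos hi
  have hne : f (bakerPoint (w 0)) ≠ f (bakerPoint (w 2)) := by
    intro e
    have hs : (bakerPoint (w 0)).1 = (bakerPoint (w 2)).1 := by
      refine congrArg tentPoint (funext fun k => ?_)
      rw [hw _ _ (by omega), hw _ _ (by omega)]
    have e' : f ((bakerPoint (w 0)).1, (bakerPoint (w 0)).2) =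
      f ((bakerPoint (w 0)).1, (bakerPoint (w 2)).2) := by
        conv_rhs => rw [hs]
        exact e
    refine tentPoint_ne_of_tails _ _ N (fun k hk => ?_) (fun k => ?_) (fun k => ?_) (hf _ _ _ e')
    · rw [hw _ _ (by omega), hw _ _ (by omega)]
    · exact if_neg (by omega)
    · exact if_neg (by omega)
  by_cases h : f (bakerPoint (w 0)) = c
  · exact ⟨w 2, fun h' => hne (h.trans h'.symm), fun i hi _ => hw _ i hi⟩
  · exact ⟨w 0, h, fun i hi _ => hw _ i hi⟩

theorem eventually_residual_bakerPoint_ne (f : ℝ × ℝ → ℝ) (hf : Continuous f)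
    (h : (∀ y x x', f (x, y) = f (x', y) → x = x') ∨ ∀ x y y', f (x, y) = f (x, y') → y = y')
    (c : ℝ) : ∀ᶠ α in residual (ℤ → Fin 3), f (bakerPoint α) ≠ c :=
  residual_of_dense_open (isOpen_ne_fun (hf.comp continuous_bakerPoint) continuous_const)
    (h.elim (fun h => dense_bakerPoint_ne_of_fst f h c) fun h => dense_bakerPoint_ne_of_snd f h c)

theorem eventually_residual_regularPoint :
    ∀ᶠ α in residual (ℤ → Fin 3), RegularPoint (bakerPoint α) := by
  simp only [RegularPoint, NotTriadic, eventually_and, eventually_countable_forall]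
  have h3 : ∀ n : ℕ, (3 : ℝ) ^ n ≠ 0 := fun n => pow_ne_zero n three_ne_zero
  refine ⟨fun n k => ?_, fun n k => ?_, fun n k => ?_, ?_⟩
  · exact eventually_residual_bakerPoint_ne (fun q => 3 ^ n * q.1) (by fun_prop)
      (.inl fun y x x' h => mul_left_cancel₀ (h3 n) h) k
  · exact eventually_residual_bakerPoint_ne (fun q => 3 ^ n * q.2) (by fun_prop)
      (.inr fun x y y' h => mul_left_cancel₀ (h3 n) h) k
  · exact eventually_residual_bakerPoint_ne (fun q => 3 ^ n * (q.1 + q.2)) (by fun_prop)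
      (.inl fun y x x' h => add_right_cancel (mul_left_cancel₀ (h3 n) h)) k
  · have := eventually_residual_bakerPoint_ne (fun q => q.1 - q.2) (by fun_prop)
      (.inl fun y x x' h => sub_left_injective h) 0
    filter_upwards [this] with α hα
    exact sub_ne_zero.1 hα

theorem dense_forall_regularPoint :
    Dense {α : ℤ → Fin 3 | ∀ n : ℤ, RegularPoint (bakerPoint (shiftBy n α))} :=
  dense_of_mem_residual (eventually_countable_forall.2 fun n =>
    (tendsto_residual_of_isOpenMap (shiftHomeomorph (Fin 3) n).continuous
      (shiftHomeomorph (Fin 3) n).isOpenMap).eventually eventually_residual_regularPoint)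

theorem spherePoint_ne_infty {α : ℤ → Fin 3} (h : RegularPoint (bakerPoint α)) :
    spherePoint α ≠ OnePoint.infty :=
  squareFold_ne_infty (h.1.mem_Ioo (bakerPoint_mem α).1) (h.2.1.mem_Ioo (bakerPoint_mem α).2)

theorem exists_dense_invariant_dirAt {F : OnePoint (ℝ × ℝ) ≃ₜ OnePoint (ℝ × ℝ)}
    (hF : ∀ i u y, u ∈ Icc (0 : ℝ) 1 → y ∈ Icc (0 : ℝ) 1 →
      F (squareFold (tentBranch i u, y)) = squareFold (u, tentBranch i y)) :
    ∃ D : Set (ℝ × ℝ), D.Countable ∧ Dense D ∧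
      (∀ v ∈ D, ∃ v' ∈ D, F v = v') ∧ (∀ v ∈ D, ∃ v' ∈ D, F v' = v) ∧
      ∀ v ∈ D, ∃ A, DirAt (fun w : ℝ × ℝ => toPlane (F w)) v A := by
  obtain ⟨C, hCs, hCc, hCd⟩ := dense_forall_regularPoint.exists_countable_dense_subset
  set C' : Set (ℤ → Fin 3) := ⋃ n : ℤ, shiftBy n '' C with hC'
  have hreg : ∀ α ∈ C', ∀ n : ℤ, RegularPoint (bakerPoint (shiftBy n α)) := by
    intro α hα n
    obtain ⟨m, β, hβ, rfl⟩ := mem_iUnion.1 hα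
    rw [shiftBy_shiftBy]
    exact hCs hβ _
  have hreg0 : ∀ α ∈ C', RegularPoint (bakerPoint α) := fun α hα => by
    simpa only [shiftBy_zero] using hreg α hα 0
  have hshift : ∀ α ∈ C', ∀ n : ℤ, shiftBy n α ∈ C' := by
    intro α hα n
    obtain ⟨m, β, hβ, rfl⟩ := mem_iUnion.1 hα
    rw [shiftBy_shiftBy]
    exact mem_iUnion.2 ⟨_, β, hβ, rfl⟩
  have hcoe : ∀ α ∈ C', ((toPlane (spherePoint α) : ℝ × ℝ) : OnePoint (ℝ × ℝ)) = spherePoint α :=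
    fun α hα => coe_toPlane (spherePoint_ne_infty (hreg0 α hα))
  have hC'd : Dense C' := hCd.mono fun α hα => mem_iUnion.2 ⟨0, α, hα, shiftBy_zero α⟩
  refine ⟨(fun α => toPlane (spherePoint α)) '' C',
    (countable_iUnion fun n => hCc.image _).image _, ?_, ?_, ?_, ?_⟩
  · have h1 : Dense (spherePoint '' C') :=
      spherePoint_surjective.denseRange.dense_image continuous_spherePoint hC'd
    refine (h1.preimage OnePoint.isOpenEmbedding_coe.isOpenMap).mono ?_
    rintro v ⟨α, hα, h⟩
    exact ⟨α, hα, by simp only [h, toPlane_coe]⟩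
  · rintro _ ⟨α, hα, rfl⟩
    refine ⟨_, ⟨_, hshift α hα 1, rfl⟩, ?_⟩
    rw [hcoe _ (hshift α hα 1), hcoe α hα, spherePoint_shift hF]
  · rintro _ ⟨α, hα, rfl⟩
    refine ⟨_, ⟨_, hshift α hα (-1), rfl⟩, ?_⟩
    rw [hcoe _ (hshift α hα (-1)), hcoe α hα, ← spherePoint_shift hF, shiftBy_shiftBy,
      add_neg_cancel, shiftBy_zero]
  · rintro _ ⟨α, hα, rfl⟩
    have e1 : bakerPoint α = (tentBranch (α 0) (bakerPoint (shiftBy 1 α)).1, (bakerPoint α).2) :=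
      Prod.ext (bakerPoint_fst_eq α) rfl
    have e2 : bakerPoint (shiftBy 1 α) =
        ((bakerPoint (shiftBy 1 α)).1, tentBranch (α 0) (bakerPoint α).2) :=
      Prod.ext rfl (bakerPoint_snd_shift α)
    have := exists_dirAt_baker hF (bakerPoint_mem (shiftBy 1 α)).1 (bakerPoint_mem α).2
      (e1 ▸ hreg0 α hα) (e2 ▸ hreg α hα 1)
    rw [← e1] at this
    exact this

/-- The uniform Bernoulli measure on two-sided sequences of three symbols. -/
noncomputable def bernoulliThree : Measure (ℤ → Fin 3) :=
  Measure.infinitePi fun _ => (PMF.uniformOfFintype (Fin 3)).toMeasure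

instance : IsProbabilityMeasure bernoulliThree := by
  unfold bernoulliThree; infer_instance

theorem bernoulliThree_pi (I : Finset ℤ) (B : ℤ → Set (Fin 3)) :
    bernoulliThree ((I : Set ℤ).pi B) =
      ∏ i ∈ I, (PMF.uniformOfFintype (Fin 3)).toMeasure (B i) :=
  Measure.infinitePi_pi _ fun _ _ => MeasurableSet.of_discrete

theorem bernoulliThree_cylinder (I : Finset ℤ) (α : ℤ → Fin 3) :
    bernoulliThree ((I : Set ℤ).pi fun i => {α i}) = (3⁻¹ : ENNReal) ^ I.card := by
  rw [bernoulliThree_pi]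
  simp

theorem bernoulliThree_eq_zero_of_infinite {S : Set ℤ} (hS : S.Infinite) (α : ℤ → Fin 3) :
    bernoulliThree {β | ∀ k ∈ S, β k = α k} = 0 := by
  have h := ENNReal.tendsto_pow_atTop_nhds_zero_of_lt_one (r := 3⁻¹)
    (ENNReal.inv_lt_one.2 (by norm_num))
  refine le_antisymm (ge_of_tendsto' h fun n => ?_) bot_le
  obtain ⟨I, hIS, rfl⟩ := hS.exists_subset_card_eq n
  rw [← bernoulliThree_cylinder I α]
  exact measure_mono fun β hβ i hi => hβ i (hIS hi)

theorem bernoulliThree_singleton (α : ℤ → Fin 3) : bernoulliThree {α} = 0 := by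
  refine measure_mono_null ?_ (bernoulliThree_eq_zero_of_infinite infinite_univ α)
  exact fun β hβ k _ => congrFun hβ k

theorem ae_interiorWords : ∀ᵐ α ∂bernoulliThree, α ∈ interiorWords := by
  have key : ∀ {S : Set ℤ}, S.Infinite → ∀ d : Fin 3,
      ∀ᵐ α ∂bernoulliThree, ¬ ∀ k ∈ S, α k = d := fun hS d => by
    rw [ae_iff]
    simpa only [not_not] using bernoulliThree_eq_zero_of_infinite hS fun _ => d
  refine ae_all_iff.2 fun n => ?_
  filter_upwards [key (Ici_infinite n) 0, key (Ici_infinite n) 2, key (Iio_infinite n) 0,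
    key (Iio_infinite n) 2] with α h1 h2 h3 h4
  have hm := bakerPoint_mem (shiftBy n α)
  have hIci : ∀ d : Fin 3, (∀ k : ℕ, shiftBy n α k = d) → ∀ k ∈ Ici n, α k = d := by
    intro d h k hk
    have := h (k - n).toNat
    rwa [Int.toNat_of_nonneg (sub_nonneg.2 hk), shiftBy, sub_add_cancel] at this
  have hIio : ∀ d : Fin 3, (∀ k : ℕ, shiftBy n α (-1 - k) = d) → ∀ k ∈ Iio n, α k = d := by
    intro d h k hk
    have hk' : k < n := hk
    have := h (n - 1 - k).toNat
    rw [Int.toNat_of_nonneg (by omega), shiftBy] at this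
    rw [← this]
    congr 1
    ring
  refine ⟨⟨hm.1.1.lt_of_ne fun e => h1 (hIci 0 ?_), hm.1.2.lt_of_ne fun e => h2 (hIci 2 ?_)⟩,
    ⟨hm.2.1.lt_of_ne fun e => h3 (hIio 0 ?_), hm.2.2.lt_of_ne fun e => h4 (hIio 2 ?_)⟩⟩
  · exact digit_eq_zero_of_tentPoint_eq_zero e.symm
  · exact digit_eq_two_of_tentPoint_eq_one e
  · exact digit_eq_zero_of_tentPoint_eq_zero e.symm
  · exact digit_eq_two_of_tentPoint_eq_one e

theorem bernoulliThree_pos {U : Set (ℤ → Fin 3)} (hU : IsOpen U) (h : U.Nonempty) :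
    0 < bernoulliThree U := by
  obtain ⟨α, hα⟩ := h
  obtain ⟨I, u, hu, hsub⟩ := isOpen_pi_iff.1 hU α hα
  have h : bernoulliThree ((I : Set ℤ).pi fun i => {α i}) ≤ bernoulliThree U :=
    measure_mono ((Set.pi_mono fun i hi => singleton_subset_iff.2 (hu i hi).2).trans hsub)
  rw [bernoulliThree_cylinder] at h
  exact (ENNReal.pow_pos (by simp) _).trans_le h

theorem measurable_shiftBy (n : ℤ) : Measurable (shiftBy n : (ℤ → Fin 3) → ℤ → Fin 3) :=
  measurable_pi_lambda _ fun i => measurable_pi_apply (i + n)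

theorem map_shiftBy_bernoulliThree (n : ℤ) :
    bernoulliThree.map (shiftBy n) = bernoulliThree := by
  refine Measure.eq_infinitePi _ fun I B hB => ?_
  rw [Measure.map_apply (measurable_shiftBy n)
    (MeasurableSet.pi I.countable_toSet fun i _ => hB i)]
  have : shiftBy n ⁻¹' (I : Set ℤ).pi B =
      ((I.map (Equiv.addRight n).toEmbedding : Finset ℤ) : Set ℤ).pi fun i => B (i - n) := by
    ext α
    simp only [Set.mem_preimage, Set.mem_pi, Finset.coe_map, Set.forall_mem_image]
    simp [shiftBy]
  rw [this, bernoulliThree_pi, Finset.prod_map]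
  simp

theorem measurableSet_interiorWords : MeasurableSet interiorWords := by
  have hc : ∀ n : ℤ, Continuous fun α => bakerPoint (shiftBy n α) := fun n =>
    continuous_bakerPoint.comp (continuous_shiftBy n)
  have : interiorWords = ⋂ n : ℤ, {α | (bakerPoint (shiftBy n α)).1 ∈ Ioo (0 : ℝ) 1 ∧
    (bakerPoint (shiftBy n α)).2 ∈ Ioo (0 : ℝ) 1} := by ext; simp [interiorWords]
  rw [this]
  refine MeasurableSet.iInter fun n => IsOpen.measurableSet ?_
  exact (isOpen_Ioo.preimage (hc n).fst).inter (isOpen_Ioo.preimage (hc n).snd)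

theorem IsPlaneBlowUp.dense_forall_ne {S : Type*} [TopologicalSpace S] [CompactSpace S]
    [T2Space S] {Ψ : S → OnePoint (ℝ × ℝ)} {E : Set (ℝ × ℝ)} {a : ℝ × ℝ → S → ℝ × ℝ}
    (h : IsPlaneBlowUp Ψ E a) (hE : E.Countable) :
    Dense {x | ∀ e ∈ E, Ψ x ≠ (e : OnePoint (ℝ × ℝ))} := by
  have h1 : Dense (⋂ e ∈ E, {x | Ψ x ≠ (e : OnePoint (ℝ × ℝ))}) := by
    refine dense_biInter_of_isOpen (fun e _ => isOpen_ne_fun h.continuous continuous_const) hE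
      fun e he x => ?_
    by_cases hx : Ψ x = (e : OnePoint (ℝ × ℝ))
    · obtain ⟨y, hy, hya, hyc⟩ := h.exists_dir_eq he (h.norm_eq_one e he x hx)
      rwa [h.injOn e he hy hx hya] at hyc
    · exact subset_closure hx
  refine h1.mono fun x hx => ?_
  simpa using hx

/-- A dense countable set of points of the sphere can be blown up so that the map of the sphere
which is semiconjugate to the shift lifts. -/
theorem IsPlaneBlowUp.exists_homeomorph_coding {S : Type*} [TopologicalSpace S] [CompactSpace S]
    {Ψ : S → OnePoint (ℝ × ℝ)} {E : Set (ℝ × ℝ)} {a : ℝ × ℝ → S → ℝ × ℝ}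
    (h : IsPlaneBlowUp Ψ E a) (hEc : E.Countable) (hEd : Dense E) :
    ∃ (H : S ≃ₜ S) (κ : (ℤ → Fin 3) → OnePoint (ℝ × ℝ)), Continuous κ ∧ Function.Surjective κ ∧
      (∀ α ∈ interiorWords, ∀ β, κ α = κ β → α = β) ∧
      ∀ x α, Ψ x = κ α → Ψ (H x) = κ (shiftBy 1 α) := by
  obtain ⟨F, hF⟩ := exists_baker_homeomorph
  obtain ⟨D, hDc, hDd, hDF, hDF', hDA⟩ := exists_dense_invariant_dirAt hF
  obtain ⟨θ, hθ, hθA⟩ := exists_homeomorph_image_eq_dirAt hDc hEc hDd hEd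
  have hsymm : ∀ v : ℝ × ℝ, θ.onePointCongr.symm (v : OnePoint (ℝ × ℝ)) =
    ((θ.symm v : ℝ × ℝ) : OnePoint (ℝ × ℝ)) := fun _ => rfl
  have hcoe : ∀ v : ℝ × ℝ, θ.onePointCongr (v : OnePoint (ℝ × ℝ)) =
    ((θ v : ℝ × ℝ) : OnePoint (ℝ × ℝ)) := fun _ => rfl
  have hG : ∀ z, (θ.onePointCongr.symm.trans (F.trans θ.onePointCongr)) z =
    θ.onePointCongr (F (θ.onePointCongr.symm z)) := fun _ => rfl
  obtain ⟨H, hH⟩ := h.exists_homeomorph (θ.onePointCongr.symm.trans (F.trans θ.onePointCongr))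
    (by
      rw [← hθ]
      rintro _ ⟨p, hp, rfl⟩
      obtain ⟨p', hp', e⟩ := hDF p hp
      exact ⟨θ p', mem_image_of_mem _ hp', by rw [hG, hsymm, θ.symm_apply_apply, e, hcoe]⟩)
    (by
      rw [← hθ]
      rintro _ ⟨p, hp, rfl⟩
      obtain ⟨p', hp', e⟩ := hDF' p hp
      exact ⟨θ p', mem_image_of_mem _ hp', by rw [hG, hsymm, θ.symm_apply_apply, e, hcoe]⟩)
    (by
      rw [← hθ]
      rintro _ ⟨p, hp, rfl⟩
      obtain ⟨p', hp', e⟩ := hDF p hp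
      obtain ⟨A, hA⟩ := hθA p hp
      obtain ⟨A', hA'⟩ := hθA p' hp'
      obtain ⟨B, hB⟩ := hDA p hp
      have hs : DirAt θ.symm (θ p) A.symm :=
        hA.symm θ.symm.continuous.continuousAt (θ.symm_apply_apply p)
          (.of_forall θ.apply_symm_apply)
      have h1 : DirAt ((fun w : ℝ × ℝ => toPlane (F w)) ∘ θ.symm) (θ p) (A.symm.trans B) :=
        .comp (by rwa [θ.symm_apply_apply]) hs
      have h2 := DirAt.comp (g := θ) (B := A')
        (by rw [Function.comp_apply, θ.symm_apply_apply, e, toPlane_coe]; exact hA') h1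
      refine ⟨_, h2.congr ?_⟩
      have ht : Tendsto (fun v : ℝ × ℝ => F ((θ.symm v : ℝ × ℝ) : OnePoint (ℝ × ℝ)))
          (𝓝 (θ p)) (𝓝 (p' : OnePoint (ℝ × ℝ))) := by
        rw [← e]
        have := (F.continuous.comp (OnePoint.continuous_coe.comp θ.symm.continuous)).tendsto (θ p)
        simpa [Function.comp_def] using this
      filter_upwards [ht.eventually (eventually_coe_toPlane p')] with v hv
      rw [hG, hsymm, ← hv, hcoe, toPlane_coe]
      rfl)
  refine ⟨H, fun α => θ.onePointCongr (spherePoint α),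
    θ.onePointCongr.continuous.comp continuous_spherePoint,
    θ.onePointCongr.surjective.comp spherePoint_surjective,
    fun α hα β e => eq_of_spherePoint_eq hα (θ.onePointCongr.injective e), fun x α e => ?_⟩
  rw [hH, hG, e, Homeomorph.symm_apply_apply]
  exact congrArg _ (spherePoint_shift hF α).symm

theorem IsPlaneBlowUp.exists_bernoulli_homeomorph {S : Type*} [TopologicalSpace S] [CompactSpace S]
    [T2Space S] [SecondCountableTopology S] [MeasurableSpace S] [BorelSpace S]
    {Ψ : S → OnePoint (ℝ × ℝ)} {E : Set (ℝ × ℝ)} {a : ℝ × ℝ → S → ℝ × ℝ}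
    (h : IsPlaneBlowUp Ψ E a) (hEc : E.Countable) (hEd : Dense E) :
    ∃ (H : S ≃ₜ S) (μ : Measure S), IsProbabilityMeasure μ ∧
      (∀ A : Set S, MeasurableSet A → μ (H ⁻¹' A) = μ A) ∧
      (∀ U : Set S, IsOpen U → U.Nonempty → 0 < μ U) ∧ IsBernoulliSystem H μ := by
  classical
  obtain ⟨H, κ, hκc, hκs, hκi, hκH⟩ := h.exists_homeomorph_coding hEc hEd
  set ν := bernoulliThree
  let r : OnePoint (ℝ × ℝ) → S := Function.surjInv h.surjective
  have hr : ∀ z, Ψ (r z) = z := Function.surjInv_eq h.surjective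
  have hfib : ∀ x y, (∀ e ∈ E, Ψ x ≠ (e : OnePoint (ℝ × ℝ))) → Ψ y = Ψ x → y = x := by
    intro x y hx e
    rcases h.fiber x y e.symm with h' | ⟨e, he, h'⟩
    · exact h'.symm
    · exact absurd h' (hx e he)
  have hrt : ∀ x, (∀ e ∈ E, Ψ x ≠ (e : OnePoint (ℝ × ℝ))) → Tendsto r (𝓝 (Ψ x)) (𝓝 x) :=
    fun x hx => tendsto_section_of_unique_fiber isCompact_univ h.continuous.continuousOn
      (fun _ => mem_univ _) hr fun y _ e => hfib x y hx e
  let M : Set (ℤ → Fin 3) := interiorWords ∩ ⋂ e ∈ E, {α | κ α ≠ (e : OnePoint (ℝ × ℝ))}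
  have hM : MeasurableSet M := measurableSet_interiorWords.inter
    (.biInter hEc fun e _ => (isOpen_ne_fun hκc continuous_const).measurableSet)
  have hMi : ∀ α ∈ M, α ∈ interiorWords := fun α hα => hα.1
  have hME : ∀ α ∈ M, ∀ e ∈ E, κ α ≠ (e : OnePoint (ℝ × ℝ)) := fun α hα e he =>
    mem_iInter₂.1 hα.2 e he
  have hMae : ∀ᵐ α ∂ν, α ∈ M := by
    have h1 : ∀ᵐ α ∂ν, ∀ e ∈ E, κ α ≠ (e : OnePoint (ℝ × ℝ)) := by
      refine (ae_ball_iff hEc).2 fun e _ => ?_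
      by_cases hex : ∃ α₀ ∈ interiorWords, κ α₀ = (e : OnePoint (ℝ × ℝ))
      · obtain ⟨α₀, hα₀, he⟩ := hex
        have h2 : ∀ᵐ α ∂ν, α ≠ α₀ := by
          rw [ae_iff]
          simpa using bernoulliThree_singleton α₀
        filter_upwards [h2] with α hα h3
        exact hα (hκi α₀ hα₀ α (he.trans h3.symm)).symm
      · filter_upwards [ae_interiorWords] with α hα h3
        exact hex ⟨α, hα, h3⟩
    filter_upwards [ae_interiorWords, h1] with α hα hα'
    exact ⟨hα, mem_iInter₂.2 hα'⟩
  let φ : (ℤ → Fin 3) → S := M.piecewise (fun α => r (κ α)) fun _ => r OnePoint.infty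
  have hφM : ∀ α ∈ M, φ α = r (κ α) := fun α hα => piecewise_eq_of_mem M _ _ hα
  have hΨφ : ∀ α ∈ M, Ψ (φ α) = κ α := fun α hα => by rw [hφM α hα, hr]
  have hφ : Measurable φ := by
    refine ContinuousOn.measurable_piecewise (fun α hα => ?_) continuousOn_const hM
    have h1 := hrt (r (κ α)) (by rw [hr]; exact hME α hα)
    rw [hr] at h1
    exact (h1.comp (hκc.tendsto α)).mono_left nhdsWithin_le_nhds
  have hφi : Function.Injective fun α : M => φ α := fun α β e => by
    refine Subtype.ext (hκi _ (hMi _ α.2) _ ?_)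
    rw [← hΨφ _ α.2, ← hΨφ _ β.2]
    exact congrArg Ψ e
  have := hM.standardBorel
  obtain ⟨ψ, hψ, hψφ⟩ := ((hφ.comp measurable_subtype_coe).measurableEmbedding
    hφi).exists_measurable_extend (g := (Subtype.val : M → ℤ → Fin 3)) measurable_subtype_coe
    fun _ => ⟨0⟩
  have hψφ : ∀ α ∈ M, ψ (φ α) = α := fun α hα => congrFun hψφ ⟨α, hα⟩
  have hψφae : ∀ᵐ α ∂ν, ψ (φ α) = α := hMae.mono hψφ
  have hshift : MeasurePreserving (shiftBy 1) ν ν :=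
    ⟨measurable_shiftBy 1, map_shiftBy_bernoulliThree 1⟩
  have hconj : ∀ᵐ α ∂ν, φ (shiftBy 1 α) = H (φ α) := by
    filter_upwards [hMae, hshift.quasiMeasurePreserving.ae hMae] with α hα hα'
    refine (hfib _ _ ?_ ?_).symm
    · rw [hΨφ _ hα']; exact hME _ hα'
    · rw [hΨφ _ hα', hκH _ α (hΨφ α hα)]
  have hHm : Measurable H := H.continuous.measurable
  refine ⟨H, ν.map φ, Measure.isProbabilityMeasure_map hφ.aemeasurable, fun A hA => ?_,
    fun U hU hne => ?_, Fin 3, inferInstance, (PMF.uniformOfFintype (Fin 3)).toMeasure, ν,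
    PMF.toMeasure.isProbabilityMeasure _, inferInstance, fun I B => ?_, φ, hφ, ⟨hφ, rfl⟩,
    ⟨ψ, hψ, ⟨hψ, ?_⟩, hψφae, ?_⟩, hconj⟩
  · rw [← Measure.map_apply hHm hA, Measure.map_map hHm hφ,
      ← Measure.map_congr (f := φ ∘ shiftBy 1) (g := H ∘ φ) hconj,
      ← Measure.map_map hφ (measurable_shiftBy 1), hshift.map_eq]
  · obtain ⟨x, hxU, hx⟩ := (h.dense_forall_ne hEc).inter_open_nonempty U hU hne
    obtain ⟨α, hα⟩ := hκs (Ψ x)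
    have h1 : ∀ᶠ β in 𝓝 α, r (κ β) ∈ U :=
      ((hα ▸ hrt x hx : Tendsto r (𝓝 (κ α)) (𝓝 x)).comp (hκc.tendsto α)).eventually
        (hU.mem_nhds hxU)
    obtain ⟨W, hWU, hW, hαW⟩ := mem_nhds_iff.1 h1
    rw [Measure.map_apply hφ hU.measurableSet]
    refine (bernoulliThree_pos hW ⟨α, hαW⟩).trans_le (measure_mono_ae ?_)
    filter_upwards [hMae] with β hβ hβW
    change φ β ∈ U
    rw [hφM β hβ]
    exact hWU hβW
  · exact bernoulliThree_pi I B
  · rw [Measure.map_map hψ hφ, Measure.map_congr (f := ψ ∘ φ) (g := id) hψφae, Measure.map_id]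
  · refine (ae_map_iff hφ.aemeasurable (measurableSet_eq_fun (hφ.comp hψ) measurable_id)).2 ?_
    filter_upwards [hψφae] with α hα
    simp [hα]

/-- The Sierpiński carpet admits a homeomorphism `H` with a fully supported invariant Borel
probability measure `μ` such that `(S, H, μ)` is Bernoulli. -/
theorem sierpinskiCarpet_bernoulli_homeo :
    ∃ (H : ↥sierpinskiCarpet ≃ₜ ↥sierpinskiCarpet) (μ : Measure ↥sierpinskiCarpet),
      IsProbabilityMeasure μ ∧
      (∀ A : Set ↥sierpinskiCarpet, MeasurableSet A → μ (⇑H ⁻¹' A) = μ A) ∧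
      (∀ U : Set ↥sierpinskiCarpet, IsOpen U → U.Nonempty → 0 < μ U) ∧
      IsBernoulliSystem (⇑H) μ := by
  have := isCompact_iff_compactSpace.1 isCompact_sierpinskiCarpet
  obtain ⟨Ψ, E, a, h, hEc, hEd⟩ := exists_isPlaneBlowUp_sierpinskiCarpet
  exact h.exists_bernoulli_homeomorph hEc hEd
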